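/- Let G be a finite group with |G| = |L₃(37)| = 2⁵·3⁴·7·19·37³·67 and degree pattern D(G) = D(L₃(37)) = (3,3,1,2,2,1), i.e., deg_G(2)=3, deg_G(3)=3, deg_G(7)=1, deg_G(19)=2, deg_G(37)=2, deg_G(67)=1. Then G is isomorphic to L₃(37). -/

import Mathlib

open scoped MatrixGroups

/-- Two distinct primes `p` and `q` dividing `|G|` are adjacent in the prime graph `Γ(G)`
of a finite group `G` iff `G` has an element of order `p * q`. -/
def primeGraphAdj (G : Type*) [Group G] (p q : ℕ) : Prop :=
  p ≠ q ∧ p.Prime ∧ q.Prime ∧ p ∣ Nat.card G ∧ q ∣ Nat.card G ∧ ∃ g : G, orderOf g = p * q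

open scoped Classical in
/-- The degree of a vertex `p` in the prime graph of `G`: the number of primes dividing `|G|`
that are adjacent to `p`. -/
noncomputable def primeGraphDeg (G : Type*) [Group G] (p : ℕ) : ℕ :=
  ((Nat.card G).primeFactors.filter (fun r => primeGraphAdj G p r)).card


open scoped Pointwise

namespace OD

section basics
variable {G : Type*} [Group G]

/-- conjugation action on subgroups -/
@[reducible] def conjAction : MulAction G (Subgroup G) := MulAction.compHom _ MulAut.conj

attribute [local instance] conjAction

theorem conj_mem_iff (g x : G) (H : Subgroup G) : x ∈ g • H ↔ g⁻¹ * x * g ∈ H := by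
  change x ∈ MulAut.conj g • H ↔ _
  rw [Subgroup.mem_pointwise_smul_iff_inv_smul_mem, ← map_inv]
  simp [MulAut.smul_def]

theorem conj_mem_conj (g x : G) (H : Subgroup G) (hx : x ∈ H) : g * x * g⁻¹ ∈ g • H := by
  rw [conj_mem_iff]; simpa [mul_assoc] using hx

theorem conj_card (g : G) (H : Subgroup G) : Nat.card (g • H : Subgroup G) = Nat.card H := by
  change Nat.card (MulAut.conj g • H : Subgroup G) = _
  exact (Nat.card_congr (Subgroup.equivSMul (MulAut.conj g) H).toEquiv).symm

theorem conj_mono (g : G) {H K : Subgroup G} (h : H ≤ K) : g • H ≤ g • K := by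
  intro x hx; rw [conj_mem_iff] at *; exact h hx

theorem conj_le_of_mem {H K : Subgroup G} (h : H ≤ K) {g : G} (hg : g ∈ K) : g • H ≤ K := by
  intro x hx; rw [conj_mem_iff] at hx
  have := K.mul_mem (K.mul_mem hg (h hx)) (K.inv_mem hg)
  simpa [mul_assoc] using this

theorem conj_eq_iff_mem_normalizer (g : G) (H : Subgroup G) :
    g • H = H ↔ g ∈ Subgroup.normalizer (H : Set G) := by
  rw [← Subgroup.inv_mem_iff, Subgroup.mem_normalizer_iff, SetLike.ext_iff]
  refine forall_congr' fun x => ?_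
  rw [conj_mem_iff, inv_inv]
  exact iff_comm

theorem mem_normalizer_of_forall [Finite G] {g : G} {H : Subgroup G}
    (h : ∀ x ∈ H, g * x * g⁻¹ ∈ H) : g ∈ Subgroup.normalizer (H : Set G) := by
  rw [← conj_eq_iff_mem_normalizer]
  have hle : g • H ≤ H := by
    intro x hx
    rw [conj_mem_iff] at hx
    have := h _ hx
    simpa [mul_assoc] using this
  exact Subgroup.eq_of_le_of_card_ge hle (conj_card g H).ge

theorem conj_centralizer (g : G) (H : Subgroup G) :
    g • Subgroup.centralizer (H : Set G) = Subgroup.centralizer ((g • H : Subgroup G) : Set G) := by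
  ext x
  rw [conj_mem_iff, Subgroup.mem_centralizer_iff, Subgroup.mem_centralizer_iff]
  constructor
  · intro h y hy
    rw [SetLike.mem_coe, conj_mem_iff] at hy
    have := h _ hy
    have h2 : g * (g⁻¹ * y * g * (g⁻¹ * x * g)) * g⁻¹ = g * (g⁻¹ * x * g * (g⁻¹ * y * g)) * g⁻¹ := by
      rw [this]
    simpa [mul_assoc] using h2
  · intro h y hy
    have := h _ (conj_mem_conj g y H hy)
    have h2 : g⁻¹ * (g * y * g⁻¹ * x) * g = g⁻¹ * (x * (g * y * g⁻¹)) * g := by rw [this]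
    simpa [mul_assoc] using h2

theorem conj_normalizer (g : G) (H : Subgroup G) :
    g • Subgroup.normalizer (H : Set G) = Subgroup.normalizer ((g • H : Subgroup G) : Set G) := by
  ext x
  rw [conj_mem_iff, ← conj_eq_iff_mem_normalizer, ← conj_eq_iff_mem_normalizer, mul_smul, mul_smul,
    inv_smul_eq_iff]

theorem conj_inf (g : G) (H K : Subgroup G) : g • (H ⊓ K) = (g • H) ⊓ (g • K) := by
  ext x; simp only [conj_mem_iff, Subgroup.mem_inf]

theorem normalizer_le_normalizer_centralizer (H : Subgroup G) :
    Subgroup.normalizer (H : Set G) ≤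
      Subgroup.normalizer ((Subgroup.centralizer (H : Set G) : Subgroup G) : Set G) := by
  intro g hg
  rw [← conj_eq_iff_mem_normalizer] at *
  rw [conj_centralizer, hg]

theorem centralizer_le_normalizer (H : Subgroup G) :
    Subgroup.centralizer (H : Set G) ≤ Subgroup.normalizer (H : Set G) := by
  intro g hg
  rw [Subgroup.mem_normalizer_iff]
  intro h
  rw [Subgroup.mem_centralizer_iff] at hg
  constructor
  · intro hh
    have := hg h hh
    rw [← this]; simpa using hh
  · intro hh
    have := hg _ hh
    have h2 : g * h * g⁻¹ = h := by
      have h3 : g⁻¹ * (g * h * g⁻¹ * g) = g⁻¹ * (g * (g * h * g⁻¹)) := by rw [this]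
      simp [mul_assoc] at h3
      conv_rhs => rw [h3]
      simp [mul_assoc]
    rw [h2] at hh; exact hh

theorem card_inf_dvd_left [Finite G] (H K : Subgroup G) : Nat.card (H ⊓ K : Subgroup G) ∣ Nat.card H :=
  Subgroup.card_dvd_of_le inf_le_left

variable [Finite G]

theorem exists_sylow {p k m : ℕ} [Fact p.Prime] (H S : Subgroup G) (hS : S ≤ H)
    (hSc : Nat.card S = p ^ k) (hH : Nat.card H = p ^ k * m) (hpm : ¬ p ∣ m) :
    ∃ P : Sylow p H, (P : Subgroup H) = S.subgroupOf H := by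
  have hpp : p.Prime := Fact.out
  have hm : m ≠ 0 := by rintro rfl; simp at hpm
  refine ⟨Sylow.ofCard (S.subgroupOf H) ?_, Sylow.coe_ofCard _ _⟩
  rw [Nat.card_congr (Subgroup.subgroupOfEquivOfLe hS).toEquiv, hSc, hH,
    Nat.factorization_mul (pow_ne_zero _ hpp.ne_zero) hm]
  simp [hpp.factorization, Nat.factorization_eq_zero_of_not_dvd hpm]

theorem sylow_conj {p k m : ℕ} [Fact p.Prime] (H S T : Subgroup G) (hS : S ≤ H) (hT : T ≤ H)
    (hSc : Nat.card S = p ^ k) (hTc : Nat.card T = p ^ k)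
    (hH : Nat.card H = p ^ k * m) (hpm : ¬ p ∣ m) :
    ∃ h ∈ H, h • S = T := by
  obtain ⟨P, hP⟩ := exists_sylow H S hS hSc hH hpm
  obtain ⟨Q, hQ⟩ := exists_sylow H T hT hTc hH hpm
  obtain ⟨h, hh⟩ := MulAction.exists_smul_eq H P Q
  refine ⟨h, h.2, ?_⟩
  have h1 : (↑(h • P) : Subgroup H) = Q := by rw [hh]
  rw [Sylow.coe_subgroup_smul, hP, hQ] at h1
  have key : ∀ x ∈ S, (h : G) * x * (h : G)⁻¹ ∈ T := by
    intro x hx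
    have : MulAut.conj h • (⟨x, hS hx⟩ : H) ∈ (MulAut.conj h • S.subgroupOf H : Subgroup H) :=
      Subgroup.smul_mem_pointwise_smul _ _ _ (by simpa [Subgroup.mem_subgroupOf] using hx)
    rw [h1] at this
    simpa [Subgroup.mem_subgroupOf, MulAut.smul_def] using this
  apply Subgroup.eq_of_le_of_card_ge
  · intro x hx
    rw [conj_mem_iff] at hx
    have := key _ hx
    simpa [mul_assoc] using this
  · rw [conj_card, hSc, hTc]

/-- number of conjugates under H -/
theorem orbit_card (H S : Subgroup G) :
    Nat.card H = Nat.card (MulAction.orbit H S) * Nat.card (H ⊓ Subgroup.normalizer (S : Set G) : Subgroup G) := by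
  have h := (MulAction.stabilizer H S).index_mul_card
  rw [MulAction.index_stabilizer, ← Nat.card_coe_set_eq] at h
  rw [← h]
  congr 1
  have : MulAction.stabilizer H S = (Subgroup.normalizer (S : Set G)).subgroupOf H := by
    ext x
    rw [MulAction.mem_stabilizer_iff, Subgroup.mem_subgroupOf, ← conj_eq_iff_mem_normalizer]
    rfl
  rw [this, ← Subgroup.inf_subgroupOf_left]
  exact Nat.card_congr (Subgroup.subgroupOfEquivOfLe inf_le_left).toEquiv

/-- the set of subgroups of order n in H -/
def subs (H : Subgroup G) (n : ℕ) : Set (Subgroup G) := {S | S ≤ H ∧ Nat.card S = n}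

theorem subs_eq_orbit {p k m : ℕ} [Fact p.Prime] (H S : Subgroup G) (hS : S ≤ H)
    (hSc : Nat.card S = p ^ k) (hH : Nat.card H = p ^ k * m) (hpm : ¬ p ∣ m) :
    subs H (p ^ k) = MulAction.orbit H S := by
  ext T
  constructor
  · rintro ⟨h1, h2⟩
    obtain ⟨h, hh, rfl⟩ := sylow_conj H S T hS h1 hSc h2 hH hpm
    exact ⟨⟨h, hh⟩, rfl⟩
  · rintro ⟨h, rfl⟩
    exact ⟨conj_le_of_mem hS h.2, (conj_card (h : G) S).trans hSc⟩

theorem card_subs_modEq {p k m : ℕ} [Fact p.Prime] (H S : Subgroup G) (hS : S ≤ H)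
    (hSc : Nat.card S = p ^ k) (hH : Nat.card H = p ^ k * m) (hpm : ¬ p ∣ m) :
    Nat.card (subs H (p ^ k)) ≡ 1 [MOD p] := by
  have hpp : p.Prime := Fact.out
  -- S acts on subs, sole fixed point S
  let A : MulAction S (subs H (p ^ k)) :=
    { smul := fun s T => ⟨(s : G) • (T : Subgroup G), conj_le_of_mem T.2.1 (hS s.2),
        (conj_card _ _).trans T.2.2⟩
      one_smul := fun T => Subtype.ext (one_smul G _)
      mul_smul := fun s t T => Subtype.ext (mul_smul (s : G) (t : G) (T : Subgroup G)) }
  have h := (IsPGroup.of_card hSc).card_modEq_card_fixedPoints (subs H (p ^ k))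
  refine h.trans ?_
  have : MulAction.fixedPoints S (subs H (p ^ k)) = {⟨S, hS, hSc⟩} := by
    ext ⟨T, hT, hTc⟩
    rw [MulAction.mem_fixedPoints, Set.mem_singleton_iff]
    constructor
    · intro hfix
      have hn : S ≤ Subgroup.normalizer (T : Set G) := by
        intro s hs
        rw [← conj_eq_iff_mem_normalizer]
        exact congrArg Subtype.val (hfix ⟨s, hs⟩)
      have hTn : T ≤ Subgroup.normalizer (T : Set G) := Subgroup.le_normalizer
      have hc : Nat.card (H ⊓ Subgroup.normalizer (T : Set G) : Subgroup G) ∣ p ^ k * m := by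
        rw [← hH]; exact card_inf_dvd_left _ _
      have hc2 : p ^ k ∣ Nat.card (H ⊓ Subgroup.normalizer (T : Set G) : Subgroup G) := by
        rw [← hSc]; exact Subgroup.card_dvd_of_le (le_inf hS hn)
      obtain ⟨c, hc3⟩ := hc2
      rw [hc3] at hc
      have hcm : c ∣ m := Nat.dvd_of_mul_dvd_mul_left (pow_pos hpp.pos k) hc
      obtain ⟨h, hh, h1⟩ := sylow_conj _ S T (le_inf hS hn) (le_inf hT hTn) hSc hTc hc3
        (fun hd => hpm (hd.trans hcm))
      obtain ⟨h', hh', h2⟩ := sylow_conj _ T S (le_inf hT hTn) (le_inf hS hn) hTc hSc hc3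
        (fun hd => hpm (hd.trans hcm))
      rw [Subgroup.mem_inf, ← conj_eq_iff_mem_normalizer] at hh'
      exact Subtype.ext (hh'.2.symm.trans h2)
    · intro hTS s
      obtain rfl : T = S := congrArg Subtype.val hTS
      apply Subtype.ext
      change (s : G) • T = T
      rw [conj_eq_iff_mem_normalizer]
      exact Subgroup.le_normalizer s.2
  rw [this]
  simp [Nat.ModEq.refl]

/-- Sylow counting inside a subgroup. -/
theorem syl_count {p k m : ℕ} [Fact p.Prime] (H S : Subgroup G) (hS : S ≤ H)
    (hSc : Nat.card S = p ^ k) (hH : Nat.card H = p ^ k * m) (hpm : ¬ p ∣ m) :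
    ∃ c, Nat.card H = c * Nat.card (H ⊓ Subgroup.normalizer (S : Set G) : Subgroup G) ∧ c ≡ 1 [MOD p] ∧
      Nat.card (subs H (p ^ k)) = c := by
  refine ⟨Nat.card (subs H (p ^ k)), ?_, card_subs_modEq H S hS hSc hH hpm, rfl⟩
  rw [subs_eq_orbit H S hS hSc hH hpm]
  exact orbit_card H S

theorem exists_sub {p k m : ℕ} [Fact p.Prime] (H : Subgroup G)
    (hH : Nat.card H = p ^ k * m) : ∃ S ≤ H, Nat.card S = p ^ k := by
  obtain ⟨S, hS⟩ := Sylow.exists_subgroup_card_pow_prime (G := H) p (n := k) ⟨m, hH⟩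
  refine ⟨S.map H.subtype, Subgroup.map_subtype_le S, ?_⟩
  rw [← hS]
  exact (Nat.card_congr (Subgroup.equivMapOfInjective S H.subtype H.subtype_injective).toEquiv).symm

/-- coprime-type action fixed point count -/
theorem fix_count {p k : ℕ} [Fact p.Prime] (Q K : Subgroup G) (hQ : Nat.card Q = p ^ k)
    (hQK : Q ≤ Subgroup.normalizer (K : Set G)) :
    Nat.card K ≡ Nat.card (K ⊓ Subgroup.centralizer (Q : Set G) : Subgroup G) [MOD p] := by
  let A : MulAction Q K :=
    { smul := fun q x => ⟨q * x * (q : G)⁻¹, (Subgroup.mem_normalizer_iff.1 (hQK q.2) x).1 x.2⟩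
      one_smul := fun x => Subtype.ext (by change (1 : G) * x * (1 : G)⁻¹ = x; simp)
      mul_smul := fun s t x => Subtype.ext (by
        change ((s * t : Q) : G) * x * ((s * t : Q) : G)⁻¹ = s * (t * x * (t : G)⁻¹) * (s : G)⁻¹
        simp [mul_assoc]) }
  have h := (IsPGroup.of_card hQ).card_modEq_card_fixedPoints K
  refine h.trans ?_
  have e : MulAction.fixedPoints Q K ≃ (K ⊓ Subgroup.centralizer (Q : Set G) : Subgroup G) :=
    { toFun := fun x => ⟨x.1, x.1.2, by
        refine Subgroup.mem_centralizer_iff.2 ?_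
        intro q hq
        have h1 : q * (x.1 : G) * q⁻¹ = x.1 := congrArg Subtype.val (x.2 ⟨q, hq⟩)
        rwa [mul_inv_eq_iff_eq_mul] at h1⟩
      invFun := fun x => ⟨⟨x.1, x.2.1⟩, fun q => Subtype.ext (by
        have h1 := (Subgroup.mem_centralizer_iff.1 x.2.2) q q.2
        change (q : G) * (x.1 : G) * (q : G)⁻¹ = x.1
        rw [mul_inv_eq_iff_eq_mul]; exact h1)⟩
      left_inv := fun x => rfl
      right_inv := fun x => rfl }
  rw [Nat.card_congr e]

end basics
end OD


open scoped Pointwise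

namespace OD

section basics2
variable {G : Type*} [Group G] [Finite G]

attribute [local instance] conjAction

theorem exists_fixed_sub {p k n : ℕ} [Fact p.Prime] (H S : Subgroup G) (hSc : Nat.card S = p ^ k)
    (hSH : S ≤ Subgroup.normalizer (H : Set G)) (hn : ¬ p ∣ Nat.card (subs H n)) :
    ∃ Q ≤ H, Nat.card Q = n ∧ S ≤ Subgroup.normalizer (Q : Set G) := by
  let A : MulAction S (subs H n) :=
    { smul := fun s T => ⟨(s : G) • (T : Subgroup G),
        (conj_mono (s : G) T.2.1).trans (((conj_eq_iff_mem_normalizer (s : G) H).2 (hSH s.2)).le),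
        (conj_card _ _).trans T.2.2⟩
      one_smul := fun T => Subtype.ext (one_smul G _)
      mul_smul := fun s t T => Subtype.ext (mul_smul (s : G) (t : G) (T : Subgroup G)) }
  obtain ⟨Q, hQ⟩ := (IsPGroup.of_card hSc).nonempty_fixed_point_of_prime_not_dvd_card (subs H n) hn
  refine ⟨Q, Q.2.1, Q.2.2, fun s hs => ?_⟩
  rw [← conj_eq_iff_mem_normalizer]
  exact congrArg Subtype.val (hQ ⟨s, hs⟩)

/-- one-prime version of lemma A -/
theorem lemmaA_aux {r a j k m m' : ℕ} [Fact r.Prime] [Fact (Nat.Prime 37)] (S H D : Subgroup G)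
    (hSc : Nat.card S = 37 ^ k) (hSH : S ≤ Subgroup.normalizer (H : Set G)) (hDH : D ≤ H)
    (hHD : H ≤ Subgroup.centralizer (D : Set G)) (hDc : Nat.card D = 37 ^ j)
    (hH : Nat.card H = 37 ^ j * m) (hm : m = r ^ a * m') (hrm : ¬ r ∣ m')
    (hr37 : r ≠ 37) (h37 : ¬ 37 ∣ m)
    (hpow : ∀ b ≤ a, r ^ a ≡ r ^ b [MOD 37] → b = a) :
    r ^ a ∣ Nat.card (H ⊓ Subgroup.centralizer (S : Set G) : Subgroup G) := by
  have hr : r.Prime := Fact.out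
  have h37p : Nat.Prime 37 := Fact.out
  have hH2 : Nat.card H = r ^ a * (37 ^ j * m') := by rw [hH, hm]; ring
  have hnd : ¬ r ∣ 37 ^ j * m' := by
    intro h
    rcases hr.dvd_mul.1 h with h | h
    · exact hr37 ((Nat.prime_dvd_prime_iff_eq hr h37p).1 (hr.dvd_of_dvd_pow h))
    · exact hrm h
  obtain ⟨Q0, hQ0, hQ0c⟩ := exists_sub (p := r) H hH2
  obtain ⟨c, hc1, hc2, hc3⟩ := syl_count H Q0 hQ0 hQ0c hH2 hnd
  have hDN : D ≤ H ⊓ Subgroup.normalizer (Q0 : Set G) := by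
    refine le_inf hDH fun d hd => centralizer_le_normalizer Q0 ?_
    rw [Subgroup.mem_centralizer_iff]
    intro q hq
    exact ((Subgroup.mem_centralizer_iff.1 (hHD (hQ0 hq))) d hd).symm
  have hcm : c ∣ m := by
    obtain ⟨e, he⟩ := Subgroup.card_dvd_of_le hDN
    rw [he, hH, hDc] at hc1
    refine ⟨e, ?_⟩
    have : 37 ^ j * m = 37 ^ j * (c * e) := by rw [hc1]; ring
    exact Nat.eq_of_mul_eq_mul_left (by positivity) this
  obtain ⟨Q, hQH, hQc, hQS⟩ := exists_fixed_sub H S hSc hSH (n := r ^ a)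
    (by rw [hc3]; exact fun h => h37 (h.trans hcm))
  have hf := fix_count S Q hSc hQS
  obtain ⟨b, hb, hb2⟩ := (Nat.dvd_prime_pow hr).1 (hQc ▸ card_inf_dvd_left Q (Subgroup.centralizer (S : Set G)))
  rw [hQc, hb2] at hf
  have := hpow b hb hf
  rw [← this, ← hb2]
  exact Subgroup.card_dvd_of_le (inf_le_inf_right _ hQH)

theorem lemmaA {j k m : ℕ} (S H D : Subgroup G)
    (hSc : Nat.card S = 37 ^ k) (hSH : S ≤ Subgroup.normalizer (H : Set G)) (hDH : D ≤ H)
    (hHD : H ≤ Subgroup.centralizer (D : Set G)) (hDc : Nat.card D = 37 ^ j)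
    (hH : Nat.card H = 37 ^ j * m) (hm : m ∣ 2592) :
    m ∣ Nat.card (H ⊓ Subgroup.centralizer (S : Set G) : Subgroup G) := by
  haveI : Fact (Nat.Prime 37) := ⟨by norm_num⟩
  haveI : Fact (Nat.Prime 2) := ⟨by norm_num⟩
  haveI : Fact (Nat.Prime 3) := ⟨by norm_num⟩
  obtain ⟨a, b, ha, hb, hab⟩ : ∃ a b, a ≤ 5 ∧ b ≤ 4 ∧ m = 2 ^ a * 3 ^ b := by
    have hm' : m ∣ 2 ^ 5 * 3 ^ 4 := by simpa using hm
    obtain ⟨x, y, hx, hy, rfl⟩ := (Nat.dvd_mul.1 hm')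
    obtain ⟨a, ha, rfl⟩ := (Nat.dvd_prime_pow Nat.prime_two).1 hx
    obtain ⟨b, hb, rfl⟩ := (Nat.dvd_prime_pow Nat.prime_three).1 hy
    exact ⟨a, b, ha, hb, rfl⟩
  have h37 : ¬ 37 ∣ m := fun h => absurd (h.trans hm) (by norm_num)
  have h2 : 2 ^ a ∣ Nat.card (H ⊓ Subgroup.centralizer (S : Set G) : Subgroup G) := by
    refine lemmaA_aux S H D hSc hSH hDH hHD hDc hH hab ?_ (by norm_num) h37 ?_
    · intro h; have := Nat.prime_two.dvd_of_dvd_pow h; omega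
    · intro c hc h
      interval_cases a <;> interval_cases c <;> first | rfl | (exfalso; revert h; decide)
  have h3 : 3 ^ b ∣ Nat.card (H ⊓ Subgroup.centralizer (S : Set G) : Subgroup G) := by
    refine lemmaA_aux S H D hSc hSH hDH hHD hDc hH (hab.trans (mul_comm _ _)) ?_ (by norm_num) h37 ?_
    · intro h; have := Nat.prime_three.dvd_of_dvd_pow h; omega
    · intro c hc h
      interval_cases b <;> interval_cases c <;> first | rfl | (exfalso; revert h; decide)
  rw [hab]
  exact Nat.Coprime.mul_dvd_of_dvd_of_dvd (Nat.Coprime.pow _ _ (by norm_num)) h2 h3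

theorem lemmaB {k m : ℕ} (H S : Subgroup G) (hS : S ≤ H)
    (hSc : Nat.card S = 37 ^ k) (hH : Nat.card H = 37 ^ k * m) (hm : m ∣ 2592)
    (hN : H ⊓ Subgroup.normalizer (S : Set G) ≤ Subgroup.centralizer (S : Set G)) :
    H ≤ Subgroup.normalizer (S : Set G) := by
  haveI : Fact (Nat.Prime 37) := ⟨by norm_num⟩
  have h37 : ¬ 37 ∣ m := fun h => absurd (h.trans hm) (by norm_num)
  obtain ⟨P, hP⟩ := exists_sylow H S hS hSc hH h37
  have hPN : Subgroup.normalizer ((P : Subgroup H) : Set H) ≤ Subgroup.centralizer ((P : Subgroup H) : Set H) := by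
    rw [hP]
    intro x hx
    rw [Subgroup.mem_centralizer_iff]
    intro y hy
    have hxN : (x : G) ∈ Subgroup.normalizer (S : Set G) := by
      apply mem_normalizer_of_forall
      intro s hs
      have := (Subgroup.mem_normalizer_iff.1 hx ⟨s, hS hs⟩).1 (by simpa [Subgroup.mem_subgroupOf] using hs)
      simpa [Subgroup.mem_subgroupOf] using this
    have hc := hN ⟨x.2, hxN⟩
    exact Subtype.ext (Subgroup.mem_centralizer_iff.1 hc y hy)
  have hcomp := MonoidHom.ker_transferSylow_isComplement' P hPN
  set K' := (MonoidHom.transferSylow P hPN).ker with hK'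
  have hPc : Nat.card P = 37 ^ k := by
    rw [← hSc]
    change Nat.card (P : Subgroup H) = _
    rw [hP]; exact Nat.card_congr (Subgroup.subgroupOfEquivOfLe hS).toEquiv
  have hK'c : Nat.card K' = m := by
    have := hcomp.card_mul
    rw [hH] at this
    change Nat.card K' * Nat.card P = _ at this
    rw [hPc, mul_comm] at this
    exact Nat.eq_of_mul_eq_mul_left (by positivity) this
  have hKc : Nat.card (K'.map H.subtype) = m := by
    rw [← hK'c]
    exact (Nat.card_congr (Subgroup.equivMapOfInjective K' H.subtype H.subtype_injective).toEquiv).symm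
  have hKN : H ≤ Subgroup.normalizer ((K'.map H.subtype : Subgroup G) : Set G) := by
    intro h hh
    apply mem_normalizer_of_forall
    rintro _ ⟨y, hy, rfl⟩
    have : K'.Normal := inferInstance
    exact ⟨_, this.conj_mem y hy ⟨h, hh⟩, by simp⟩
  have hA := lemmaA (j := 0) S (K'.map H.subtype) ⊥ hSc (hS.trans hKN) bot_le
    (by intro x _; rw [Subgroup.mem_centralizer_iff]; intro y hy; simp at hy; subst hy; simp)
    (by simp) (by simpa using hKc) hm
  have hKC : K'.map H.subtype ≤ Subgroup.centralizer (S : Set G) := by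
    have := Subgroup.eq_of_le_of_card_ge (H := K'.map H.subtype ⊓ Subgroup.centralizer (S : Set G)) inf_le_left
      (by rw [hKc]; exact Nat.le_of_dvd Nat.card_pos hA)
    rw [← this]; exact inf_le_right
  intro h hh
  obtain ⟨⟨a, b⟩, hab⟩ := hcomp.2 (⟨h, hh⟩ : H)
  have e : (a : H) * (b : H) = ⟨h, hh⟩ := hab
  have e2 : ((a : H) : G) * ((b : H) : G) = h := congrArg Subtype.val e
  rw [← e2]
  refine Subgroup.mul_mem _ (centralizer_le_normalizer S (hKC ⟨_, a.2, rfl⟩)) (Subgroup.le_normalizer ?_)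
  have hb : (b : H) ∈ S.subgroupOf H := by rw [← hP]; exact b.2
  exact hb

theorem normalizer_quot_dvd {p : ℕ} [hp : Fact p.Prime] (S : Subgroup G) (hS : Nat.card S = p) :
    ∃ e, e ∣ p - 1 ∧ Nat.card (Subgroup.normalizer (S : Set G)) =
      Nat.card (Subgroup.centralizer (S : Set G)) * e := by
  have hcyc : IsCyclic S := isCyclic_of_prime_card hS
  have h1 := Subgroup.index_ker (S.normalizerMonoidHom)
  have h2 := S.normalizerMonoidHom.ker.index_mul_card
  have h3 : Nat.card (S.normalizerMonoidHom).range ∣ Nat.card (MulAut S) := Subgroup.card_subgroup_dvd_card _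
  rw [IsCyclic.card_mulAut, hS, Nat.totient_prime hp.out] at h3
  refine ⟨_, h3, ?_⟩
  rw [← h2, h1, mul_comm]
  congr 1
  rw [Subgroup.normalizerMonoidHom_ker]
  exact Nat.card_congr (Subgroup.subgroupOfEquivOfLe (centralizer_le_normalizer S)).toEquiv

theorem exists_order {p : ℕ} [Fact p.Prime] (H : Subgroup G) (h : p ∣ Nat.card H) :
    ∃ x ∈ H, orderOf x = p := by
  obtain ⟨x, hx⟩ := exists_prime_orderOf_dvd_card' (G := H) p h
  exact ⟨x, x.2, by rw [← hx]; exact Subgroup.orderOf_coe x⟩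

end basics2
end OD


open scoped Pointwise

namespace OD

section graph
set_option linter.unusedSectionVars false
variable {G : Type*} [Group G] [Finite G]

attribute [local instance] conjAction

scoped instance fact37 : Fact (Nat.Prime 37) := ⟨by norm_num⟩
scoped instance fact67 : Fact (Nat.Prime 67) := ⟨by norm_num⟩
scoped instance fact19 : Fact (Nat.Prime 19) := ⟨by norm_num⟩

/-- Consequences of the hypotheses that are used in the group theoretic part. -/
structure Hyp (G : Type*) [Group G] : Prop where
  card : Nat.card G = 2 ^ 5 * 3 ^ 4 * 7 * 19 * 37 ^ 3 * 67
  c37 : ∀ u : G, orderOf u = 37 → ∀ q : ℕ, q.Prime →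
    q ∣ Nat.card (Subgroup.centralizer (Subgroup.zpowers u : Set G)) → q = 2 ∨ q = 3 ∨ q = 37
  inv : ∃ u t : G, orderOf u = 37 ∧ orderOf t = 2 ∧ Commute u t
  n67 : ∀ Q : Subgroup G, Nat.card Q = 67 → Nat.card (Subgroup.normalizer (Q : Set G)) = 1407
  c67 : ∀ Q : Subgroup G, Nat.card Q = 67 → ¬ 3 ∣ Nat.card (Subgroup.centralizer (Q : Set G))

theorem prime_dvd_card {n q : ℕ} (hn : n = 2 ^ 5 * 3 ^ 4 * 7 * 19 * 37 ^ 3 * 67) (hq : q.Prime) (h : q ∣ n) :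
    q = 2 ∨ q = 3 ∨ q = 7 ∨ q = 19 ∨ q = 37 ∨ q = 67 := by
  have aux : ∀ {r : ℕ}, r.Prime → q ∣ r → q = r := fun hr h => (Nat.prime_dvd_prime_iff_eq hq hr).1 h
  rw [hn] at h
  rcases hq.dvd_mul.1 h with h | h
  · rcases hq.dvd_mul.1 h with h | h
    · rcases hq.dvd_mul.1 h with h | h
      · rcases hq.dvd_mul.1 h with h | h
        · rcases hq.dvd_mul.1 h with h | h
          · have := aux (by norm_num) (hq.dvd_of_dvd_pow h); tauto
          · have := aux (by norm_num) (hq.dvd_of_dvd_pow h); tauto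
        · have := aux (by norm_num) h; tauto
      · have := aux (by norm_num) h; tauto
    · have := aux (by norm_num) (hq.dvd_of_dvd_pow h); tauto
  · have := aux (by norm_num) h; tauto

theorem primeFactors_card {n : ℕ} (hn : n = 2 ^ 5 * 3 ^ 4 * 7 * 19 * 37 ^ 3 * 67) :
    n.primeFactors = {2, 3, 7, 19, 37, 67} := by
  ext q
  rw [Nat.mem_primeFactors]
  simp only [Finset.mem_insert, Finset.mem_singleton]
  constructor
  · rintro ⟨hq, h, _⟩
    exact prime_dvd_card hn hq h
  · subst hn
    rintro (rfl | rfl | rfl | rfl | rfl | rfl) <;> norm_num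

theorem div_form {n : ℕ} (h : n ∣ 2 ^ 5 * 3 ^ 4 * 7 * 19 * 37 ^ 3 * 67) :
    ∃ a b c d e f, a ≤ 5 ∧ b ≤ 4 ∧ c ≤ 1 ∧ d ≤ 1 ∧ e ≤ 3 ∧ f ≤ 1 ∧
      n = 2 ^ a * 3 ^ b * 7 ^ c * 19 ^ d * 37 ^ e * 67 ^ f := by
  obtain ⟨x1, n6, hx1, h6, rfl⟩ := Nat.dvd_mul.1 h
  obtain ⟨x2, n5, hx2, h5, rfl⟩ := Nat.dvd_mul.1 hx1
  obtain ⟨x3, n4, hx3, h4, rfl⟩ := Nat.dvd_mul.1 hx2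
  obtain ⟨x4, n3, hx4, h3, rfl⟩ := Nat.dvd_mul.1 hx3
  obtain ⟨n1, n2, h1, h2, rfl⟩ := Nat.dvd_mul.1 hx4
  obtain ⟨a, ha, rfl⟩ := (Nat.dvd_prime_pow (by norm_num)).1 h1
  obtain ⟨b, hb, rfl⟩ := (Nat.dvd_prime_pow (by norm_num)).1 h2
  obtain ⟨c, hc, rfl⟩ := (Nat.dvd_prime_pow (by norm_num)).1 (pow_one 7 ▸ h3)
  obtain ⟨d, hd, rfl⟩ := (Nat.dvd_prime_pow (by norm_num)).1 (pow_one 19 ▸ h4)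
  obtain ⟨e, he, rfl⟩ := (Nat.dvd_prime_pow (by norm_num)).1 h5
  obtain ⟨f, hf, rfl⟩ := (Nat.dvd_prime_pow (by norm_num)).1 (pow_one 67 ▸ h6)
  exact ⟨a, b, c, d, e, f, ha, hb, hc, hd, he, hf, rfl⟩

theorem div_form' {n : ℕ} (h : n ∣ 2 ^ 5 * 3 ^ 4 * 7 * 19 * 37 ^ 3 * 67) :
    ∃ a b c d e f, a ≤ 5 ∧ b ≤ 4 ∧ c ≤ 1 ∧ d ≤ 1 ∧ e ≤ 3 ∧ f ≤ 1 ∧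
      n = 2 ^ a * 3 ^ b * 7 ^ c * 19 ^ d * 37 ^ e * 67 ^ f ∧ (a ≠ 0 → 2 ∣ n) ∧ (b ≠ 0 → 3 ∣ n) ∧
        (c ≠ 0 → 7 ∣ n) ∧ (d ≠ 0 → 19 ∣ n) ∧ (e ≠ 0 → 37 ∣ n) ∧ (f ≠ 0 → 67 ∣ n) ∧
        (67 ∣ n → f = 1) ∧ (37 ^ 2 ∣ n → 2 ≤ e) := by
  obtain ⟨a, b, c, d, e, f, ha, hb, hc, hd, he, hf, hn⟩ := div_form h
  have key : ∀ {p k : ℕ}, k ≠ 0 → p ∣ p ^ k := fun hk => dvd_pow_self _ hk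
  refine ⟨a, b, c, d, e, f, ha, hb, hc, hd, he, hf, hn, ?_, ?_, ?_, ?_, ?_, ?_, ?_, ?_⟩
  · intro h; rw [hn]; exact Dvd.dvd.trans (key h) ⟨3 ^ b * 7 ^ c * 19 ^ d * 37 ^ e * 67 ^ f, by ring⟩
  · intro h; rw [hn]; exact Dvd.dvd.trans (key h) ⟨2 ^ a * 7 ^ c * 19 ^ d * 37 ^ e * 67 ^ f, by ring⟩
  · intro h; rw [hn]; exact Dvd.dvd.trans (key h) ⟨2 ^ a * 3 ^ b * 19 ^ d * 37 ^ e * 67 ^ f, by ring⟩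
  · intro h; rw [hn]; exact Dvd.dvd.trans (key h) ⟨2 ^ a * 3 ^ b * 7 ^ c * 37 ^ e * 67 ^ f, by ring⟩
  · intro h; rw [hn]; exact Dvd.dvd.trans (key h) ⟨2 ^ a * 3 ^ b * 7 ^ c * 19 ^ d * 67 ^ f, by ring⟩
  · intro h; rw [hn]; exact Dvd.dvd.trans (key h) ⟨2 ^ a * 3 ^ b * 7 ^ c * 19 ^ d * 37 ^ e, by ring⟩
  · intro h
    by_contra hf1
    obtain rfl : f = 0 := by omega
    rw [hn] at h
    have h2 : (67 : ℕ).Coprime (2 ^ a * 3 ^ b * 7 ^ c * 19 ^ d * 37 ^ e * 67 ^ 0) := by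
      simp only [pow_zero, mul_one]
      exact (((Nat.Coprime.pow_right a (by norm_num)).mul_right (Nat.Coprime.pow_right b (by norm_num))).mul_right
        (Nat.Coprime.pow_right c (by norm_num))).mul_right (Nat.Coprime.pow_right d (by norm_num)) |>.mul_right
        (Nat.Coprime.pow_right e (by norm_num))
    have := Nat.Coprime.eq_one_of_dvd h2 h
    omega
  · intro h
    rw [hn] at h
    have h2 : (37 ^ 2 : ℕ).Coprime (2 ^ a * 3 ^ b * 7 ^ c * 19 ^ d * 67 ^ f) := by
      exact (((Nat.Coprime.pow_right a (by norm_num)).mul_right (Nat.Coprime.pow_right b (by norm_num))).mul_right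
        (Nat.Coprime.pow_right c (by norm_num))).mul_right (Nat.Coprime.pow_right d (by norm_num)) |>.mul_right
        (Nat.Coprime.pow_right f (by norm_num))
    have h3 : 37 ^ 2 ∣ (2 ^ a * 3 ^ b * 7 ^ c * 19 ^ d * 67 ^ f) * 37 ^ e := by
      convert h using 1; ring
    have := (Nat.Coprime.dvd_mul_left h2).1 h3
    exact (Nat.pow_dvd_pow_iff_le_right (by norm_num)).1 this

theorem mem_cent_zpowers (u x : G) : x ∈ Subgroup.centralizer (Subgroup.zpowers u : Set G) ↔ Commute u x := by
  rw [Subgroup.mem_centralizer_iff]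
  constructor
  · intro h; exact h u (Subgroup.mem_zpowers u)
  · rintro h _ ⟨n, rfl⟩
    exact (h.zpow_left n)

theorem adj_symm {p q : ℕ} (h : primeGraphAdj G p q) : primeGraphAdj G q p := by
  obtain ⟨h1, h2, h3, h4, h5, g, hg⟩ := h
  exact ⟨h1.symm, h3, h2, h5, h4, g, by rw [hg, mul_comm]⟩

theorem adj_of_cent {p q : ℕ} (hp : p.Prime) (hq : q.Prime) (hpq : p ≠ q) (u : G) (hu : orderOf u = p)
    (h : q ∣ Nat.card (Subgroup.centralizer (Subgroup.zpowers u : Set G))) : primeGraphAdj G p q := by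
  have := Fact.mk hq
  obtain ⟨x, hx, hxo⟩ := exists_order _ h
  rw [mem_cent_zpowers] at hx
  refine ⟨hpq, hp, hq, hu ▸ orderOf_dvd_natCard u, hxo ▸ orderOf_dvd_natCard x, u * x, ?_⟩
  rw [hx.orderOf_mul_eq_mul_orderOf_of_coprime (by rw [hu, hxo]; exact (Nat.coprime_primes hp hq).2 hpq), hu, hxo]

theorem exists_of_adj {p q : ℕ} (h : primeGraphAdj G p q) :
    ∃ u t : G, orderOf u = p ∧ orderOf t = q ∧ Commute u t := by
  obtain ⟨h1, h2, h3, h4, h5, g, hg⟩ := h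
  refine ⟨g ^ q, g ^ p, ?_, ?_, (Commute.refl g).pow_pow _ _⟩
  · rw [orderOf_pow_of_dvd h3.ne_zero ⟨p, by rw [hg, mul_comm]⟩, hg, Nat.mul_div_cancel _ h3.pos]
  · rw [orderOf_pow_of_dvd h2.ne_zero ⟨q, by rw [hg]⟩, hg, Nat.mul_div_cancel_left _ h2.pos]

theorem zpowers_eq {p : ℕ} [Fact p.Prime] (Q : Subgroup G) (hQ : Nat.card Q = p) :
    ∃ u, orderOf u = p ∧ Q = Subgroup.zpowers u := by
  obtain ⟨u, hu, huo⟩ := exists_order (p := p) Q (by rw [hQ])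
  refine ⟨u, huo, (Subgroup.eq_of_le_of_card_ge ?_ ?_).symm⟩
  · rwa [Subgroup.zpowers_le]
  · rw [Nat.card_zpowers, huo, hQ]

theorem sq_dvd_cent (hcard : Nat.card G = 2 ^ 5 * 3 ^ 4 * 7 * 19 * 37 ^ 3 * 67) (u : G) (hu : orderOf u = 37) :
    37 ^ 2 ∣ Nat.card (Subgroup.centralizer (Subgroup.zpowers u : Set G)) := by
  have hL : Nat.card (Subgroup.zpowers u) = 37 ^ 1 := by rw [Nat.card_zpowers, hu, pow_one]
  have h1 := Sylow.prime_pow_dvd_card_normalizer (p := 37) (n := 1) (G := G) (by rw [hcard]; norm_num) hL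
  obtain ⟨e, he, h2⟩ := normalizer_quot_dvd (p := 37) (Subgroup.zpowers u) (by rw [hL, pow_one])
  rw [h2] at h1
  have : (37 ^ 2 : ℕ).Coprime e := Nat.Coprime.coprime_dvd_right he (by norm_num)
  exact this.dvd_of_dvd_mul_right h1


theorem deg_one {p : ℕ} (hd : primeGraphDeg G p = 1) :
    ∃ r, primeGraphAdj G p r ∧ ∀ q, primeGraphAdj G p q → q = r := by
  classical
  unfold primeGraphDeg at hd
  obtain ⟨r, hr⟩ := Finset.card_eq_one.1 hd
  have key : ∀ q, primeGraphAdj G p q ↔ q = r := by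
    intro q
    have h1 : q ∈ (Nat.card G).primeFactors.filter (fun r => primeGraphAdj G p r) ↔ q = r := by
      rw [← Finset.mem_singleton, ← hr]
    rw [← h1, Finset.mem_filter]
    constructor
    · intro h; exact ⟨Nat.mem_primeFactors.2 ⟨h.2.2.1, h.2.2.2.2.1, Nat.card_pos.ne'⟩, h⟩
    · exact fun h => h.2
  exact ⟨r, (key r).2 rfl, fun q hq => (key q).1 hq⟩

/-- the neighbours -/
noncomputable def nbr (G : Type*) [Group G] (p : ℕ) : Finset ℕ :=
  open scoped Classical in (Nat.card G).primeFactors.filter (fun r => primeGraphAdj G p r)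

theorem mem_nbr {p q : ℕ} : q ∈ nbr G p ↔ primeGraphAdj G p q := by
  classical
  unfold nbr
  rw [Finset.mem_filter]
  constructor
  · exact fun h => h.2
  · intro h; exact ⟨Nat.mem_primeFactors.2 ⟨h.2.2.1, h.2.2.2.2.1, Nat.card_pos.ne'⟩, h⟩

theorem adj_cases (hcard : Nat.card G = 2 ^ 5 * 3 ^ 4 * 7 * 19 * 37 ^ 3 * 67) {p q : ℕ} (h : primeGraphAdj G p q) :
    q = 2 ∨ q = 3 ∨ q = 7 ∨ q = 19 ∨ q = 37 ∨ q = 67 :=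
  prime_dvd_card hcard h.2.2.1 h.2.2.2.2.1

theorem cent_prime {p q : ℕ} (hp : p.Prime) (hq : q.Prime) (u : G) (hu : orderOf u = p)
    (h : q ∣ Nat.card (Subgroup.centralizer (Subgroup.zpowers u : Set G))) : q = p ∨ primeGraphAdj G p q := by
  by_cases hpq : q = p
  · exact Or.inl hpq
  · exact Or.inr (adj_of_cent hp hq (Ne.symm hpq) u hu h)

theorem arith1 {a b c d e e' k s : ℕ} (ha : a ≤ 5) (hb : b ≤ 4) (hc : c ≤ 1) (hd : d ≤ 1) (he : e ≤ 3)
    (he2 : 2 ≤ e) (ha0 : a = 0 ∨ s = 2) (hb0 : b = 0 ∨ s = 3) (hc0 : c = 0 ∨ s = 7) (hd0 : d = 0 ∨ s = 19)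
    (he6' : e' = 1 ∨ e' = 2 ∨ e' = 3 ∨ e' = 6) (hss : s = 2 ∨ s = 3 ∨ s = 7 ∨ s = 19)
    (hk1 : 2 ^ a * 3 ^ b * 7 ^ c * 19 ^ d * 37 ^ e * 67 ^ 1 = k * (67 * 37 * e')) (hk2 : k % 67 = 1 % 67) : False := by
  rcases hss with rfl | rfl | rfl | rfl
  · obtain rfl : b = 0 := by omega
    obtain rfl : c = 0 := by omega
    obtain rfl : d = 0 := by omega
    interval_cases a <;> interval_cases e <;> rcases he6' with rfl | rfl | rfl | rfl <;> norm_num at hk1 <;> omega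
  · obtain rfl : a = 0 := by omega
    obtain rfl : c = 0 := by omega
    obtain rfl : d = 0 := by omega
    interval_cases b <;> interval_cases e <;> rcases he6' with rfl | rfl | rfl | rfl <;> norm_num at hk1 <;> omega
  · obtain rfl : a = 0 := by omega
    obtain rfl : b = 0 := by omega
    obtain rfl : d = 0 := by omega
    interval_cases c <;> interval_cases e <;> rcases he6' with rfl | rfl | rfl | rfl <;> norm_num at hk1 <;> omega
  · obtain rfl : a = 0 := by omega
    obtain rfl : b = 0 := by omega
    obtain rfl : c = 0 := by omega
    interval_cases d <;> interval_cases e <;> rcases he6' with rfl | rfl | rfl | rfl <;> norm_num at hk1 <;> omega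


theorem arith2 {x1 x2 x3 x4 x5 e c r : ℕ} (ha : x1 ≤ 5) (hb : x2 ≤ 4) (hc : x3 ≤ 1) (hd : x4 ≤ 1) (he2 : x5 ≤ 3)
    (ha0 : x1 = 0 ∨ r = 2) (hb0 : x2 = 0 ∨ r = 3) (hc0 : x3 = 0 ∨ r = 7) (hd0 : x4 = 0 ∨ r = 19)
    (he0 : x5 = 0 ∨ r = 37) (he6 : e = 1 ∨ e = 2 ∨ e = 3 ∨ e = 6)
    (hrc : r = 2 ∨ r = 3 ∨ r = 7 ∨ r = 19 ∨ r = 37 ∨ r = 67) (hr67 : r ≠ 67)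
    (hc1 : 2 ^ 5 * 3 ^ 4 * 7 * 19 * 37 ^ 3 * 67 =
      c * (2 ^ x1 * 3 ^ x2 * 7 ^ x3 * 19 ^ x4 * 37 ^ x5 * 67 ^ 1 * e)) (hc2 : c % 67 = 1 % 67) :
    (r = 7 ∧ 2 ^ x1 * 3 ^ x2 * 7 ^ x3 * 19 ^ x4 * 37 ^ x5 * 67 ^ 1 * e = 1407) ∨
      (r = 37 ∧ 2 ^ x1 * 3 ^ x2 * 7 ^ x3 * 19 ^ x4 * 37 ^ x5 * 67 ^ 1 * e = 67 * 37 * 6) := by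
  rcases hrc with rfl | rfl | rfl | rfl | rfl | rfl
  · obtain rfl : x2 = 0 := by omega
    obtain rfl : x3 = 0 := by omega
    obtain rfl : x4 = 0 := by omega
    obtain rfl : x5 = 0 := by omega
    interval_cases x1 <;> rcases he6 with rfl | rfl | rfl | rfl <;> norm_num at hc1 <;> omega
  · obtain rfl : x1 = 0 := by omega
    obtain rfl : x3 = 0 := by omega
    obtain rfl : x4 = 0 := by omega
    obtain rfl : x5 = 0 := by omega
    interval_cases x2 <;> rcases he6 with rfl | rfl | rfl | rfl <;> norm_num at hc1 <;> omega
  · obtain rfl : x1 = 0 := by omega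
    obtain rfl : x2 = 0 := by omega
    obtain rfl : x4 = 0 := by omega
    obtain rfl : x5 = 0 := by omega
    interval_cases x3 <;> rcases he6 with rfl | rfl | rfl | rfl <;> norm_num at hc1 ⊢ <;> omega
  · obtain rfl : x1 = 0 := by omega
    obtain rfl : x2 = 0 := by omega
    obtain rfl : x3 = 0 := by omega
    obtain rfl : x5 = 0 := by omega
    interval_cases x4 <;> rcases he6 with rfl | rfl | rfl | rfl <;> norm_num at hc1 <;> omega
  · obtain rfl : x1 = 0 := by omega
    obtain rfl : x2 = 0 := by omega
    obtain rfl : x3 = 0 := by omega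
    obtain rfl : x4 = 0 := by omega
    interval_cases x5 <;> rcases he6 with rfl | rfl | rfl | rfl <;> norm_num at hc1 ⊢ <;> omega
  · exact absurd rfl hr67

theorem no_67_37 (hcard : Nat.card G = 2 ^ 5 * 3 ^ 4 * 7 * 19 * 37 ^ 3 * 67)
    (hdeg37 : primeGraphDeg G 37 = 2) (hadj : primeGraphAdj G 67 37)
    (hN : ∀ Q : Subgroup G, Nat.card Q = 67 → Nat.card (Subgroup.normalizer (Q : Set G)) = 67 * 37 * 6) : False := by
  obtain ⟨u, t, hu, ht, hut⟩ := exists_of_adj (adj_symm hadj)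
  set H := Subgroup.centralizer (Subgroup.zpowers u : Set G) with hH
  have hsq := sq_dvd_cent hcard u hu
  rw [← hH] at hsq
  set Q := Subgroup.zpowers t with hQ
  have hQc : Nat.card Q = 67 := by rw [hQ, Nat.card_zpowers, ht]
  have hQH : Q ≤ H := by rw [hQ, Subgroup.zpowers_le, hH, mem_cent_zpowers]; exact hut
  have h67 : 67 ∣ Nat.card H := hQc ▸ Subgroup.card_dvd_of_le hQH
  -- the neighbours of 37
  have h67m : 67 ∈ nbr G 37 := mem_nbr.2 (adj_symm hadj)
  have hcn : (nbr G 37).card = 2 := hdeg37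
  obtain ⟨s, hs⟩ : ∃ s, (nbr G 37).erase 67 = {s} := by
    rw [← Finset.card_eq_one, Finset.card_erase_of_mem h67m, hcn]
  have hsc : ∀ q, q.Prime → q ∣ Nat.card H → q = 37 ∨ q = 67 ∨ q = s := by
    intro q hq hqd
    rcases cent_prime (by norm_num) hq u hu hqd with h | h
    · exact Or.inl h
    · by_cases h6 : q = 67
      · tauto
      · have : q ∈ (nbr G 37).erase 67 := Finset.mem_erase.2 ⟨h6, mem_nbr.2 h⟩
        rw [hs, Finset.mem_singleton] at this; tauto
  have hss : s = 2 ∨ s = 3 ∨ s = 7 ∨ s = 19 := by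
    have h1 : s ∈ (nbr G 37).erase 67 := by rw [hs]; simp
    rw [Finset.mem_erase, mem_nbr] at h1
    have h2 := adj_cases hcard h1.2
    have h3 := h1.2.1
    omega
  obtain ⟨a, b, c, d, e, f, ha, hb, hc, hd, he, hf, hn, ha', hb', hc', hd', -, -, hf', he'⟩ :=
    div_form' (hcard ▸ Subgroup.card_subgroup_dvd_card H)
  obtain rfl := hf' h67
  have he2 := he' hsq
  have ha0 : a = 0 ∨ s = 2 := by
    by_contra h
    have h9 := hsc 2 (by norm_num) (ha' (fun h0 => h (Or.inl h0)))
    exact h (Or.inr (by clear * - h9; omega))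
  have hb0 : b = 0 ∨ s = 3 := by
    by_contra h
    have h9 := hsc 3 (by norm_num) (hb' (fun h0 => h (Or.inl h0)))
    exact h (Or.inr (by clear * - h9; omega))
  have hc0 : c = 0 ∨ s = 7 := by
    by_contra h
    have h9 := hsc 7 (by norm_num) (hc' (fun h0 => h (Or.inl h0)))
    exact h (Or.inr (by clear * - h9; omega))
  have hd0 : d = 0 ∨ s = 19 := by
    by_contra h
    have h9 := hsc 19 (by norm_num) (hd' (fun h0 => h (Or.inl h0)))
    exact h (Or.inr (by clear * - h9; omega))
  -- normalizer of Q in H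
  have hNc : ∃ e', e' ∣ 6 ∧ Nat.card (H ⊓ Subgroup.normalizer (Q : Set G) : Subgroup G) = 67 * 37 * e' := by
    have h1 : Nat.card (H ⊓ Subgroup.normalizer (Q : Set G) : Subgroup G) ∣ 67 * 37 * 6 := by
      rw [← hN Q hQc]; exact Subgroup.card_dvd_of_le inf_le_right
    have h2 : 67 ∣ Nat.card (H ⊓ Subgroup.normalizer (Q : Set G) : Subgroup G) :=
      hQc ▸ Subgroup.card_dvd_of_le (le_inf hQH Subgroup.le_normalizer)
    have h3 : 37 ∣ Nat.card (H ⊓ Subgroup.normalizer (Q : Set G) : Subgroup G) := by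
      have : Nat.card (Subgroup.zpowers u) = 37 := by rw [Nat.card_zpowers, hu]
      rw [← this]
      apply Subgroup.card_dvd_of_le
      rw [Subgroup.zpowers_le]
      refine ⟨(mem_cent_zpowers u u).2 (Commute.refl u), centralizer_le_normalizer Q ?_⟩
      exact (mem_cent_zpowers t u).2 hut.symm
    have h4 : 67 * 37 ∣ Nat.card (H ⊓ Subgroup.normalizer (Q : Set G) : Subgroup G) :=
      Nat.Coprime.mul_dvd_of_dvd_of_dvd (by norm_num) h2 h3
    obtain ⟨e', he'⟩ := h4
    refine ⟨e', ?_, he'⟩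
    rw [he'] at h1
    exact Nat.dvd_of_mul_dvd_mul_left (by norm_num) h1
  obtain ⟨e', he6, hNc⟩ := hNc
  have he6' : e' = 1 ∨ e' = 2 ∨ e' = 3 ∨ e' = 6 := by
    have : e' ≤ 6 := Nat.le_of_dvd (by norm_num) he6
    interval_cases e' <;> omega
  have hH67 : ∃ m, Nat.card H = 67 ^ 1 * m ∧ ¬ 67 ∣ m := by
    refine ⟨2 ^ a * 3 ^ b * 7 ^ c * 19 ^ d * 37 ^ e, by rw [hn]; ring, ?_⟩
    intro h
    have h2 : (67 : ℕ).Coprime (2 ^ a * 3 ^ b * 7 ^ c * 19 ^ d * 37 ^ e) := by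
      exact (((Nat.Coprime.pow_right a (by norm_num)).mul_right (Nat.Coprime.pow_right b (by norm_num))).mul_right
        (Nat.Coprime.pow_right c (by norm_num))).mul_right (Nat.Coprime.pow_right d (by norm_num)) |>.mul_right
        (Nat.Coprime.pow_right e (by norm_num))
    have := Nat.Coprime.eq_one_of_dvd h2 h
    omega
  obtain ⟨m, hm1, hm2⟩ := hH67
  obtain ⟨k, hk1, hk2, -⟩ := syl_count (p := 67) (k := 1) H Q hQH (by rw [hQc, pow_one]) hm1 hm2
  rw [hNc, hn] at hk1
  unfold Nat.ModEq at hk2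
  exact arith1 ha hb hc hd he he2 ha0 hb0 hc0 hd0 he6' hss hk1 hk2

theorem step1 (hcard : Nat.card G = 2 ^ 5 * 3 ^ 4 * 7 * 19 * 37 ^ 3 * 67)
    (hdeg37 : primeGraphDeg G 37 = 2) (hdeg67 : primeGraphDeg G 67 = 1) :
    primeGraphAdj G 67 7 ∧ (∀ q, primeGraphAdj G 67 q → q = 7) ∧
    (∀ Q : Subgroup G, Nat.card Q = 67 → Nat.card (Subgroup.normalizer (Q : Set G)) = 1407) := by
  obtain ⟨r, hr, hru⟩ := deg_one hdeg67
  have hrc := adj_cases hcard hr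
  have hr67 : r ≠ 67 := hr.1.symm
  have key : ∀ Q : Subgroup G, Nat.card Q = 67 → (r = 7 ∧ Nat.card (Subgroup.normalizer (Q : Set G)) = 1407) ∨
      (r = 37 ∧ Nat.card (Subgroup.normalizer (Q : Set G)) = 67 * 37 * 6) := by
    intro Q hQ
    obtain ⟨e, he, hNe⟩ := normalizer_quot_dvd (p := 67) Q hQ
    obtain ⟨t, ht, hQt⟩ := zpowers_eq (p := 67) Q hQ
    have hpr : ∀ q, q.Prime → q ∣ Nat.card (Subgroup.centralizer (Q : Set G)) → q = 67 ∨ q = r := by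
      intro q hq hqd
      rw [hQt] at hqd
      rcases cent_prime (by norm_num) hq t ht hqd with h | h
      · exact Or.inl h
      · exact Or.inr (hru q h)
    have h67 : 67 ∣ Nat.card (Subgroup.centralizer (Q : Set G)) := by
      rw [← hQ]
      apply Subgroup.card_dvd_of_le
      rw [hQt, Subgroup.zpowers_le, mem_cent_zpowers]
    obtain ⟨c, hc1, hc2, -⟩ := syl_count (p := 67) (k := 1) (m := 2 ^ 5 * 3 ^ 4 * 7 * 19 * 37 ^ 3) ⊤ Q le_top
      (by rw [hQ, pow_one]) (by rw [Subgroup.card_top, hcard]; ring) (by norm_num)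
    rw [top_inf_eq, Subgroup.card_top, hcard, hNe] at hc1
    obtain ⟨x1, x2, x3, x4, x5, f, ha, hb, hc, hd, he2, hf, hn, ha', hb', hc', hd', he', -, hf', -⟩ :=
      div_form' (hcard ▸ Subgroup.card_subgroup_dvd_card (Subgroup.centralizer (Q : Set G)))
    obtain rfl := hf' h67
    have ha0 : x1 = 0 ∨ r = 2 := by
      by_contra h
      have h9 := hpr 2 (by norm_num) (ha' (fun h0 => h (Or.inl h0)))
      exact h (Or.inr (by clear * - h9; omega))
    have hb0 : x2 = 0 ∨ r = 3 := by
      by_contra h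
      have h9 := hpr 3 (by norm_num) (hb' (fun h0 => h (Or.inl h0)))
      exact h (Or.inr (by clear * - h9; omega))
    have hc0 : x3 = 0 ∨ r = 7 := by
      by_contra h
      have h9 := hpr 7 (by norm_num) (hc' (fun h0 => h (Or.inl h0)))
      exact h (Or.inr (by clear * - h9; omega))
    have hd0 : x4 = 0 ∨ r = 19 := by
      by_contra h
      have h9 := hpr 19 (by norm_num) (hd' (fun h0 => h (Or.inl h0)))
      exact h (Or.inr (by clear * - h9; omega))
    have he0 : x5 = 0 ∨ r = 37 := by
      by_contra h
      have h9 := hpr 37 (by norm_num) (he' (fun h0 => h (Or.inl h0)))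
      exact h (Or.inr (by clear * - h9; omega))
    have he6 : e = 1 ∨ e = 2 ∨ e = 3 ∨ e = 6 := by
      have h1 : e ∣ 2 ^ 5 * 3 ^ 4 * 7 * 19 * 37 ^ 3 * 67 := ⟨c * Nat.card (Subgroup.centralizer (Q : Set G)), by
        rw [hc1]; ring⟩
      have h2 : e ∣ 6 := by
        have := Nat.dvd_gcd he h1
        norm_num at this; exact this
      have : e ≤ 6 := Nat.le_of_dvd (by norm_num) h2
      interval_cases e <;> omega
    rw [hNe, hn]
    rw [hn] at hc1
    unfold Nat.ModEq at hc2
    exact arith2 ha hb hc hd he2 ha0 hb0 hc0 hd0 he0 he6 hrc hr67 hc1 hc2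
  obtain ⟨Q0, -, hQ0⟩ := exists_sub (p := 67) (k := 1) (m := 2 ^ 5 * 3 ^ 4 * 7 * 19 * 37 ^ 3) (⊤ : Subgroup G)
    (by rw [Subgroup.card_top, hcard]; ring)
  rcases key Q0 (by rw [hQ0, pow_one]) with ⟨rfl, -⟩ | ⟨rfl, -⟩
  · exact ⟨hr, hru, fun Q hQ => by rcases key Q hQ with h | h <;> omega⟩
  · exact (no_67_37 hcard hdeg37 hr fun Q hQ => by rcases key Q hQ with h | h <;> omega).elim

theorem hyp_of_deg (hcard : Nat.card G = 2 ^ 5 * 3 ^ 4 * 7 * 19 * 37 ^ 3 * 67)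
    (hdeg2 : primeGraphDeg G 2 = 3) (hdeg3 : primeGraphDeg G 3 = 3) (hdeg7 : primeGraphDeg G 7 = 1)
    (hdeg37 : primeGraphDeg G 37 = 2) (hdeg67 : primeGraphDeg G 67 = 1) : Hyp G := by
  obtain ⟨h1, h2, h3⟩ := step1 hcard hdeg37 hdeg67
  obtain ⟨r, hr, hru⟩ := deg_one hdeg7
  have h7 : ∀ q, primeGraphAdj G 7 q → q = 67 := fun q hq => (hru q hq).trans (hru 67 (adj_symm h1)).symm
  have full : ∀ T : Finset ℕ, ∀ p, primeGraphDeg G p = T.card → nbr G p ⊆ T → nbr G p = T :=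
    fun T p h hs => Finset.eq_of_subset_of_card_le hs h.ge
  have n2 : nbr G 2 = {3, 19, 37} := by
    apply full _ _ (by rw [hdeg2]; rfl)
    intro q hq
    rw [mem_nbr] at hq
    have hc := adj_cases hcard hq
    have h1 := hq.1
    simp only [Finset.mem_insert, Finset.mem_singleton]
    rcases hc with rfl | rfl | rfl | rfl | rfl | rfl <;> try tauto
    · have := h7 _ (adj_symm hq); omega
    · have := h2 _ (adj_symm hq); omega
  have n3 : nbr G 3 = {2, 19, 37} := by
    apply full _ _ (by rw [hdeg3]; rfl)
    intro q hq
    rw [mem_nbr] at hq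
    have hc := adj_cases hcard hq
    have h1 := hq.1
    simp only [Finset.mem_insert, Finset.mem_singleton]
    rcases hc with rfl | rfl | rfl | rfl | rfl | rfl <;> try tauto
    · have := h7 _ (adj_symm hq); omega
    · have := h2 _ (adj_symm hq); omega
  have a237 : primeGraphAdj G 2 37 := mem_nbr.1 (by rw [n2]; simp)
  have a337 : primeGraphAdj G 3 37 := mem_nbr.1 (by rw [n3]; simp)
  have n37 : {2, 3} = nbr G 37 := by
    apply Finset.eq_of_subset_of_card_le
    · intro q hq
      simp only [Finset.mem_insert, Finset.mem_singleton] at hq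
      rw [mem_nbr]
      rcases hq with rfl | rfl
      · exact adj_symm a237
      · exact adj_symm a337
    · exact hdeg37.le
  refine ⟨hcard, ?_, ?_, h3, ?_⟩
  · intro u hu q hq hqd
    rcases cent_prime (by norm_num) hq u hu hqd with h | h
    · tauto
    · rw [← mem_nbr, ← n37] at h
      simp only [Finset.mem_insert, Finset.mem_singleton] at h
      tauto
  · exact exists_of_adj (adj_symm a237)
  · intro Q hQ h
    obtain ⟨t, ht, hQt⟩ := zpowers_eq (p := 67) Q hQ
    rw [hQt] at h
    rcases cent_prime (by norm_num) (by norm_num) t ht h with h | h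
    · omega
    · have := h2 _ h; omega

end graph
end OD


open scoped Pointwise

namespace OD

section local1
set_option linter.unusedSectionVars false
variable {G : Type*} [Group G] [Finite G]

attribute [local instance] conjAction

theorem cent_form (hG : Hyp G) {u : G} (hu : orderOf u = 37) (K : Subgroup G)
    (hK : K ≤ Subgroup.centralizer (Subgroup.zpowers u : Set G)) :
    ∃ e m, e ≤ 3 ∧ m ∣ 2592 ∧ Nat.card K = 37 ^ e * m := by
  obtain ⟨a, b, c, d, e, f, ha, hb, hc, hd, he, hf, hn, ha', hb', hc', hd', he', hf', -, -⟩ :=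
    div_form' (hG.card ▸ Subgroup.card_subgroup_dvd_card K)
  have key : ∀ q, q.Prime → q ∣ Nat.card K → q = 2 ∨ q = 3 ∨ q = 37 := fun q hq h =>
    hG.c37 u hu q hq (h.trans (Subgroup.card_dvd_of_le hK))
  obtain rfl : c = 0 := by
    by_contra h; have := key 7 (by norm_num) (hc' h); clear * - this; omega
  obtain rfl : d = 0 := by
    by_contra h; have := key 19 (by norm_num) (hd' h); clear * - this; omega
  obtain rfl : f = 0 := by
    by_contra h; have := key 67 (by norm_num) (hf' h); clear * - this; omega
  refine ⟨e, 2 ^ a * 3 ^ b, he, ?_, by rw [hn]; ring⟩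
  exact mul_dvd_mul (pow_dvd_pow 2 ha) (pow_dvd_pow 3 hb)

theorem cent_form' (hG : Hyp G) {u : G} (hu : orderOf u = 37) (K : Subgroup G)
    (hK : K ≤ Subgroup.centralizer (Subgroup.zpowers u : Set G)) (S : Subgroup G) (hS : S ≤ K)
    {j : ℕ} (hSc : Nat.card S = 37 ^ j) (hmax : ¬ 37 ^ (j + 1) ∣ Nat.card K) :
    ∃ m, m ∣ 2592 ∧ Nat.card K = 37 ^ j * m := by
  obtain ⟨e, m, he, hm, hc⟩ := cent_form hG hu K hK
  have h1 : 37 ^ j ∣ 37 ^ e * m := by rw [← hc, ← hSc]; exact Subgroup.card_dvd_of_le hS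
  have h2 : (37 ^ j).Coprime m := Nat.Coprime.coprime_dvd_right hm (Nat.Coprime.pow_left j (by norm_num))
  have h3 := (Nat.pow_dvd_pow_iff_le_right (by norm_num)).1 (h2.dvd_of_dvd_mul_right h1)
  have h4 : e ≤ j := by
    by_contra h
    exact hmax (hc ▸ (pow_dvd_pow 37 (by omega)).trans (dvd_mul_right _ _))
  obtain rfl : e = j := le_antisymm h4 h3
  exact ⟨m, hm, hc⟩

theorem not_pow4 (hG : Hyp G) (K : Subgroup G) : ¬ 37 ^ (3 + 1) ∣ Nat.card K := by
  intro h
  have := h.trans (Subgroup.card_subgroup_dvd_card K)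
  rw [hG.card] at this
  norm_num at this

theorem exists_S (hG : Hyp G) {k : ℕ} (L : Subgroup G) (hL : Nat.card L = 37 ^ k) :
    ∃ S : Subgroup G, L ≤ S ∧ Nat.card S = 37 ^ 3 := by
  obtain ⟨P, hP⟩ := (IsPGroup.of_card hL).exists_le_sylow
  refine ⟨P, hP, ?_⟩
  have := P.card_eq_multiplicity
  rw [hG.card] at this
  have h2 : (2 ^ 5 * 3 ^ 4 * 7 * 19 * 37 ^ 3 * 67).factorization 37 = 3 := by
    rw [show 2 ^ 5 * 3 ^ 4 * 7 * 19 * 37 ^ 3 * 67 = 37 ^ 3 * (2 ^ 5 * 3 ^ 4 * 7 * 19 * 67) by norm_num,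
      Nat.factorization_mul (by norm_num) (by norm_num)]
    have : (2 ^ 5 * 3 ^ 4 * 7 * 19 * 67).factorization 37 = 0 :=
      Nat.factorization_eq_zero_of_not_dvd (by norm_num)
    rw [Finsupp.add_apply, this, Nat.factorization_pow, Finsupp.smul_apply,
      Nat.Prime.factorization_self (by norm_num)]
    rfl
  rw [h2] at this
  exact this

theorem sylG_conj (hG : Hyp G) (S T : Subgroup G) (hS : Nat.card S = 37 ^ 3) (hT : Nat.card T = 37 ^ 3) :
    ∃ g : G, g • S = T := by
  obtain ⟨h, -, hh⟩ := sylow_conj (p := 37) (m := 2 ^ 5 * 3 ^ 4 * 7 * 19 * 67) ⊤ S T le_top le_top hS hT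
    (by rw [Subgroup.card_top, hG.card]; ring) (by norm_num)
  exact ⟨h, hh⟩

/-- a 37-subgroup centralized by an element of order q (q = 19 or 67) is trivial -/
theorem cent_trivial (hG : Hyp G) {q k : ℕ} [Fact q.Prime] (hq : q ≠ 2 ∧ q ≠ 3 ∧ q ≠ 37) (K T : Subgroup G)
    (hK : Nat.card K ∣ 37 ^ k) (hT : Nat.card T = q) :
    Nat.card (K ⊓ Subgroup.centralizer (T : Set G) : Subgroup G) = 1 := by
  obtain ⟨i, -, hi⟩ := (Nat.dvd_prime_pow (by norm_num)).1
    ((card_inf_dvd_left K (Subgroup.centralizer (T : Set G))).trans hK)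
  rcases Nat.eq_zero_or_pos i with rfl | hpos
  · rw [hi, pow_zero]
  · exfalso
    obtain ⟨u, hu, huo⟩ := exists_order (p := 37) (K ⊓ Subgroup.centralizer (T : Set G))
      (by rw [hi]; exact dvd_pow_self _ hpos.ne')
    have h1 : T ≤ Subgroup.centralizer (Subgroup.zpowers u : Set G) := by
      intro t ht
      rw [mem_cent_zpowers]
      exact ((Subgroup.mem_centralizer_iff.1 hu.2) t ht).symm
    have := hG.c37 u huo q Fact.out (hT ▸ Subgroup.card_dvd_of_le h1)
    tauto

theorem arith3 : ∀ (a : Fin 6) (b : Fin 5) (c f : Fin 2), let n := 2 ^ a.val * 3 ^ b.val * 7 ^ c.val * 67 ^ f.val;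
    ((2 ^ 5 * 3 ^ 4 * 7 * 19 * 67) / n) % 37 = 1 → (n = 469 ∨ n = 5427 ∨ n = 432 ∨ n = 607824) := by
  decide +kernel

theorem step2a (hG : Hyp G) (S : Subgroup G) (hS : Nat.card S = 37 ^ 3) :
    ∃ d, Nat.card (Subgroup.normalizer (S : Set G)) = 37 ^ 3 * d ∧ (d = 469 ∨ d = 5427 ∨ d = 432 ∨ d = 607824) := by
  obtain ⟨c, hc1, hc2, -⟩ := syl_count (p := 37) (k := 3) (m := 2 ^ 5 * 3 ^ 4 * 7 * 19 * 67) ⊤ S le_top hS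
    (by rw [Subgroup.card_top, hG.card]; ring) (by norm_num)
  rw [top_inf_eq, Subgroup.card_top, hG.card] at hc1
  obtain ⟨a, b, c', d, e, f, ha, hb, hc, hd, he, hf, hn, ha', hb', hc', hd', he', hf', -, -⟩ :=
    div_form' (hG.card ▸ Subgroup.card_subgroup_dvd_card (Subgroup.normalizer (S : Set G)))
  obtain rfl : d = 0 := by
    by_contra h
    obtain ⟨t, ht, hto⟩ := exists_order (p := 19) _ (hd' h)
    have hT : Nat.card (Subgroup.zpowers t) = 19 := by rw [Nat.card_zpowers, hto]
    have h1 := fix_count (p := 19) (k := 1) (Subgroup.zpowers t) S (by rw [hT, pow_one])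
      (by rw [Subgroup.zpowers_le]; exact ht)
    rw [cent_trivial hG (q := 19) (k := 3) (by norm_num) S (Subgroup.zpowers t) (by rw [hS]) hT, hS] at h1
    revert h1; decide
  have he3 : e = 3 := by
    have h1 : 37 ^ 3 ∣ Nat.card (Subgroup.normalizer (S : Set G)) :=
      hS ▸ Subgroup.card_dvd_of_le Subgroup.le_normalizer
    rw [hn] at h1
    have h2 : (37 ^ 3 : ℕ).Coprime (2 ^ a * 3 ^ b * 7 ^ c' * 67 ^ f) := by
      exact (((Nat.Coprime.pow_right a (by norm_num)).mul_right (Nat.Coprime.pow_right b (by norm_num))).mul_right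
        (Nat.Coprime.pow_right c' (by norm_num))).mul_right (Nat.Coprime.pow_right f (by norm_num))
    have h3 : 37 ^ 3 ∣ (2 ^ a * 3 ^ b * 7 ^ c' * 67 ^ f) * 37 ^ e := by
      convert h1 using 1; ring
    have := (Nat.pow_dvd_pow_iff_le_right (by norm_num)).1 ((Nat.Coprime.dvd_mul_left h2).1 h3)
    omega
  subst he3
  refine ⟨2 ^ a * 3 ^ b * 7 ^ c' * 67 ^ f, by rw [hn]; ring, ?_⟩
  refine arith3 ⟨a, by omega⟩ ⟨b, by omega⟩ ⟨c', by omega⟩ ⟨f, by omega⟩ ?_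
  have h5 : 2 ^ 5 * 3 ^ 4 * 7 * 19 * 67 = c * (2 ^ a * 3 ^ b * 7 ^ c' * 67 ^ f) := by
    have h6 : 37 ^ 3 * (2 ^ 5 * 3 ^ 4 * 7 * 19 * 67) = 37 ^ 3 * (c * (2 ^ a * 3 ^ b * 7 ^ c' * 67 ^ f)) := by
      rw [hn] at hc1
      calc _ = 2 ^ 5 * 3 ^ 4 * 7 * 19 * 37 ^ 3 * 67 := by ring
        _ = _ := hc1
        _ = _ := by ring
    exact Nat.eq_of_mul_eq_mul_left (by norm_num) h6
  change (2 ^ 5 * 3 ^ 4 * 7 * 19 * 67) / (2 ^ a * 3 ^ b * 7 ^ c' * 67 ^ f) % 37 = 1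
  rw [h5, Nat.mul_div_cancel _ (by positivity)]
  exact hc2

theorem step2b (hG : Hyp G) (S : Subgroup G) (hS : Nat.card S = 37 ^ 3) :
    Nat.card (Subgroup.normalizer (S : Set G)) = 37 ^ 3 * 469 ∨
    Nat.card (Subgroup.normalizer (S : Set G)) = 37 ^ 3 * 432 := by
  obtain ⟨d, hd, hd2⟩ := step2a hG S hS
  have aux : ∀ x, d = 67 * x → ¬ 67 ∣ 37 ^ 3 * x → ∃ c k, k ∣ 21 ∧ c % 67 = 1 ∧ 37 ^ 3 * x = c * k := by
    intro x hx hx2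
    have hN : Nat.card (Subgroup.normalizer (S : Set G)) = 67 ^ 1 * (37 ^ 3 * x) := by rw [hd, hx]; ring
    obtain ⟨Q, hQ, hQc⟩ := exists_sub (p := 67) (k := 1) _ hN
    obtain ⟨c, hc1, hc2, -⟩ := syl_count (p := 67) (k := 1) _ Q hQ hQc hN hx2
    have h1 : Nat.card (Subgroup.normalizer (S : Set G) ⊓ Subgroup.normalizer (Q : Set G) : Subgroup G) ∣ 67 * 21 := by
      rw [show 67 * 21 = 1407 by norm_num, ← hG.n67 Q (by rw [hQc, pow_one])]
      exact Subgroup.card_dvd_of_le inf_le_right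
    have h2 : 67 ∣ Nat.card (Subgroup.normalizer (S : Set G) ⊓ Subgroup.normalizer (Q : Set G) : Subgroup G) := by
      rw [← pow_one 67, ← hQc]
      exact Subgroup.card_dvd_of_le (le_inf hQ Subgroup.le_normalizer)
    obtain ⟨k, hk⟩ := h2
    rw [hk] at h1 hc1
    refine ⟨c, k, Nat.dvd_of_mul_dvd_mul_left (by norm_num) h1, hc2, ?_⟩
    rw [hN] at hc1
    have : 67 * (37 ^ 3 * x) = 67 * (c * k) := by rw [← pow_one 67, hc1]; ring
    exact Nat.eq_of_mul_eq_mul_left (by norm_num) this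
  have k21 : ∀ k, k ∣ 21 → k = 1 ∨ k = 3 ∨ k = 7 ∨ k = 21 := by
    intro k hk
    have : k ≤ 21 := Nat.le_of_dvd (by norm_num) hk
    clear * - hk this
    interval_cases k <;> omega
  rcases hd2 with rfl | rfl | rfl | rfl
  · exact Or.inl hd
  · exfalso
    obtain ⟨c, k, hk, hc, h⟩ := aux 81 (by norm_num) (by norm_num)
    have hk' := k21 k hk
    clear * - hk' hc h
    rcases hk' with rfl | rfl | rfl | rfl <;> omega
  · exact Or.inr hd
  · exfalso
    obtain ⟨c, k, hk, hc, h⟩ := aux 9072 (by norm_num) (by norm_num)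
    have hk' := k21 k hk
    clear * - hk' hc h
    rcases hk' with rfl | rfl | rfl | rfl <;> omega

/-- center of S -/
theorem zS_card (S : Subgroup G) {k : ℕ} (hS : Nat.card S = 37 ^ k) (hk : 0 < k) :
    ∃ i, 0 < i ∧ i ≤ k ∧ Nat.card (S ⊓ Subgroup.centralizer (S : Set G) : Subgroup G) = 37 ^ i := by
  obtain ⟨i, hi, hi2⟩ := (Nat.dvd_prime_pow (by norm_num)).1
    (hS ▸ card_inf_dvd_left S (Subgroup.centralizer (S : Set G)))
  refine ⟨i, ?_, hi, hi2⟩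
  have h1 := fix_count (p := 37) S S hS Subgroup.le_normalizer
  rw [hS, hi2] at h1
  by_contra h
  obtain rfl : i = 0 := by omega
  have : 37 ^ k ≡ 0 [MOD 37] := (Nat.modEq_zero_iff_dvd.2 (dvd_pow_self 37 hk.ne'))
  have h2 := this.symm.trans h1
  revert h2; decide

theorem step2 (hG : Hyp G) (S : Subgroup G) (hS : Nat.card S = 37 ^ 3) :
    Nat.card (Subgroup.normalizer (S : Set G)) = 37 ^ 3 * 432 := by
  rcases step2b hG S hS with h | h
  swap
  · exact h
  exfalso
  obtain ⟨u, t, hu, ht, hut⟩ := hG.inv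
  obtain ⟨S', hS'1, hS'⟩ := exists_S hG (k := 1) (Subgroup.zpowers u) (by rw [Nat.card_zpowers, hu, pow_one])
  obtain ⟨g, rfl⟩ := sylG_conj hG S S' hS hS'
  have hN : Nat.card (Subgroup.normalizer ((g • S : Subgroup G) : Set G)) = 37 ^ 3 * 469 := by
    rw [← conj_normalizer, conj_card, h]
  set T := g • S with hT
  clear_value T
  -- T abelian
  have hTab : T ≤ Subgroup.centralizer (T : Set G) := by
    obtain ⟨Q, hQ, hQc⟩ := exists_sub (p := 67) (k := 1) (m := 37 ^ 3 * 7) _ (hN.trans (by norm_num))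
    obtain ⟨i, hi1, hi2, hi3⟩ := zS_card T hS' (by norm_num)
    have h1 := fix_count (p := 67) (k := 1) Q (T ⊓ Subgroup.centralizer (T : Set G)) hQc (by
      intro q hq
      have hqN := (conj_eq_iff_mem_normalizer q T).2 (hQ hq)
      rw [← conj_eq_iff_mem_normalizer, conj_inf, conj_centralizer, hqN])
    rw [cent_trivial hG (q := 67) (k := i) (by norm_num) _ Q (by rw [hi3]) (by rw [hQc, pow_one]), hi3] at h1
    have hi : i = 3 := by
      interval_cases i
      · revert h1; decide
      · revert h1; decide
      · rfl
    have := Subgroup.eq_of_le_of_card_ge (H := T ⊓ Subgroup.centralizer (T : Set G)) inf_le_left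
      (by rw [hi3, hi, hS'])
    exact this.ge.trans inf_le_right
  have hTH : T ≤ Subgroup.centralizer (Subgroup.zpowers u : Set G) :=
    hTab.trans (Subgroup.centralizer_le hS'1)
  obtain ⟨m, hm, hmc⟩ := cent_form' hG hu _ le_rfl T hTH hS' (not_pow4 hG _)
  have hNH : Subgroup.centralizer (Subgroup.zpowers u : Set G) ⊓ Subgroup.normalizer (T : Set G) = T := by
    symm
    apply Subgroup.eq_of_le_of_card_ge (le_inf hTH Subgroup.le_normalizer)
    rw [hS']
    apply Nat.le_of_dvd (by norm_num)
    have h1 : Nat.card (Subgroup.centralizer (Subgroup.zpowers u : Set G) ⊓ Subgroup.normalizer (T : Set G) : Subgroup G) ∣ 37 ^ 3 * 2592 :=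
      (card_inf_dvd_left _ _).trans (hmc ▸ mul_dvd_mul_left _ hm)
    have h2 : Nat.card (Subgroup.centralizer (Subgroup.zpowers u : Set G) ⊓ Subgroup.normalizer (T : Set G) : Subgroup G) ∣ 37 ^ 3 * 469 :=
      hN ▸ Subgroup.card_dvd_of_le inf_le_right
    have h3 := Nat.dvd_gcd h1 h2
    rwa [show Nat.gcd (37 ^ 3 * 2592) (37 ^ 3 * 469) = 37 ^ 3 by norm_num] at h3
  have hB := lemmaB _ T hTH hS' hmc hm (by rw [hNH]; exact hTab)
  rw [inf_eq_left.2 hB] at hNH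
  have h2 : t ∈ T := by rw [← hNH, mem_cent_zpowers]; exact hut
  have h3 := Subgroup.orderOf_dvd_natCard T h2
  rw [ht, hS'] at h3
  norm_num at h3

end local1
end OD


open scoped Pointwise

namespace OD

section local2
set_option linter.unusedSectionVars false
variable {G : Type*} [Group G] [Finite G]

attribute [local instance] conjAction

theorem dvd_card_of_orbits {A α : Type*} [Group A] [MulAction A α] [Finite α] (n : ℕ)
    (h : ∀ a : α, n ∣ Nat.card (MulAction.orbit A a)) : n ∣ Nat.card α := by
  classical
  have := Fintype.ofFinite (Quotient (MulAction.orbitRel A α))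
  rw [Nat.card_congr (MulAction.selfEquivSigmaOrbits A α), Nat.card_sigma]
  exact Finset.dvd_sum fun ω _ => h _

theorem toSyl (hG : Hyp G) (T : Subgroup G) (hT : Nat.card T = 37 ^ 3) : ∃ P : Sylow 37 G, (P : Subgroup G) = T := by
  obtain ⟨P, hP⟩ := (IsPGroup.of_card hT).exists_le_sylow
  obtain ⟨S, hS, hSc⟩ := exists_S hG (k := 3) T hT
  refine ⟨P, (Subgroup.eq_of_le_of_card_ge hP ?_).symm⟩
  obtain ⟨n, hn⟩ := IsPGroup.iff_card.1 P.2
  have h1 : n ≤ 3 := by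
    by_contra h
    exact not_pow4 hG (P : Subgroup G) (hn ▸ pow_dvd_pow 37 (by omega))
  rw [hT, hn]
  exact Nat.pow_le_pow_right (by norm_num) h1

theorem le_of_normalizes (hG : Hyp G) (X T : Subgroup G) {i : ℕ} (hX : Nat.card X = 37 ^ i)
    (hT : Nat.card T = 37 ^ 3) (hXT : X ≤ Subgroup.normalizer (T : Set G)) : X ≤ T := by
  obtain ⟨P, rfl⟩ := toSyl hG T hT
  have h : X ⊓ Subgroup.normalizer ((P : Subgroup G) : Set G) = X ⊓ (P : Subgroup G) :=
    (IsPGroup.of_card hX).inf_normalizer_sylow P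
  rw [inf_eq_left.2 hXT] at h
  rw [h]; exact inf_le_right

theorem normal_of_index (D S : Subgroup G) {k : ℕ} (hDS : D ≤ S) (hD : Nat.card D = 37 ^ k) (hS : Nat.card S = 37 ^ (k + 1)) :
    S ≤ Subgroup.normalizer (D : Set G) := by
  have h1 := Sylow.prime_pow_dvd_card_normalizer (G := S) (p := 37) (n := k) (by rw [hS]) (H := D.subgroupOf S)
    (by rw [← hD]; exact Nat.card_congr (Subgroup.subgroupOfEquivOfLe hDS).toEquiv)
  have h2 : Subgroup.normalizer ((D.subgroupOf S : Subgroup S) : Set S) = ⊤ := by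
    apply Subgroup.eq_top_of_le_card
    rw [hS]; exact Nat.le_of_dvd Nat.card_pos h1
  intro s hs
  apply mem_normalizer_of_forall
  intro d hd
  have h3 : (⟨s, hs⟩ : S) ∈ Subgroup.normalizer ((D.subgroupOf S : Subgroup S) : Set S) := by rw [h2]; trivial
  have := (Subgroup.mem_normalizer_iff.1 h3 ⟨d, hDS hd⟩).1 (by simpa [Subgroup.mem_subgroupOf] using hd)
  simpa [Subgroup.mem_subgroupOf] using this

theorem step3 (hG : Hyp G) (S : Subgroup G) (hS : Nat.card S = 37 ^ 3) :
    ∃ S' : Subgroup G, Nat.card S' = 37 ^ 3 ∧ S ≠ S' ∧ Nat.card (S ⊓ S' : Subgroup G) = 37 ^ 2 := by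
  by_contra hcon
  push Not at hcon
  let Ω := {T : Subgroup G // Nat.card T = 37 ^ 3 ∧ T ≠ S}
  have hconjS : ∀ s ∈ S, s • S = S := fun s hs => (conj_eq_iff_mem_normalizer s S).2 (Subgroup.le_normalizer hs)
  let A : MulAction S Ω :=
    { smul := fun s T => ⟨(s : G) • (T : Subgroup G), (conj_card _ _).trans T.2.1, fun h => T.2.2
        (smul_left_cancel (s : G) (h.trans (hconjS s s.2).symm))⟩
      one_smul := fun T => Subtype.ext (one_smul G _)
      mul_smul := fun s t T => Subtype.ext (mul_smul (s : G) (t : G) (T : Subgroup G)) }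
  have hdvd : 37 ^ 2 ∣ Nat.card Ω := by
    apply dvd_card_of_orbits (A := S)
    rintro ⟨T, hT, hTS⟩
    have h1 := (MulAction.stabilizer S (⟨T, hT, hTS⟩ : Ω)).index_mul_card
    rw [MulAction.index_stabilizer, ← Nat.card_coe_set_eq, hS] at h1
    have h2 : Nat.card (MulAction.stabilizer S (⟨T, hT, hTS⟩ : Ω)) = Nat.card (S ⊓ T : Subgroup G) := by
      have : MulAction.stabilizer S (⟨T, hT, hTS⟩ : Ω) = T.subgroupOf S := by
        ext x
        rw [MulAction.mem_stabilizer_iff, Subgroup.mem_subgroupOf]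
        constructor
        · intro hx
          have hx2 : (x : G) • T = T := congrArg Subtype.val hx
          rw [conj_eq_iff_mem_normalizer] at hx2
          obtain ⟨P, hP⟩ := toSyl hG T hT
          have h3 : S ⊓ Subgroup.normalizer ((P : Subgroup G) : Set G) = S ⊓ (P : Subgroup G) :=
            (IsPGroup.of_card hS).inf_normalizer_sylow P
          rw [hP] at h3
          have h4 : (x : G) ∈ S ⊓ Subgroup.normalizer (T : Set G) := ⟨x.2, hx2⟩
          rw [h3] at h4; exact h4.2
        · intro hx
          exact Subtype.ext ((conj_eq_iff_mem_normalizer (x : G) T).2 (Subgroup.le_normalizer hx))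
      rw [this, ← Subgroup.inf_subgroupOf_left]
      exact Nat.card_congr (Subgroup.subgroupOfEquivOfLe inf_le_left).toEquiv
    rw [h2] at h1
    obtain ⟨i, hi, hi2⟩ := (Nat.dvd_prime_pow (by norm_num)).1 (hS ▸ card_inf_dvd_left S T)
    have h3 : i ≠ 3 := by
      rintro rfl
      have := Subgroup.eq_of_le_of_card_ge (H := S ⊓ T) inf_le_left (by rw [hi2, hS])
      have h4 : S ≤ T := this.ge.trans inf_le_right
      exact hTS (Subgroup.eq_of_le_of_card_ge h4 (by rw [hS, hT])).symm
    have h4 : i ≠ 2 := by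
      rintro rfl
      exact hcon T hT (Ne.symm hTS) hi2
    rw [hi2] at h1
    have h5 : 37 ^ (1 - i) * 37 ^ 2 * 37 ^ i = 37 ^ 3 := by
      have : i = 0 ∨ i = 1 := by omega
      rcases this with rfl | rfl <;> norm_num
    have := Nat.eq_of_mul_eq_mul_right (by positivity) (h1.trans h5.symm)
    rw [this]; exact dvd_mul_left _ _
  obtain ⟨c, hc1, hc2, hc3⟩ := syl_count (p := 37) (k := 3) (m := 2 ^ 5 * 3 ^ 4 * 7 * 19 * 67) ⊤ S le_top hS
    (by rw [Subgroup.card_top, hG.card]; ring) (by norm_num)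
  rw [top_inf_eq, Subgroup.card_top, hG.card, step2 hG S hS] at hc1
  have hc : c = 53466 := by clear * - hc1; omega
  have hΩ : Nat.card Ω = 53465 := by
    have e : Ω ≃ ((subs (⊤ : Subgroup G) (37 ^ 3)) \ {S} : Set (Subgroup G)) :=
      { toFun := fun T => ⟨T.1, ⟨le_top, T.2.1⟩, T.2.2⟩
        invFun := fun T => ⟨T.1, T.2.1.2, T.2.2⟩
        left_inv := fun T => rfl
        right_inv := fun T => rfl }
    rw [Nat.card_congr e, Nat.card_coe_set_eq, Set.ncard_sdiff_singleton_of_mem (show S ∈ subs ⊤ (37 ^ 3) from ⟨le_top, hS⟩),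
      ← Nat.card_coe_set_eq, hc3, hc]
  rw [hΩ] at hdvd
  norm_num at hdvd

theorem exists_succ {p n : ℕ} [Fact p.Prime] (L N : Subgroup G) (hL : L ≤ N) (hLc : Nat.card L = p ^ n)
    (h : p ^ (n + 1) ∣ Nat.card N) : ∃ K, L ≤ K ∧ K ≤ N ∧ Nat.card K = p ^ (n + 1) := by
  obtain ⟨K, hK, hLK⟩ := Sylow.exists_subgroup_card_pow_succ (G := N) h (H := L.subgroupOf N)
    (by rw [← hLc]; exact Nat.card_congr (Subgroup.subgroupOfEquivOfLe hL).toEquiv)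
  refine ⟨K.map N.subtype, ?_, Subgroup.map_subtype_le K, ?_⟩
  · intro x hx
    exact ⟨⟨x, hL hx⟩, hLK (by simpa [Subgroup.mem_subgroupOf] using hx), rfl⟩
  · rw [← hK]
    exact (Nat.card_congr (Subgroup.equivMapOfInjective K N.subtype N.subtype_injective).toEquiv).symm

theorem exists_u {k : ℕ} (D : Subgroup G) (hD : Nat.card D = 37 ^ k) (hk : k ≠ 0) :
    ∃ u ∈ D, orderOf u = 37 ∧ Subgroup.centralizer (D : Set G) ≤ Subgroup.centralizer (Subgroup.zpowers u : Set G) := by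
  obtain ⟨u, hu, huo⟩ := exists_order (p := 37) D (by rw [hD]; exact dvd_pow_self _ hk)
  refine ⟨u, hu, huo, Subgroup.centralizer_le ?_⟩
  exact (Subgroup.zpowers_le.2 hu : Subgroup.zpowers u ≤ D)

theorem comm_of_card_sq {p : ℕ} [Fact p.Prime] (K : Subgroup G) (hK : Nat.card K = p ^ 2) :
    K ≤ Subgroup.centralizer (K : Set G) := by
  intro x hx
  rw [Subgroup.mem_centralizer_iff]
  intro y hy
  have := IsPGroup.commutative_of_card_eq_prime_sq hK ⟨y, hy⟩ ⟨x, hx⟩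
  exact congrArg Subtype.val this

theorem div2592 : ∀ c, c ∣ 2592 → c ≡ 1 [MOD 37] → c = 1 ∨ c = 1296 := by
  have : ∀ c ∈ Nat.divisors 2592, c % 37 = 1 → c = 1 ∨ c = 1296 := by decide +kernel
  intro c hc h
  exact this c (Nat.mem_divisors.2 ⟨hc, by norm_num⟩) h

theorem step4a (hG : Hyp G) (S S' : Subgroup G) (hS : Nat.card S = 37 ^ 3) (hS' : Nat.card S' = 37 ^ 3)
    (hne : S ≠ S') (hD : Nat.card (S ⊓ S' : Subgroup G) = 37 ^ 2) :
    ¬ S ≤ Subgroup.centralizer (S : Set G) := by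
  intro hab
  have hab' : S' ≤ Subgroup.centralizer (S' : Set G) := by
    obtain ⟨g, rfl⟩ := sylG_conj hG S S' hS hS'
    rw [← conj_centralizer]; exact conj_mono g hab
  set D := S ⊓ S' with hDdef
  have hDS : D ≤ S := inf_le_left
  have hDS' : D ≤ S' := inf_le_right
  set H := Subgroup.centralizer (D : Set G) with hH
  have hSH : S ≤ H := hab.trans (Subgroup.centralizer_le hDS)
  have hS'H : S' ≤ H := hab'.trans (Subgroup.centralizer_le hDS')
  obtain ⟨u, huD, hu, huC⟩ := exists_u D hD (by norm_num)
  obtain ⟨m, hm, hmc⟩ := cent_form' hG hu H huC S hSH hS (not_pow4 hG _)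
  have hHN : ¬ H ≤ Subgroup.normalizer (S : Set G) := fun h =>
    hne (Subgroup.eq_of_le_of_card_ge (le_of_normalizes hG S' S hS' hS (hS'H.trans h)) (by rw [hS, hS'])).symm
  obtain ⟨c, hc1, hc2, -⟩ := syl_count (p := 37) H S hSH hS hmc
    (fun h => absurd (h.trans hm) (by norm_num))
  have hnc : ¬ H ⊓ Subgroup.normalizer (S : Set G) ≤ Subgroup.centralizer (S : Set G) := fun h =>
    hHN (lemmaB H S hSH hS hmc hm h)
  obtain ⟨n, hn⟩ : 37 ^ 3 ∣ Nat.card (H ⊓ Subgroup.normalizer (S : Set G) : Subgroup G) :=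
    hS ▸ Subgroup.card_dvd_of_le (le_inf hSH Subgroup.le_normalizer)
  have hmn : m = c * n := by
    rw [hmc, hn] at hc1
    have : 37 ^ 3 * m = 37 ^ 3 * (c * n) := by rw [hc1]; ring
    exact Nat.eq_of_mul_eq_mul_left (by positivity) this
  have hc : c = 1296 := by
    rcases div2592 c ((Dvd.intro _ hmn.symm).trans hm) hc2 with h | h
    · exfalso
      rw [h, one_mul] at hc1
      have := Subgroup.eq_of_le_of_card_ge (H := H ⊓ Subgroup.normalizer (S : Set G)) inf_le_left hc1.le
      exact hHN (this.ge.trans inf_le_right)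
    · exact h
  have hn2 : n = 1 ∨ n = 2 := by
    have h1 : 1296 * n ∣ 1296 * 2 := by rw [← hc, ← hmn, hc]; exact hm
    have h2 := Nat.dvd_of_mul_dvd_mul_left (by norm_num) h1
    exact (Nat.dvd_prime Nat.prime_two).1 h2
  rcases hn2 with rfl | rfl
  · have := Subgroup.eq_of_le_of_card_ge (K := H ⊓ Subgroup.normalizer (S : Set G))
      (le_inf hSH Subgroup.le_normalizer) (by rw [hn, hS, mul_one])
    exact hnc (this ▸ hab)
  · obtain ⟨s, hsH, hso⟩ := exists_order (p := 2) (H ⊓ Subgroup.normalizer (S : Set G)) (by rw [hn]; norm_num)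
    have hsC : s ∉ Subgroup.centralizer (S : Set G) := by
      intro hs
      apply hnc
      have h1 : 37 ^ 3 * 2 ∣ Nat.card ((H ⊓ Subgroup.normalizer (S : Set G)) ⊓ Subgroup.centralizer (S : Set G) : Subgroup G) := by
        apply Nat.Coprime.mul_dvd_of_dvd_of_dvd (by norm_num)
        · rw [← hS]; exact Subgroup.card_dvd_of_le (le_inf (le_inf hSH Subgroup.le_normalizer) hab)
        · rw [← hso]; exact Subgroup.orderOf_dvd_natCard _ ⟨hsH, hs⟩
      have := Subgroup.eq_of_le_of_card_ge
        (H := (H ⊓ Subgroup.normalizer (S : Set G)) ⊓ Subgroup.centralizer (S : Set G)) inf_le_left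
        (by rw [hn]; exact Nat.le_of_dvd Nat.card_pos h1)
      exact this.ge.trans inf_le_right
    have hCD : S ⊓ Subgroup.centralizer (Subgroup.zpowers s : Set G) = D := by
      symm
      apply Subgroup.eq_of_le_of_card_ge
      · refine le_inf hDS fun d hd => ?_
        rw [mem_cent_zpowers]
        exact ((Subgroup.mem_centralizer_iff.1 hsH.1) d hd).symm
      · obtain ⟨i, hi, hi2⟩ := (Nat.dvd_prime_pow (by norm_num)).1 (hS ▸ card_inf_dvd_left S (Subgroup.centralizer (Subgroup.zpowers s : Set G)))
        have h3 : i ≠ 3 := by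
          rintro rfl
          have := Subgroup.eq_of_le_of_card_ge (H := S ⊓ Subgroup.centralizer (Subgroup.zpowers s : Set G))
            inf_le_left (by rw [hi2, hS])
          apply hsC
          rw [Subgroup.mem_centralizer_iff]
          intro x hx
          exact ((mem_cent_zpowers s x).1 (this.ge hx).2).symm
        rw [hi2, hD]
        exact Nat.pow_le_pow_right (by norm_num) (by omega)
    obtain ⟨K, hsK, hKN, hKc⟩ := exists_succ (p := 2) (n := 1) (Subgroup.zpowers s) (Subgroup.normalizer (S : Set G))
      (Subgroup.zpowers_le.2 hsH.2) (by rw [Nat.card_zpowers, hso, pow_one]) (by rw [step2 hG S hS]; norm_num)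
    have hKab := comm_of_card_sq K hKc
    have hKD : K ≤ Subgroup.normalizer (D : Set G) := by
      intro k hk
      have h1 := (conj_eq_iff_mem_normalizer k S).2 (hKN hk)
      have h2 : k • Subgroup.zpowers s = Subgroup.zpowers s := by
        rw [conj_eq_iff_mem_normalizer]
        apply centralizer_le_normalizer
        exact Subgroup.centralizer_le hsK (hKab hk)
      rw [← conj_eq_iff_mem_normalizer, ← hCD, conj_inf, conj_centralizer, h1, h2]
    have hHle : H ≤ Subgroup.normalizer (D : Set G) := centralizer_le_normalizer D
    have hKH : K ≤ H := by
      intro k hk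
      have hnorm : (H.subgroupOf (Subgroup.normalizer (D : Set G))).Normal := by
        rw [hH, ← Subgroup.normalizerMonoidHom_ker]; infer_instance
      have hq : H.relIndex (Subgroup.normalizer (D : Set G)) * Nat.card H =
          Nat.card (Subgroup.normalizer (D : Set G)) := by
        rw [← Nat.card_congr (Subgroup.subgroupOfEquivOfLe hHle).toEquiv]
        exact Subgroup.index_mul_card _
      have hodd : ¬ 2 ∣ H.relIndex (Subgroup.normalizer (D : Set G)) := by
        rintro ⟨q, hq2⟩
        have h1 := Subgroup.card_subgroup_dvd_card (Subgroup.normalizer (D : Set G))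
        rw [← hq, hq2, hmc, hmn, hc, hG.card] at h1
        have h2 : 2 ^ 6 ∣ 2 ^ 5 * 3 ^ 4 * 7 * 19 * 37 ^ 3 * 67 :=
          Dvd.dvd.trans ⟨q * (37 ^ 3 * 81), by ring⟩ h1
        norm_num at h2
      have h1 : (⟨k, hKD hk⟩ : Subgroup.normalizer (D : Set G)) ^ (H.relIndex (Subgroup.normalizer (D : Set G))) ∈
          H.subgroupOf (Subgroup.normalizer (D : Set G)) := Subgroup.pow_index_mem _ _
      have h2 : k ^ (H.relIndex (Subgroup.normalizer (D : Set G))) ∈ H := h1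
      have h3 : k ^ 4 ∈ H := by
        have : k ^ 4 = 1 := orderOf_dvd_iff_pow_eq_one.1 (by
          have := Subgroup.orderOf_dvd_natCard K hk; rw [hKc] at this; exact this)
        rw [this]; exact H.one_mem
      have hcop : Nat.Coprime 4 (H.relIndex (Subgroup.normalizer (D : Set G))) := by
        rw [show 4 = 2 ^ 2 by norm_num]
        exact Nat.Coprime.pow_left _ ((Nat.Prime.coprime_iff_not_dvd Nat.prime_two).2 hodd)
      have hz := Nat.gcd_eq_gcd_ab 4 (H.relIndex (Subgroup.normalizer (D : Set G)))
      rw [hcop] at hz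
      have : k = (k ^ 4) ^ (Nat.gcdA 4 (H.relIndex (Subgroup.normalizer (D : Set G)))) *
          (k ^ (H.relIndex (Subgroup.normalizer (D : Set G)))) ^ (Nat.gcdB 4 (H.relIndex (Subgroup.normalizer (D : Set G)))) := by
        rw [← zpow_natCast, ← zpow_natCast, ← zpow_mul, ← zpow_mul, ← zpow_add, ← hz]; simp
      rw [this]
      exact H.mul_mem (H.zpow_mem h3 _) (H.zpow_mem h2 _)
    have h4 : 2 ^ (1 + 1) ∣ 37 ^ 3 * 2 := by
      rw [← hn, ← hKc]; exact Subgroup.card_dvd_of_le (le_inf hKH hKN)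
    norm_num at h4

end local2
end OD


open scoped Pointwise

namespace OD

section local3
set_option linter.unusedSectionVars false
variable {G : Type*} [Group G] [Finite G]

attribute [local instance] conjAction

theorem nonab (hG : Hyp G) (T : Subgroup G) (hT : Nat.card T = 37 ^ 3) :
    ¬ T ≤ Subgroup.centralizer (T : Set G) := by
  obtain ⟨S', hS', hne, hD⟩ := step3 hG T hT
  exact step4a hG T S' hT hS' hne hD

theorem eq_of_gt (A X T : Subgroup G) (hA : Nat.card A = 37 ^ 2) (hT : Nat.card T = 37 ^ 3)
    (hAX : A ≤ X) (hXT : X ≤ T) {x : G} (hx : x ∈ X) (hxA : x ∉ A) : X = T := by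
  obtain ⟨i, hi, hi2⟩ := (Nat.dvd_prime_pow (by norm_num)).1 (hT ▸ Subgroup.card_dvd_of_le hXT)
  have h3 : i = 3 := by
    by_contra h
    have : A = X := Subgroup.eq_of_le_of_card_ge hAX (by
      rw [hA, hi2]; exact Nat.pow_le_pow_right (by norm_num) (by omega))
    exact hxA (this ▸ hx)
  subst h3
  exact Subgroup.eq_of_le_of_card_ge hXT (by rw [hi2, hT])

theorem center_card (hG : Hyp G) (T : Subgroup G) (hT : Nat.card T = 37 ^ 3) :
    Nat.card (T ⊓ Subgroup.centralizer (T : Set G) : Subgroup G) = 37 := by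
  obtain ⟨i, hi, hi2, hi3⟩ := zS_card T hT (by norm_num)
  have h3 : i ≠ 3 := by
    rintro rfl
    have := Subgroup.eq_of_le_of_card_ge (H := T ⊓ Subgroup.centralizer (T : Set G)) inf_le_left
      (by rw [hi3, hT])
    exact nonab hG T hT (this.ge.trans inf_le_right)
  have h2 : i ≠ 2 := by
    rintro rfl
    obtain ⟨x, hxT, hxZ⟩ : ∃ x ∈ T, x ∉ T ⊓ Subgroup.centralizer (T : Set G) := by
      by_contra h
      push Not at h
      exact nonab hG T hT ((show T ≤ _ from h).trans inf_le_right)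
    have := eq_of_gt (T ⊓ Subgroup.centralizer (T : Set G))
      (T ⊓ Subgroup.centralizer (Subgroup.zpowers x : Set G)) T hi3 hT
      (inf_le_inf_left _ (Subgroup.centralizer_le (Subgroup.zpowers_le.2 hxT))) inf_le_left
      (x := x) ⟨hxT, (mem_cent_zpowers x x).2 (Commute.refl x)⟩ hxZ
    apply hxZ
    refine ⟨hxT, Subgroup.mem_centralizer_iff.2 fun y hy => ?_⟩
    exact ((mem_cent_zpowers x y).1 (this.ge hy).2).symm
  obtain rfl : i = 1 := by omega
  simpa using hi3

theorem cent_D (hG : Hyp G) (D T : Subgroup G) (hT : Nat.card T = 37 ^ 3) (hD : Nat.card D = 37 ^ 2)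
    (hDT : D ≤ T) : T ⊓ Subgroup.centralizer (D : Set G) = D := by
  apply le_antisymm _ (le_inf hDT (comm_of_card_sq D hD))
  intro x hx
  by_contra hxD
  have h1 := eq_of_gt D (T ⊓ Subgroup.centralizer (D : Set G)) T hD hT
    (le_inf hDT (comm_of_card_sq D hD)) inf_le_left hx hxD
  have h2 : D ≤ T ⊓ Subgroup.centralizer (T : Set G) := by
    refine le_inf hDT fun d hd => Subgroup.mem_centralizer_iff.2 fun y hy => ?_
    exact (Subgroup.mem_centralizer_iff.1 (h1.ge hy).2 d hd).symm
  have h3 := Subgroup.card_dvd_of_le h2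
  rw [hD, center_card hG T hT] at h3
  norm_num at h3

theorem center_le_D (hG : Hyp G) (D T : Subgroup G) (hT : Nat.card T = 37 ^ 3) (hD : Nat.card D = 37 ^ 2)
    (hDT : D ≤ T) : T ⊓ Subgroup.centralizer (T : Set G) ≤ D :=
  (inf_le_inf_left _ (Subgroup.centralizer_le hDT)).trans (cent_D hG D T hT hD hDT).le

theorem cent_le_norm (hG : Hyp G) (D T : Subgroup G) (hT : Nat.card T = 37 ^ 3) (hD : Nat.card D = 37 ^ 2)
    (hDT : D ≤ T) : Subgroup.centralizer (D : Set G) ≤ Subgroup.normalizer (T : Set G) := by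
  set H := Subgroup.centralizer (D : Set G) with hH
  have hDH : D ≤ H := comm_of_card_sq D hD
  obtain ⟨u, huD, hu, huC⟩ := exists_u D hD (by norm_num)
  obtain ⟨m, hm, hmc⟩ := cent_form' hG hu H huC D hDH hD (by
    intro h
    obtain ⟨W, hDW, hWH, hWc⟩ := exists_succ D H hDH hD h
    have := cent_D hG D W hWc hD hDW
    rw [inf_eq_left.2 hWH] at this
    rw [this, hD] at hWc
    norm_num at hWc)
  have hTD := normal_of_index D T hDT hD hT
  have h1 := lemmaA T H D hT (hTD.trans (normalizer_le_normalizer_centralizer D)) hDH le_rfl hD hmc hm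
  set K := H ⊓ Subgroup.centralizer (T : Set G)
  have h2 : D ⊔ K = H := by
    apply Subgroup.eq_of_le_of_card_ge (sup_le hDH inf_le_left)
    rw [hmc]
    apply Nat.le_of_dvd Nat.card_pos
    apply Nat.Coprime.mul_dvd_of_dvd_of_dvd
    · exact Nat.Coprime.coprime_dvd_right hm (by norm_num)
    · rw [← hD]; exact Subgroup.card_dvd_of_le le_sup_left
    · exact h1.trans (Subgroup.card_dvd_of_le le_sup_right)
  rw [← h2]
  exact sup_le (hDT.trans Subgroup.le_normalizer) (inf_le_right.trans (centralizer_le_normalizer T))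

theorem comm_mem (hG : Hyp G) (T : Subgroup G) (hT : Nat.card T = 37 ^ 3) {a b : G} (ha : a ∈ T) (hb : b ∈ T) :
    a * b * a⁻¹ * b⁻¹ ∈ T ⊓ Subgroup.centralizer (T : Set G) := by
  have hc : (T ⊓ Subgroup.centralizer (T : Set G)).subgroupOf T = Subgroup.center T := by
    ext x
    rw [Subgroup.mem_subgroupOf, Subgroup.mem_center_iff, Subgroup.mem_inf, Subgroup.mem_centralizer_iff]
    constructor
    · intro h g
      exact Subtype.ext (h.2 g g.2)
    · intro h
      exact ⟨x.2, fun g hg => congrArg Subtype.val (h ⟨g, hg⟩)⟩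
  have h1 : Nat.card (Subgroup.center T) = 37 := by
    rw [← hc, ← center_card hG T hT]
    exact Nat.card_congr (Subgroup.subgroupOfEquivOfLe inf_le_left).toEquiv
  have h2 : Nat.card (T ⧸ Subgroup.center T) = 37 ^ 2 := by
    have := Subgroup.card_eq_card_quotient_mul_card_subgroup (Subgroup.center T)
    rw [h1, hT] at this
    omega
  have h3 := IsPGroup.commutative_of_card_eq_prime_sq h2 (QuotientGroup.mk (⟨a, ha⟩ : T)) (QuotientGroup.mk (⟨b, hb⟩ : T))
  rw [← QuotientGroup.mk_mul, ← QuotientGroup.mk_mul, eq_comm, QuotientGroup.eq, ← hc, Subgroup.mem_subgroupOf] at h3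
  have h4 := Subgroup.mem_centralizer_iff.1 h3.2 (b * a) (T.mul_mem hb ha)
  have h5 : a * b * a⁻¹ * b⁻¹ = (b * a)⁻¹ * (a * b) := by
    simp only [Subgroup.coe_mul, Subgroup.coe_inv] at h4
    rw [mul_inv_cancel_left] at h4
    calc a * b * a⁻¹ * b⁻¹ = (a * b) * (b * a)⁻¹ := by group
      _ = _ := by rw [mul_inv_eq_iff_eq_mul]; exact h4
  rw [h5]
  exact h3

theorem prime_gen {z c : G} (hz : orderOf z = 37) (hc : c ∈ Subgroup.zpowers z) (hc1 : c ≠ 1) {x : G}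
    (hx : x ∈ Subgroup.zpowers z) : ∃ k : ℕ, x = c ^ k := by
  have h1 : Subgroup.zpowers c ≤ Subgroup.zpowers z := Subgroup.zpowers_le.2 hc
  have h2 := Subgroup.card_dvd_of_le h1
  rw [Nat.card_zpowers, Nat.card_zpowers, hz] at h2
  have h3 : orderOf c = 37 := by
    rcases (Nat.dvd_prime (by norm_num)).1 h2 with h | h
    · exact absurd (orderOf_eq_one_iff.1 h) hc1
    · exact h
  have h4 := Subgroup.eq_of_le_of_card_ge h1 (by rw [Nat.card_zpowers, Nat.card_zpowers, h3, hz])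
  rw [← h4, ← mem_powers_iff_mem_zpowers] at hx
  obtain ⟨k, hk⟩ := hx
  exact ⟨k, hk.symm⟩

theorem conj_pow_comm {s d c : G} (h : s * d * s⁻¹ = c * d) (hc : Commute s c) (k : ℕ) :
    s ^ k * d * (s ^ k)⁻¹ = c ^ k * d := by
  induction k with
  | zero => simp
  | succ k ih =>
    calc s ^ (k + 1) * d * (s ^ (k + 1))⁻¹ = s * (s ^ k * d * (s ^ k)⁻¹) * s⁻¹ := by
          rw [pow_succ']; group
      _ = s * (c ^ k) * s⁻¹ * (s * d * s⁻¹) := by rw [ih]; group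
      _ = c ^ k * (c * d) := by rw [h, (hc.pow_right k).eq]; group
      _ = _ := by rw [pow_succ]; group

theorem comm_surj (hG : Hyp G) (T : Subgroup G) (hT : Nat.card T = 37 ^ 3) {z d c : G} (hz : orderOf z = 37)
    (hZ : T ⊓ Subgroup.centralizer (T : Set G) = Subgroup.zpowers z) (hd : d ∈ T)
    (hdZ : d ∉ Subgroup.zpowers z) (hc : c ∈ Subgroup.zpowers z) : ∃ s ∈ T, s * d * s⁻¹ = c * d := by
  obtain ⟨s, hs, hsd⟩ : ∃ s ∈ T, s * d * s⁻¹ * d⁻¹ ≠ 1 := by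
    by_contra h
    push Not at h
    apply hdZ
    rw [← hZ]
    refine ⟨hd, Subgroup.mem_centralizer_iff.2 fun y hy => ?_⟩
    have := h y hy
    rw [mul_inv_eq_one, mul_inv_eq_iff_eq_mul] at this
    exact this
  have h1 := comm_mem hG T hT hs hd
  have h2 : Commute s (s * d * s⁻¹ * d⁻¹) := Subgroup.mem_centralizer_iff.1 h1.2 s hs
  obtain ⟨k, hk⟩ := prime_gen hz (hZ ▸ h1) hsd hc
  refine ⟨s ^ k, T.pow_mem hs k, ?_⟩
  rw [conj_pow_comm (c := s * d * s⁻¹ * d⁻¹) (by group) h2, hk]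

theorem D_gen {D : Subgroup G} (hD : Nat.card D = 37 ^ 2) {z d : G} (hz : orderOf z = 37) (hzD : z ∈ D) (hd : d ∈ D)
    (hdz : d ∉ Subgroup.zpowers z) : Subgroup.closure {z, d} = D := by
  have h1 : Subgroup.closure {z, d} ≤ D := by
    rw [Subgroup.closure_le]
    rintro x (rfl | rfl) <;> assumption
  have h2 : Subgroup.zpowers z ≤ Subgroup.closure {z, d} :=
    Subgroup.zpowers_le.2 (Subgroup.subset_closure (by simp))
  have hdc : d ∈ Subgroup.closure {z, d} := Subgroup.subset_closure (by simp)
  obtain ⟨i, hi, hi2⟩ := (Nat.dvd_prime_pow (by norm_num)).1 (hD ▸ Subgroup.card_dvd_of_le h1)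
  apply Subgroup.eq_of_le_of_card_ge h1
  rw [hD, hi2]
  apply Nat.pow_le_pow_right (by norm_num)
  by_contra h
  have : Subgroup.zpowers z = Subgroup.closure {z, d} := Subgroup.eq_of_le_of_card_ge h2 (by
    rw [hi2, Nat.card_zpowers, hz]
    exact (Nat.pow_le_pow_right (by norm_num) (show i ≤ 1 by omega)).trans (by norm_num))
  exact hdz (this ▸ hdc)

theorem eq_of_center_eq (hG : Hyp G) (D T₁ T₂ : Subgroup G) (hT₁ : Nat.card T₁ = 37 ^ 3) (hT₂ : Nat.card T₂ = 37 ^ 3)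
    (hD : Nat.card D = 37 ^ 2) (hD₁ : D ≤ T₁) (hD₂ : D ≤ T₂)
    (h : T₁ ⊓ Subgroup.centralizer (T₁ : Set G) = T₂ ⊓ Subgroup.centralizer (T₂ : Set G)) : T₁ = T₂ := by
  obtain ⟨z, hz, hZ⟩ := zpowers_eq (p := 37) _ (center_card hG T₁ hT₁)
  have hZ2 := h.symm.trans hZ
  have hzD : z ∈ D := center_le_D hG D T₁ hT₁ hD hD₁ (hZ ▸ Subgroup.mem_zpowers z)
  obtain ⟨d, hd, hdz⟩ : ∃ d ∈ D, d ∉ Subgroup.zpowers z := by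
    by_contra h
    push Not at h
    have := Subgroup.card_dvd_of_le (show D ≤ _ from h)
    rw [hD, Nat.card_zpowers, hz] at this
    norm_num at this
  symm
  refine Subgroup.eq_of_le_of_card_ge (le_of_normalizes hG T₂ T₁ hT₂ hT₁ ?_) (by rw [hT₁, hT₂])
  intro s₂ hs₂
  obtain ⟨s₁, hs₁, h1⟩ := comm_surj hG T₁ hT₁ hz hZ (hD₁ hd) hdz (hZ2 ▸ comm_mem hG T₂ hT₂ hs₂ (hD₂ hd))
  have h2 : s₁ * d * s₁⁻¹ = s₂ * d * s₂⁻¹ := by rw [h1]; group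
  have h3 : s₁⁻¹ * s₂ ∈ Subgroup.centralizer (D : Set G) := by
    rw [← D_gen hD hz hzD hd hdz, Subgroup.centralizer_closure, Subgroup.mem_centralizer_iff]
    have hz1 : z ∈ T₁ ⊓ Subgroup.centralizer (T₁ : Set G) := hZ ▸ Subgroup.mem_zpowers z
    have hz2 : z ∈ T₂ ⊓ Subgroup.centralizer (T₂ : Set G) := hZ2 ▸ Subgroup.mem_zpowers z
    rintro x (rfl | rfl)
    · have e1 : Commute s₁ x := Subgroup.mem_centralizer_iff.1 hz1.2 _ hs₁
      have e2 : Commute s₂ x := Subgroup.mem_centralizer_iff.1 hz2.2 _ hs₂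
      exact (e1.inv_left.mul_left e2).symm.eq
    · have : s₁⁻¹ * (s₁ * x * s₁⁻¹) * s₂ = s₁⁻¹ * (s₂ * x * s₂⁻¹) * s₂ := by rw [h2]
      simpa [mul_assoc] using this
  have h4 := cent_le_norm hG D T₁ hT₁ hD hD₁ h3
  have := (Subgroup.normalizer (T₁ : Set G)).mul_mem (Subgroup.le_normalizer hs₁) h4
  rwa [mul_inv_cancel_left] at this

end local3
end OD


open scoped Pointwise

namespace OD

section local4
set_option linter.unusedSectionVars false
variable {G : Type*} [Group G] [Finite G]

attribute [local instance] conjAction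

theorem act_pow {s z w : G} (h : s * w * s⁻¹ = z * w) (hs : Commute s z) (hzw : Commute z w) (k a b : ℕ) :
    s ^ k * (z ^ a * w ^ b) * (s ^ k)⁻¹ = z ^ (a + k * b) * w ^ b := by
  have h1 := conj_pow_comm h hs k
  have h2 : s ^ k * z ^ a * (s ^ k)⁻¹ = z ^ a := by
    rw [((hs.pow_left k).pow_right a).eq, mul_inv_cancel_right]
  calc s ^ k * (z ^ a * w ^ b) * (s ^ k)⁻¹ = (s ^ k * z ^ a * (s ^ k)⁻¹) * (s ^ k * w ^ b * (s ^ k)⁻¹) := by group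
    _ = z ^ a * (s ^ k * w * (s ^ k)⁻¹) ^ b := by rw [h2, conj_pow]
    _ = _ := by rw [h1, (hzw.pow_left k).mul_pow, ← pow_mul, pow_add, mul_assoc]

theorem act_pow' {s z w : G} (h : s * z * s⁻¹ = w * z) (hs : Commute s w) (hzw : Commute z w) (k a b : ℕ) :
    s ^ k * (z ^ a * w ^ b) * (s ^ k)⁻¹ = z ^ a * w ^ (b + k * a) := by
  rw [((hzw.pow_left a).pow_right b).eq, act_pow h hs hzw.symm, ((hzw.pow_left a).pow_right _).eq]

theorem exists_coords {D : Subgroup G} (hD : Nat.card D = 37 ^ 2) {z w : G} (hz : orderOf z = 37) (hw : orderOf w = 37)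
    (hzD : z ∈ D) (hwD : w ∈ D) (hwz : w ∉ Subgroup.zpowers z) {d : G} (hd : d ∈ D) :
    ∃ a b : ℕ, d = z ^ a * w ^ b := by
  have hzw : Commute z w := Subgroup.mem_centralizer_iff.1 (comm_of_card_sq D hD hwD) z hzD
  have hz37 : z ^ 37 = 1 := hz ▸ pow_orderOf_eq_one z
  have hw37 : w ^ 37 = 1 := hw ▸ pow_orderOf_eq_one w
  rw [← D_gen hD hz hzD hwD hwz] at hd
  induction hd using Subgroup.closure_induction with
  | mem x hx =>
    rcases hx with rfl | rfl
    · exact ⟨1, 0, by simp⟩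
    · exact ⟨0, 1, by simp⟩
  | one => exact ⟨0, 0, by simp⟩
  | mul x y _ _ hx hy =>
    obtain ⟨a, b, rfl⟩ := hx
    obtain ⟨c, d, rfl⟩ := hy
    refine ⟨a + c, b + d, ?_⟩
    rw [pow_add, pow_add, ((hzw.pow_left c).pow_right b).mul_mul_mul_comm]
  | inv x _ hx =>
    obtain ⟨a, b, rfl⟩ := hx
    refine ⟨36 * a, 36 * b, ?_⟩
    rw [inv_eq_iff_mul_eq_one, ((hzw.pow_left _).pow_right _).symm.mul_mul_mul_comm, ← pow_add, ← pow_add,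
      show a + 36 * a = 37 * a by ring, show b + 36 * b = 37 * b by ring, pow_mul, pow_mul, hz37, hw37]
    simp

theorem solve37 (a b : ℕ) (hb : ¬ 37 ∣ b) : ∃ j, 1 + j * b ≡ a [MOD 37] := by
  have hb' : (b : ZMod 37) ≠ 0 := fun h => hb ((ZMod.natCast_eq_zero_iff b 37).1 h)
  refine ⟨(((a : ZMod 37) - 1) / b).val, ?_⟩
  rw [← ZMod.natCast_eq_natCast_iff]
  push_cast
  rw [ZMod.natCast_zmod_val, div_mul_cancel₀ _ hb']
  ring

theorem pow37_congr {z : G} (hz : orderOf z = 37) {a b : ℕ} (h : a ≡ b [MOD 37]) : z ^ a = z ^ b :=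
  pow_eq_pow_iff_modEq.2 (hz ▸ h)

theorem config (hG : Hyp G) : ∃ (S D : Subgroup G) (z w h : G), Nat.card S = 37 ^ 3 ∧ Nat.card D = 37 ^ 2 ∧ D ≤ S ∧
    orderOf z = 37 ∧ orderOf w = 37 ∧ S ⊓ Subgroup.centralizer (S : Set G) = Subgroup.zpowers z ∧ z ∈ D ∧ w ∈ D ∧
    w ∉ Subgroup.zpowers z ∧ h ∈ Subgroup.normalizer (D : Set G) ∧ h * z * h⁻¹ = z ^ 2 ∧ h * w * h⁻¹ = w ^ 19 ∧
    ∀ d ∈ D, d ≠ 1 → ∃ p ∈ Subgroup.normalizer (D : Set G), p * z * p⁻¹ = d := by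
  obtain ⟨S, -, hS⟩ := exists_S hG (k := 0) (⊥ : Subgroup G) (by simp)
  obtain ⟨S', hS', hne, hD⟩ := step3 hG S hS
  set D := S ⊓ S' with hDdef
  have hDS : D ≤ S := inf_le_left
  have hDS' : D ≤ S' := inf_le_right
  obtain ⟨z, hz, hZ⟩ := zpowers_eq (p := 37) _ (center_card hG S hS)
  obtain ⟨w, hw, hW⟩ := zpowers_eq (p := 37) _ (center_card hG S' hS')
  have hzZ : z ∈ S ⊓ Subgroup.centralizer (S : Set G) := hZ ▸ Subgroup.mem_zpowers z
  have hwW : w ∈ S' ⊓ Subgroup.centralizer (S' : Set G) := hW ▸ Subgroup.mem_zpowers w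
  have hzD : z ∈ D := center_le_D hG D S hS hD hDS hzZ
  have hwD : w ∈ D := center_le_D hG D S' hS' hD hDS' hwW
  have hzw : Commute z w := Subgroup.mem_centralizer_iff.1 (comm_of_card_sq D hD hwD) z hzD
  have hZW : Subgroup.zpowers z ≠ Subgroup.zpowers w := fun h =>
    hne (eq_of_center_eq hG D S S' hS hS' hD hDS hDS' (by rw [hZ, hW, h]))
  have hwz : w ∉ Subgroup.zpowers z := fun h => hZW (Subgroup.eq_of_le_of_card_ge (Subgroup.zpowers_le.2 h)
    (by rw [Nat.card_zpowers, Nat.card_zpowers, hz, hw])).symm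
  have hzw' : z ∉ Subgroup.zpowers w := fun h => hZW (Subgroup.eq_of_le_of_card_ge (Subgroup.zpowers_le.2 h)
    (by rw [Nat.card_zpowers, Nat.card_zpowers, hz, hw]))
  obtain ⟨s, hs, hsw⟩ := comm_surj hG S hS hz hZ (hDS hwD) hwz (Subgroup.mem_zpowers z)
  obtain ⟨t, ht, htz⟩ := comm_surj hG S' hS' hw hW (hDS' hzD) hzw' (Subgroup.mem_zpowers w)
  have hsz : Commute s z := Subgroup.mem_centralizer_iff.1 hzZ.2 s hs
  have htw : Commute t w := Subgroup.mem_centralizer_iff.1 hwW.2 t ht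
  have hsP : s ∈ Subgroup.normalizer (D : Set G) := normal_of_index D S hDS hD hS hs
  have htP : t ∈ Subgroup.normalizer (D : Set G) := normal_of_index D S' hDS' hD hS' ht
  have As := act_pow hsw hsz hzw
  have At := act_pow' htz htw hzw
  have key : ∀ a b : ℕ, (s ^ 2 * t ^ 18 * s ^ 1 * t ^ 1 * s ^ 36) * (z ^ a * w ^ b) * (s ^ 2 * t ^ 18 * s ^ 1 * t ^ 1 * s ^ 36)⁻¹
      = s ^ 2 * (t ^ 18 * (s ^ 1 * (t ^ 1 * (s ^ 36 * (z ^ a * w ^ b) * (s ^ 36)⁻¹) * (t ^ 1)⁻¹) * (s ^ 1)⁻¹) * (t ^ 18)⁻¹) * (s ^ 2)⁻¹ := by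
    intro a b
    simp only [mul_inv_rev, mul_assoc]
  refine ⟨S, D, z, w, s ^ 2 * t ^ 18 * s ^ 1 * t ^ 1 * s ^ 36, hS, hD, hDS, hz, hw, hZ, hzD, hwD, hwz, ?_, ?_, ?_, ?_⟩
  · have hm := fun n => Subgroup.pow_mem _ hsP n
    have hm' := fun n => Subgroup.pow_mem _ htP n
    exact mul_mem (mul_mem (mul_mem (mul_mem (hm _) (hm' _)) (hm _)) (hm' _)) (hm _)
  · have := key 1 0
    rw [As, At, As, At, As] at this
    rw [pow_one z, pow_zero, mul_one] at this
    rw [this, pow37_congr hz (show _ ≡ 2 [MOD 37] by decide), pow37_congr hw (show _ ≡ 0 [MOD 37] by decide), pow_zero, mul_one]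
  · have := key 0 1
    rw [As, At, As, At, As] at this
    rw [pow_one w, pow_zero, one_mul] at this
    rw [this, pow37_congr hz (show _ ≡ 0 [MOD 37] by decide), pow37_congr hw (show _ ≡ 19 [MOD 37] by decide), pow_zero, one_mul]
  · intro d hd hd1
    obtain ⟨a, b, rfl⟩ := exists_coords hD hz hw hzD hwD hwz hd
    by_cases hb : 37 ∣ b
    · have ha : ¬ 37 ∣ 37 + a := by
        intro ha
        apply hd1
        rw [pow37_congr hz (show a ≡ 0 [MOD 37] from Nat.modEq_zero_iff_dvd.2 (by omega)),
          pow37_congr hw (show b ≡ 0 [MOD 37] from Nat.modEq_zero_iff_dvd.2 hb)]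
        simp
      obtain ⟨j, hj⟩ := solve37 b (37 + a) ha
      refine ⟨t ^ j * s ^ (36 + a) * t ^ 1, mul_mem (mul_mem (Subgroup.pow_mem _ htP _) (Subgroup.pow_mem _ hsP _))
        (Subgroup.pow_mem _ htP _), ?_⟩
      have e : t ^ j * s ^ (36 + a) * t ^ 1 * (z ^ 1 * w ^ 0) * (t ^ j * s ^ (36 + a) * t ^ 1)⁻¹ =
        t ^ j * (s ^ (36 + a) * (t ^ 1 * (z ^ 1 * w ^ 0) * (t ^ 1)⁻¹) * (s ^ (36 + a))⁻¹) * (t ^ j)⁻¹ := by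
        simp only [mul_inv_rev, mul_assoc]
      rw [At, As, At, show 0 + 1 * 1 = 1 by norm_num, mul_one, show 1 + (36 + a) = 37 + a by ring, pow37_congr hw hj,
        pow37_congr hz (show 37 + a ≡ a [MOD 37] by simp [Nat.ModEq]), pow_one z, pow_zero, mul_one] at e
      exact e
    · obtain ⟨j, hj⟩ := solve37 a b hb
      refine ⟨s ^ j * t ^ b, mul_mem (Subgroup.pow_mem _ hsP _) (Subgroup.pow_mem _ htP _), ?_⟩
      have e : s ^ j * t ^ b * (z ^ 1 * w ^ 0) * (s ^ j * t ^ b)⁻¹ =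
        s ^ j * (t ^ b * (z ^ 1 * w ^ 0) * (t ^ b)⁻¹) * (s ^ j)⁻¹ := by
        simp only [mul_inv_rev, mul_assoc]
      rw [At, As, show 0 + b * 1 = b by ring, pow37_congr hz hj, pow_one z, pow_zero, mul_one] at e
      exact e

end local4
end OD


open scoped Pointwise

namespace OD

section local5
set_option linter.unusedSectionVars false
variable {G : Type*} [Group G] [Finite G]

attribute [local instance] conjAction

theorem card_conj_elem (H : Subgroup G) (z : G) :
    Nat.card H = Set.ncard {x | ∃ h ∈ H, h * z * h⁻¹ = x} *
      Nat.card (H ⊓ Subgroup.centralizer (Subgroup.zpowers z : Set G) : Subgroup G) := by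
  let A : MulAction H G :=
    { smul := fun h x => (h : G) * x * (h : G)⁻¹
      one_smul := fun x => by change ((1 : H) : G) * x * ((1 : H) : G)⁻¹ = x; simp
      mul_smul := fun a b x => by
        change ((a * b : H) : G) * x * ((a * b : H) : G)⁻¹ = (a : G) * ((b : G) * x * (b : G)⁻¹) * (a : G)⁻¹
        simp [mul_assoc] }
  have h := (MulAction.stabilizer H z).index_mul_card
  rw [MulAction.index_stabilizer] at h
  have h1 : MulAction.orbit H z = {x | ∃ h ∈ H, h * z * h⁻¹ = x} := by
    ext x
    constructor
    · rintro ⟨a, rfl⟩; exact ⟨a, a.2, rfl⟩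
    · rintro ⟨a, ha, rfl⟩; exact ⟨⟨a, ha⟩, rfl⟩
  have h2 : MulAction.stabilizer H z = (Subgroup.centralizer (Subgroup.zpowers z : Set G)).subgroupOf H := by
    ext x
    rw [MulAction.mem_stabilizer_iff, Subgroup.mem_subgroupOf, mem_cent_zpowers]
    change (x : G) * z * (x : G)⁻¹ = z ↔ _
    rw [mul_inv_eq_iff_eq_mul]
    exact ⟨fun h => h.symm, fun h => h.symm⟩
  rw [h1, h2, ← Subgroup.inf_subgroupOf_left, Nat.card_congr (Subgroup.subgroupOfEquivOfLe inf_le_left).toEquiv] at h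
  exact h.symm

theorem conj_iter {h z : G} {n : ℕ} (H : h * z * h⁻¹ = z ^ n) (i : ℕ) : h ^ i * z * (h ^ i)⁻¹ = z ^ (n ^ i) := by
  induction i with
  | zero => simp
  | succ i ih =>
    calc h ^ (i + 1) * z * (h ^ (i + 1))⁻¹ = h * (h ^ i * z * (h ^ i)⁻¹) * h⁻¹ := by rw [pow_succ']; group
      _ = (h * z * h⁻¹) ^ (n ^ i) := by rw [ih, conj_pow]
      _ = _ := by rw [H, ← pow_mul, pow_succ']

theorem order2_37 : orderOf (2 : ZMod 37) = 36 := by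
  rw [orderOf_eq_iff (by norm_num)]
  constructor
  · decide +kernel
  · have : ∀ m : Fin 36, 0 < m.1 → (2 : ZMod 37) ^ m.1 ≠ 1 := by decide +kernel
    intro m hm hm0
    exact this ⟨m, hm⟩ hm0

theorem arith5 {i j i' j' a ε γ γ' : ℕ} (hi : i < 36) (hi' : i' < 36) (hj : j < 12) (hj' : j' < 12)
    (ha : (a : ZMod 37) ≠ 0) (hε : (ε : ZMod 37) ≠ 0)
    (h1 : ((2 ^ i * a * 2 ^ j : ℕ) : ZMod 37) = ((2 ^ i' * a * 2 ^ j' : ℕ) : ZMod 37))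
    (h2 : (γ : ZMod 37) = γ')
    (h3 : ((γ * 19 ^ i : ℕ) : ZMod 37) = ((2 ^ i * (ε * 19 ^ j) : ℕ) : ZMod 37))
    (h4 : ((γ' * 19 ^ i' : ℕ) : ZMod 37) = ((2 ^ i' * (ε * 19 ^ j') : ℕ) : ZMod 37)) : i = i' ∧ j = j' := by
  push_cast at *
  have e19 : (19 : ZMod 37) = 2 ^ 35 := by decide +kernel
  have e36 : (2 : ZMod 37) ^ 36 = 1 := by decide +kernel
  have e1 : (2 : ZMod 37) ^ (i + j) = 2 ^ (i' + j') := by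
    apply mul_left_cancel₀ ha
    rw [pow_add, pow_add]; linear_combination h1
  have c1 : (19 : ZMod 37) ^ i * 2 ^ i = 1 := by
    rw [← mul_pow, show (19 : ZMod 37) * 2 = 1 by decide +kernel, one_pow]
  have c2 : (19 : ZMod 37) ^ i' * 2 ^ i' = 1 := by
    rw [← mul_pow, show (19 : ZMod 37) * 2 = 1 by decide +kernel, one_pow]
  have g1 : (γ : ZMod 37) = 2 ^ (i + i + 35 * j) * ε := by
    rw [pow_add, pow_add, pow_mul, ← e19]
    linear_combination 2 ^ i * h3 - γ * c1
  have g2 : (γ' : ZMod 37) = 2 ^ (i' + i' + 35 * j') * ε := by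
    rw [pow_add, pow_add, pow_mul, ← e19]
    linear_combination 2 ^ i' * h4 - γ' * c2
  have e2 : (2 : ZMod 37) ^ (i + i + 35 * j) = 2 ^ (i' + i' + 35 * j') := by
    apply mul_right_cancel₀ hε
    rw [← g1, ← g2, h2]
  have u : IsUnit (2 : ZMod 37) := by decide +kernel
  obtain ⟨u, hu⟩ := u
  have ou : orderOf u = 36 := by rw [← orderOf_units, hu, order2_37]
  rw [← hu] at e1 e2
  have f1 : u ^ (i + j) = u ^ (i' + j') := Units.ext (by push_cast; exact e1)
  have f2 : u ^ (i + i + 35 * j) = u ^ (i' + i' + 35 * j') := Units.ext (by push_cast; exact e2)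
  rw [pow_eq_pow_iff_modEq, ou] at f1 f2
  unfold Nat.ModEq at f1 f2
  clear * - f1 f2 hi hi' hj hj'
  have k1 : i % 12 = i' % 12 := by omega
  have k2 : j = j' := by clear f2; omega
  subst k2
  clear f2 k1
  omega

/-- compatibility data of an element with the pair `z, w`. -/
def QQ (z w x : G) (χ γ : ℕ) : Prop :=
  x * z * x⁻¹ = z ^ χ ∧ w * (x * w * x⁻¹) * w⁻¹ = z ^ γ * (x * w * x⁻¹)

theorem QQ_unique {z w x : G} (hz : orderOf z = 37) {χ γ χ' γ' : ℕ} (h : QQ z w x χ γ) (h' : QQ z w x χ' γ') :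
    (χ : ZMod 37) = χ' ∧ (γ : ZMod 37) = γ' := by
  have h1 : z ^ χ = z ^ χ' := h.1.symm.trans h'.1
  have h2 : z ^ γ = z ^ γ' := mul_right_cancel (h.2.symm.trans h'.2)
  rw [pow_eq_pow_iff_modEq, hz, ← ZMod.natCast_eq_natCast_iff] at h1 h2
  exact ⟨h1, h2⟩

theorem QQ_mul (hG : Hyp G) (S : Subgroup G) (hS : Nat.card S = 37 ^ 3) {z w x σ : G}
    (hZ : S ⊓ Subgroup.centralizer (S : Set G) = Subgroup.zpowers z) (hw : w ∈ S) (hσ : σ ∈ S)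
    (hx : x ∈ Subgroup.normalizer (S : Set G)) {χ γ : ℕ} (h : QQ z w x χ γ) : QQ z w (x * σ) χ γ := by
  have hzZ : z ∈ S ⊓ Subgroup.centralizer (S : Set G) := hZ ▸ Subgroup.mem_zpowers z
  have hσz : Commute σ z := Subgroup.mem_centralizer_iff.1 hzZ.2 σ hσ
  constructor
  · rw [← h.1, mul_assoc x σ z, hσz.eq]; group
  · have h1 := comm_mem hG S hS hσ hw
    set c := σ * w * σ⁻¹ * w⁻¹ with hc
    have h2 : x * c * x⁻¹ ∈ S ⊓ Subgroup.centralizer (S : Set G) := by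
      have h3 : x • (S ⊓ Subgroup.centralizer (S : Set G)) = S ⊓ Subgroup.centralizer (S : Set G) := by
        rw [conj_inf, conj_centralizer, (conj_eq_iff_mem_normalizer x S).2 hx]
      rw [← h3]; exact conj_mem_conj x c _ h1
    have h4 : x * σ * w * (x * σ)⁻¹ = (x * c * x⁻¹) * (x * w * x⁻¹) := by rw [hc]; group
    have h5 : Commute w (x * c * x⁻¹) := Subgroup.mem_centralizer_iff.1 h2.2 w hw
    have h6 : Commute (z ^ γ) (x * c * x⁻¹) := Subgroup.mem_centralizer_iff.1 h2.2 _ (S.pow_mem hzZ.1 γ)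
    rw [h4]
    calc w * (x * c * x⁻¹ * (x * w * x⁻¹)) * w⁻¹ = (w * (x * c * x⁻¹)) * (x * w * x⁻¹) * w⁻¹ := by group
      _ = (x * c * x⁻¹) * (w * (x * w * x⁻¹) * w⁻¹) := by rw [h5.eq]; group
      _ = (x * c * x⁻¹) * (z ^ γ) * (x * w * x⁻¹) := by rw [h.2]; group
      _ = _ := by rw [← h6.eq]; group

theorem QQ_f (hG : Hyp G) (S : Subgroup G) (hS : Nat.card S = 37 ^ 3) {z w g h : G} (hz : orderOf z = 37)
    (hZ : S ⊓ Subgroup.centralizer (S : Set G) = Subgroup.zpowers z) (hw : w ∈ S)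
    (hg : g ∈ Subgroup.normalizer (S : Set G)) (hh : h ∈ Subgroup.normalizer (S : Set G))
    (hhz : h * z * h⁻¹ = z ^ 2) (hhw : h * w * h⁻¹ = w ^ 19) {a ε : ℕ} (ha : g * z * g⁻¹ = z ^ a)
    (hε : w * (g * w * g⁻¹) * w⁻¹ = z ^ ε * (g * w * g⁻¹)) (i j : ℕ) :
    ∃ γ : ℕ, QQ z w (h ^ i * g * h ^ j) (2 ^ i * a * 2 ^ j) γ ∧
      ((γ * 19 ^ i : ℕ) : ZMod 37) = ((2 ^ i * (ε * 19 ^ j) : ℕ) : ZMod 37) := by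
  have hzZ : z ∈ S ⊓ Subgroup.centralizer (S : Set G) := hZ ▸ Subgroup.mem_zpowers z
  have hx : h ^ i * g * h ^ j ∈ Subgroup.normalizer (S : Set G) :=
    mul_mem (mul_mem (pow_mem hh i) hg) (pow_mem hh j)
  set E := h ^ i * g * h ^ j * w * (h ^ i * g * h ^ j)⁻¹ with hE
  have hES : E ∈ S := (Subgroup.mem_normalizer_iff.1 hx w).1 hw
  have h1 := comm_mem hG S hS hw hES
  rw [hZ, ← mem_powers_iff_mem_zpowers] at h1
  obtain ⟨γ, hγ⟩ := h1
  have hγ2 : w * E * w⁻¹ = z ^ γ * E := by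
    have : z ^ γ = w * E * w⁻¹ * E⁻¹ := hγ
    rw [this]; group
  set e := g * w * g⁻¹ with he
  have heS : e ∈ S := (Subgroup.mem_normalizer_iff.1 hg w).1 hw
  have hzc : ∀ y ∈ S, Commute y z := fun y hy => Subgroup.mem_centralizer_iff.1 hzZ.2 y hy
  have hE2 : E = h ^ i * e ^ (19 ^ j) * (h ^ i)⁻¹ := by
    have : E = h ^ i * (g * (h ^ j * w * (h ^ j)⁻¹) * g⁻¹) * (h ^ i)⁻¹ := by rw [hE]; group
    rw [this, conj_iter hhw, ← conj_pow]
  refine ⟨γ, ⟨?_, hγ2⟩, ?_⟩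
  · have : h ^ i * g * h ^ j * z * (h ^ i * g * h ^ j)⁻¹ = h ^ i * (g * (h ^ j * z * (h ^ j)⁻¹) * g⁻¹) * (h ^ i)⁻¹ := by group
    rw [this, conj_iter hhz, ← conj_pow, ha, ← conj_pow, ← conj_pow, conj_iter hhz, ← pow_mul, ← pow_mul, mul_assoc]
  · have h2 : w * e ^ (19 ^ j) * w⁻¹ = z ^ (ε * 19 ^ j) * e ^ (19 ^ j) := by
      rw [← conj_pow, hε, ((hzc e heS).symm.pow_left ε).mul_pow, ← pow_mul]
    have h3 : w ^ (19 ^ i) * E * (w ^ (19 ^ i))⁻¹ = z ^ (2 ^ i * (ε * 19 ^ j)) * E := by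
      clear_value e
      rw [pow_mul, ← conj_iter hhz, ← conj_iter hhw, hE2, conj_pow]
      calc _ = h ^ i * (w * e ^ (19 ^ j) * w⁻¹) * (h ^ i)⁻¹ := by group
        _ = _ := by rw [h2]; group
    have h4 := conj_pow_comm hγ2 ((hzc w hw).pow_right γ) (19 ^ i)
    rw [h3, ← pow_mul] at h4
    have h5 := mul_right_cancel h4
    rw [pow_eq_pow_iff_modEq, hz, ← ZMod.natCast_eq_natCast_iff] at h5
    exact h5.symm

theorem norm_S (hG : Hyp G) (S D : Subgroup G) (hS : Nat.card S = 37 ^ 3) (hD : Nat.card D = 37 ^ 2) (hDS : D ≤ S)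
    {z p : G} (hz : orderOf z = 37) (hZ : S ⊓ Subgroup.centralizer (S : Set G) = Subgroup.zpowers z)
    (hp : p ∈ Subgroup.normalizer (D : Set G)) (hpz : p * z * p⁻¹ ∈ Subgroup.zpowers z) :
    p ∈ Subgroup.normalizer (S : Set G) := by
  rw [← conj_eq_iff_mem_normalizer] at hp ⊢
  refine eq_of_center_eq hG D (p • S) S ((conj_card p S).trans hS) hS hD (hp ▸ conj_mono p hDS) hDS ?_
  rw [← conj_centralizer, ← conj_inf, hZ]
  refine Subgroup.eq_of_le_of_card_ge ?_ (conj_card _ _).ge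
  intro x hx
  rw [conj_mem_iff, ← mem_powers_iff_mem_zpowers] at hx
  obtain ⟨k, hk⟩ := hx
  have hk' : z ^ k = p⁻¹ * x * p := hk
  have : x = (p * z * p⁻¹) ^ k := by rw [conj_pow, hk']; group
  rw [this]; exact pow_mem hpz k

theorem step5a (hG : Hyp G) (S D : Subgroup G) (hS : Nat.card S = 37 ^ 3) (hD : Nat.card D = 37 ^ 2) (hDS : D ≤ S)
    {z w h : G} (hz : orderOf z = 37) (hZ : S ⊓ Subgroup.centralizer (S : Set G) = Subgroup.zpowers z)
    (hzD : z ∈ D) (hwD : w ∈ D) (hwz : w ∉ Subgroup.zpowers z)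
    (hh : h ∈ Subgroup.normalizer (S : Set G))
    (hhz : h * z * h⁻¹ = z ^ 2) (hhw : h * w * h⁻¹ = w ^ 19) :
    Subgroup.normalizer (S : Set G) ≤ Subgroup.normalizer (D : Set G) := by
  intro g hg
  by_contra hgD
  have hzZ : z ∈ S ⊓ Subgroup.centralizer (S : Set G) := hZ ▸ Subgroup.mem_zpowers z
  have hw : w ∈ S := hDS hwD
  have hgz : g * z * g⁻¹ ∈ Subgroup.zpowers z := by
    have h3 : g • (S ⊓ Subgroup.centralizer (S : Set G)) = S ⊓ Subgroup.centralizer (S : Set G) := by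
      rw [conj_inf, conj_centralizer, (conj_eq_iff_mem_normalizer g S).2 hg]
    rw [← hZ, ← h3]; exact conj_mem_conj g z _ hzZ
  have heS : g * w * g⁻¹ ∈ S := (Subgroup.mem_normalizer_iff.1 hg w).1 hw
  obtain ⟨a, ha⟩ := mem_powers_iff_mem_zpowers.2 hgz
  replace ha : g * z * g⁻¹ = z ^ a := ha.symm
  have h1 := comm_mem hG S hS hw heS
  rw [hZ, ← mem_powers_iff_mem_zpowers] at h1
  obtain ⟨ε, hε⟩ := h1
  replace hε : w * (g * w * g⁻¹) * w⁻¹ = z ^ ε * (g * w * g⁻¹) := by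
    have : z ^ ε = w * (g * w * g⁻¹) * w⁻¹ * (g * w * g⁻¹)⁻¹ := hε
    rw [this]; group
  have ha0 : (a : ZMod 37) ≠ 0 := by
    rw [Ne, ZMod.natCast_eq_zero_iff]
    intro h0
    rw [pow37_congr hz (Nat.modEq_zero_iff_dvd.2 h0), pow_zero, conj_eq_one_iff] at ha
    rw [ha, orderOf_one] at hz
    norm_num at hz
  have hε0 : (ε : ZMod 37) ≠ 0 := by
    rw [Ne, ZMod.natCast_eq_zero_iff]
    intro h0
    rw [pow37_congr hz (Nat.modEq_zero_iff_dvd.2 h0), pow_zero, one_mul, mul_inv_eq_iff_eq_mul] at hε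
    apply hgD
    have heD : g * w * g⁻¹ ∈ D := by
      rw [← cent_D hG D S hS hD hDS]
      refine ⟨heS, ?_⟩
      change g * w * g⁻¹ ∈ Subgroup.centralizer (D : Set G)
      rw [← D_gen hD hz hzD hwD hwz, Subgroup.centralizer_closure, Subgroup.mem_centralizer_iff]
      rintro x (rfl | rfl)
      · exact (Subgroup.mem_centralizer_iff.1 hzZ.2 _ heS).symm
      · exact hε
    have hle : g • D ≤ D := by
      intro x hx
      rw [conj_mem_iff, ← D_gen hD hz hzD hwD hwz] at hx
      have : x ∈ (Subgroup.closure {z, w}).map (MulAut.conj g).toMonoidHom :=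
        ⟨_, hx, by simp [mul_assoc]⟩
      rw [MonoidHom.map_closure] at this
      refine (Subgroup.closure_le D).2 ?_ this
      rintro _ ⟨y, (rfl | rfl), rfl⟩
      · exact (Subgroup.zpowers_le.2 hzD) hgz
      · exact heD
    rw [← conj_eq_iff_mem_normalizer]
    exact Subgroup.eq_of_le_of_card_ge hle (conj_card _ _).ge
  let N := Subgroup.normalizer (S : Set G)
  have hf : ∀ i j : ℕ, h ^ i * g * h ^ j ∈ N := fun i j => mul_mem (mul_mem (pow_mem hh i) hg) (pow_mem hh j)
  have hq : Nat.card (N ⧸ S.subgroupOf N) = 432 := by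
    have := Subgroup.card_eq_card_quotient_mul_card_subgroup (S.subgroupOf N)
    rw [Nat.card_congr (Subgroup.subgroupOfEquivOfLe (show S ≤ N from Subgroup.le_normalizer)).toEquiv, hS, step2 hG S hS] at this
    clear * - this
    omega
  let F : Option (Fin 36 × Fin 12) → N ⧸ S.subgroupOf N := fun o => match o with
    | none => QuotientGroup.mk 1
    | some ij => QuotientGroup.mk ⟨h ^ ij.1.1 * g * h ^ ij.2.1, hf _ _⟩
  have hQ := QQ_f hG S hS hz hZ hw hg hh hhz hhw ha hε
  have hQ1 : QQ z w 1 1 0 := by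
    constructor <;> simp
  have key : ∀ (i j : ℕ) (x : N), (QuotientGroup.mk ⟨h ^ i * g * h ^ j, hf _ _⟩ : N ⧸ S.subgroupOf N) = QuotientGroup.mk x →
      ∃ γ : ℕ, QQ z w (x : G) (2 ^ i * a * 2 ^ j) γ ∧
      ((γ * 19 ^ i : ℕ) : ZMod 37) = ((2 ^ i * (ε * 19 ^ j) : ℕ) : ZMod 37) := by
    intro i j x hx
    rw [QuotientGroup.eq, Subgroup.mem_subgroupOf] at hx
    obtain ⟨γ, h2, h3⟩ := hQ i j
    refine ⟨γ, ?_, h3⟩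
    have := QQ_mul hG S hS hZ hw hx (hf i j) h2
    change QQ z w (h ^ i * g * h ^ j * ((h ^ i * g * h ^ j)⁻¹ * (x : G))) _ _ at this
    rwa [mul_inv_cancel_left] at this
  have key0 : ∀ (i j : ℕ), (QuotientGroup.mk ⟨h ^ i * g * h ^ j, hf _ _⟩ : N ⧸ S.subgroupOf N) ≠ QuotientGroup.mk 1 := by
    intro i j hx
    obtain ⟨γ, h2, h3⟩ := key i j 1 hx
    have h4 := (QQ_unique hz h2 hQ1).2
    push_cast at h3 h4
    rw [h4, zero_mul] at h3
    have h5 : (2 : ZMod 37) ≠ 0 := by decide +kernel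
    have h6 : (19 : ZMod 37) ≠ 0 := by decide +kernel
    exact mul_ne_zero (pow_ne_zero i h5) (mul_ne_zero hε0 (pow_ne_zero j h6)) h3.symm
  have hF : Function.Injective F := by
    rintro (_ | ⟨⟨i, hi⟩, ⟨j, hj⟩⟩) (_ | ⟨⟨i', hi'⟩, ⟨j', hj'⟩⟩) h0
    · rfl
    · exact absurd h0.symm (key0 i' j')
    · exact absurd h0 (key0 i j)
    · obtain ⟨γ, h2, h3⟩ := key i j _ h0
      obtain ⟨γ', h2', h3'⟩ := hQ i' j'
      obtain ⟨h4, h5⟩ := QQ_unique hz h2 h2'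
      obtain ⟨rfl, rfl⟩ := arith5 hi hi' hj hj' ha0 hε0 h4 h5 h3 h3'
      rfl
  have := Nat.card_le_card_of_injective F hF
  rw [hq] at this
  simp at this

theorem step5 (hG : Hyp G) : ∃ D : Subgroup G, Nat.card D = 37 ^ 2 ∧
    Nat.card (Subgroup.normalizer (D : Set G)) = 38 * (37 ^ 3 * 432) ∧
    (∀ d ∈ D, d ≠ 1 → ∀ e ∈ D, e ≠ 1 → ∃ p ∈ Subgroup.normalizer (D : Set G), p * d * p⁻¹ = e) ∧
    (∀ d ∈ D, d ^ 37 = 1) ∧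
    (∀ g : G, D ≤ Subgroup.normalizer ((g • D : Subgroup G) : Set G) → g • D = D) := by
  obtain ⟨S, D, z, w, h, hS, hD, hDS, hz, hw, hZ, hzD, hwD, hwz, hh, hhz, hhw, htr⟩ := config hG
  have hhS : h ∈ Subgroup.normalizer (S : Set G) :=
    norm_S hG S D hS hD hDS hz hZ hh (hhz ▸ pow_mem (Subgroup.mem_zpowers z) 2)
  have h5 := step5a hG S D hS hD hDS hz hZ hzD hwD hwz hhS hhz hhw
  have hz1 : z ≠ 1 := by rintro rfl; rw [orderOf_one] at hz; norm_num at hz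
  have hSP : S ≤ Subgroup.normalizer (D : Set G) := normal_of_index D S hDS hD hS
  have hcard : Nat.card (Subgroup.normalizer (D : Set G)) = 38 * (37 ^ 3 * 432) := by
    have h1 := card_conj_elem (Subgroup.normalizer (D : Set G)) z
    have h2 := card_conj_elem (Subgroup.normalizer (S : Set G)) z
    have h3 : {x | ∃ h ∈ Subgroup.normalizer (D : Set G), h * z * h⁻¹ = x} = (D : Set G) \ {1} := by
      ext x
      constructor
      · rintro ⟨p, hp, rfl⟩
        exact ⟨(Subgroup.mem_normalizer_iff.1 hp z).1 hzD, by simpa using hz1⟩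
      · rintro ⟨hx, hx1⟩
        exact htr x hx hx1
    have h4 : {x | ∃ h ∈ Subgroup.normalizer (S : Set G), h * z * h⁻¹ = x} = (Subgroup.zpowers z : Set G) \ {1} := by
      ext x
      constructor
      · rintro ⟨p, hp, rfl⟩
        have h3 : p • (S ⊓ Subgroup.centralizer (S : Set G)) = S ⊓ Subgroup.centralizer (S : Set G) := by
          rw [conj_inf, conj_centralizer, (conj_eq_iff_mem_normalizer p S).2 hp]
        rw [hZ] at h3
        refine ⟨?_, by simpa using hz1⟩
        change p * z * p⁻¹ ∈ Subgroup.zpowers z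
        rw [← h3]; exact conj_mem_conj p z _ (Subgroup.mem_zpowers z)
      · rintro ⟨hx, hx1⟩
        obtain ⟨p, hp, hpz⟩ := htr x (Subgroup.zpowers_le.2 hzD hx) hx1
        exact ⟨p, norm_S hG S D hS hD hDS hz hZ hp (hpz ▸ hx), hpz⟩
    have h6 : Subgroup.normalizer (D : Set G) ⊓ Subgroup.centralizer (Subgroup.zpowers z : Set G) =
        Subgroup.normalizer (S : Set G) ⊓ Subgroup.centralizer (Subgroup.zpowers z : Set G) := by
      apply le_antisymm _ (inf_le_inf_right _ h5)
      intro p hp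
      refine ⟨norm_S hG S D hS hD hDS hz hZ hp.1 ?_, hp.2⟩
      have := (mem_cent_zpowers z p).1 hp.2
      rw [← this.eq, mul_inv_cancel_right]; exact Subgroup.mem_zpowers z
    rw [h3, h6, Set.ncard_sdiff_singleton_of_mem (show (1 : G) ∈ (D : Set G) from D.one_mem), ← Nat.card_coe_set_eq] at h1
    rw [h4, Set.ncard_sdiff_singleton_of_mem (show (1 : G) ∈ (Subgroup.zpowers z : Set G) from Subgroup.one_mem _),
      ← Nat.card_coe_set_eq, step2 hG S hS] at h2
    have e1 : Nat.card ((D : Set G) : Type _) = 37 ^ 2 := hD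
    have e2 : Nat.card ((Subgroup.zpowers z : Set G) : Type _) = 37 := by
      rw [← hz]; exact Nat.card_zpowers z
    rw [e1] at h1
    rw [e2] at h2
    clear * - h1 h2
    omega
  refine ⟨D, hD, hcard, ?_, ?_, ?_⟩
  · intro d hd hd1 e he he1
    obtain ⟨p, hp, hpz⟩ := htr d hd hd1
    obtain ⟨q, hq, hqz⟩ := htr e he he1
    refine ⟨q * p⁻¹, mul_mem hq (inv_mem hp), ?_⟩
    rw [← hpz, ← hqz]; group
  · intro d hd
    by_cases hd1 : d = 1
    · rw [hd1, one_pow]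
    obtain ⟨p, hp, hpz⟩ := htr d hd hd1
    rw [← hpz, conj_pow, ← hz, pow_orderOf_eq_one]; simp
  · intro g hg
    have hgP : Nat.card (Subgroup.normalizer ((g • D : Subgroup G) : Set G)) = 37 ^ 3 * (38 * 432) := by
      rw [← conj_normalizer, conj_card, hcard]; norm_num
    have hP : Nat.card (Subgroup.normalizer (D : Set G)) = 37 ^ 3 * (38 * 432) := by
      rw [hcard]; norm_num
    obtain ⟨T, hDT, hTN, hTc⟩ := exists_succ (p := 37) (n := 2) D _ hg hD (by rw [hgP]; exact dvd_mul_right _ _)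
    obtain ⟨x, hx, hxT⟩ := sylow_conj (p := 37) _ (g • S) T (by rw [← conj_normalizer]; exact conj_mono g hSP) hTN
      ((conj_card _ _).trans hS) hTc hgP (by norm_num)
    obtain ⟨y, hy, hyT⟩ := sylow_conj (p := 37) _ S T hSP (normal_of_index D T hDT hD hTc) hS hTc hP (by norm_num)
    rw [← conj_eq_iff_mem_normalizer] at hx hy
    have h7 : y⁻¹ * x * g ∈ Subgroup.normalizer (S : Set G) := by
      rw [← conj_eq_iff_mem_normalizer, mul_smul, mul_smul, hxT, ← hyT, inv_smul_smul]
    have h8 := (conj_eq_iff_mem_normalizer _ _).2 (h5 h7)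
    rw [mul_smul, mul_smul, hx, inv_smul_eq_iff, hy] at h8
    exact h8

end local5
end OD


namespace OD

section plane1
set_option linter.unusedSectionVars false

/-- The geometric situation: points with their groups of dilations. -/
structure Geom (G X : Type*) [Group G] [MulAction G X] (D : X → Subgroup G) : Prop where
  cardX : Nat.card X = 1407
  cardD : ∀ x, Nat.card (D x) = 37 ^ 2
  conj : ∀ (g : G) (x : X) (d : G), d ∈ D (g • x) ↔ g⁻¹ * d * g ∈ D x
  fixD : ∀ x, ∀ d ∈ D x, d • x = x
  fixD' : ∀ x y, (∀ d ∈ D x, d • y = y) → y = x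
  trans : ∀ x y : X, ∃ g : G, g • x = y
  conjD : ∀ x, ∀ d ∈ D x, d ≠ 1 → ∀ e ∈ D x, e ≠ 1 → ∃ p : G, p • x = x ∧ p * d * p⁻¹ = e
  exp : ∀ x, ∀ d ∈ D x, d ^ 37 = 1
  comm : ∀ x, ∀ d ∈ D x, ∀ e ∈ D x, d * e = e * d
  c19 : ∀ u : G, orderOf u = 37 → ¬ 19 ∣ Nat.card (Subgroup.centralizer (Subgroup.zpowers u : Set G))

variable {G X : Type*} [Group G] [Finite G] [MulAction G X] [Finite X] {D : X → Subgroup G}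

theorem burnside_dvd (H : Subgroup G) (F : ℕ)
    (hF : ∀ h ∈ H, h ≠ 1 → Set.ncard {y : X | h • y = y} = F) :
    Nat.card H ∣ Nat.card X + (Nat.card H - 1) * F := by
  classical
  have := Fintype.ofFinite H
  have := Fintype.ofFinite X
  have h := MulAction.sum_card_fixedBy_eq_card_orbits_mul_card_group H X
  have key : ∑ a : H, Fintype.card (MulAction.fixedBy X a) = Nat.card X + (Nat.card H - 1) * F := by
    rw [← Finset.add_sum_erase _ _ (Finset.mem_univ (1 : H))]
    congr 1
    · rw [Nat.card_eq_fintype_card]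
      exact Fintype.card_congr (Equiv.subtypeUnivEquiv fun y => one_smul H y)
    · rw [Finset.sum_congr rfl (g := fun _ => F)]
      · rw [Finset.sum_const, Finset.card_erase_of_mem (Finset.mem_univ _), Finset.card_univ, smul_eq_mul,
          Nat.card_eq_fintype_card]
      · intro a ha
        rw [← hF a a.2 (fun h => (Finset.mem_erase.1 ha).1 (Subtype.ext h)), ← Nat.card_eq_fintype_card]
        rfl
  rw [← key, h, Nat.card_eq_fintype_card (α := H)]
  exact Dvd.intro_left _ rfl

theorem ncard_fix_conj (p d : G) : Set.ncard {y : X | (p * d * p⁻¹) • y = y} = Set.ncard {y : X | d • y = y} := by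
  have : {y : X | (p * d * p⁻¹) • y = y} = (fun y => p • y) '' {y : X | d • y = y} := by
    ext y
    simp only [Set.mem_ofPred_eq, Set.mem_image]
    constructor
    · intro h
      refine ⟨p⁻¹ • y, ?_, smul_inv_smul _ _⟩
      rw [eq_inv_smul_iff, ← mul_smul, ← mul_smul, h]
    · rintro ⟨z, hz, rfl⟩
      rw [← mul_smul, inv_mul_cancel_right, mul_smul, hz]
  rw [this, Set.ncard_image_of_injective _ (MulAction.injective p)]

theorem Geom.fix38 (hX : Geom G X D) (x : X) (d : G) (hd : d ∈ D x) (hd1 : d ≠ 1) :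
    Set.ncard {y : X | d • y = y} = 38 := by
  set F := Set.ncard {y : X | d • y = y} with hFd
  have hF : ∀ h ∈ D x, h ≠ 1 → Set.ncard {y : X | h • y = y} = F := by
    intro h hh hh1
    obtain ⟨p, -, hp⟩ := hX.conjD x d hd hd1 h hh hh1
    rw [← hp, ncard_fix_conj]
  have h1 := burnside_dvd (X := X) (D x) F hF
  rw [hX.cardX, hX.cardD] at h1
  have h2 : F ≤ 1407 := by
    rw [← hX.cardX, ← Set.ncard_univ]
    exact Set.ncard_le_ncard (Set.subset_univ _)
  have h3 : F ≠ 1407 := by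
    intro h
    have h4 : ∀ y : X, ∀ e ∈ D x, e • y = y := by
      intro y e he
      by_cases he1 : e = 1
      · rw [he1, one_smul]
      · have h5 := hF e he he1
        rw [h, ← hX.cardX, ← Set.ncard_univ] at h5
        have h6 := Set.eq_of_subset_of_ncard_le (Set.subset_univ _) h5.ge
        have : y ∈ {y : X | e • y = y} := by rw [h6]; trivial
        exact this
    have h5 : ∀ y, y = x := fun y => hX.fixD' x y (h4 y)
    have : Subsingleton X := ⟨fun a b => (h5 a).trans (h5 b).symm⟩
    have := hX.cardX
    rw [Nat.card_of_subsingleton x] at this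
    omega
  clear * - h1 h2 h3
  clear_value F
  norm_num at h1
  omega

/-- the translations with centre `x` fixing `y` -/
def LL (D : X → Subgroup G) (x y : X) : Subgroup G := D x ⊓ MulAction.stabilizer G y

theorem mem_LL {x y : X} {g : G} : g ∈ LL D x y ↔ g ∈ D x ∧ g • y = y := by
  unfold LL
  rw [Subgroup.mem_inf, MulAction.mem_stabilizer_iff]

theorem Geom.LL_le (hX : Geom G X D) {x y : X} (h : y ≠ x) : Nat.card (LL D x y) ≤ 37 := by
  have h1 : Nat.card (LL D x y) ∣ 37 ^ 2 := by
    rw [← hX.cardD x]; exact Subgroup.card_dvd_of_le inf_le_left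
  obtain ⟨k, hk, hk2⟩ := (Nat.dvd_prime_pow (by norm_num)).1 h1
  have h2 : k ≠ 2 := by
    rintro rfl
    have h3 : LL D x y = D x := Subgroup.eq_of_le_of_card_ge inf_le_left (by rw [hk2, hX.cardD])
    exact h (hX.fixD' x y fun d hd => by
      rw [← h3] at hd; exact (mem_LL.1 hd).2)
  rw [hk2]
  interval_cases k <;> simp_all

theorem Geom.LL_card (hX : Geom G X D) {x y : X} (h : y ≠ x) : Nat.card (LL D x y) = 37 := by
  classical
  have := Fintype.ofFinite G
  have := Fintype.ofFinite X
  have hL : ∀ z, Nat.card (LL D x z) =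
      ((Finset.univ.filter (fun g => g ∈ D x)).filter (fun g => g • z = z)).card := by
    intro z
    rw [Nat.card_eq_fintype_card, Fintype.card_subtype]
    congr 1
    ext g
    simp [mem_LL]
  have hF : ∀ g : G, Set.ncard {z : X | g • z = z} = (Finset.univ.filter (fun z : X => g • z = z)).card := by
    intro g
    rw [Set.ncard_eq_toFinset_card']
    congr 1
    ext z; simp
  have hDc : (Finset.univ.filter (fun g => g ∈ D x)).card = 37 ^ 2 := by
    rw [← hX.cardD x, Nat.card_eq_fintype_card, Fintype.card_subtype]
  have hXc : (Finset.univ : Finset X).card = 1407 := by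
    rw [← hX.cardX, Nat.card_eq_fintype_card, Finset.card_univ]
  have hsum : ∑ z : X, Nat.card (LL D x z) = 1407 + 1368 * 38 := by
    have h1 := Finset.sum_card_bipartiteAbove_eq_sum_card_bipartiteBelow
      (s := Finset.univ.filter (fun g => g ∈ D x)) (t := (Finset.univ : Finset X)) (fun g z => g • z = z)
    have h2 : ∑ z : X, Nat.card (LL D x z) = ∑ g ∈ Finset.univ.filter (fun g => g ∈ D x),
        (Finset.univ.filter (fun z : X => g • z = z)).card := by
      rw [Finset.sum_congr rfl fun z _ => hL z]
      exact h1.symm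
    rw [h2, ← Finset.add_sum_erase _ _ (show (1 : G) ∈ Finset.univ.filter (fun g => g ∈ D x) by simp)]
    congr 1
    · simp [← hXc]
    · rw [Finset.sum_congr rfl (g := fun _ => 38)]
      · rw [Finset.sum_const, Finset.card_erase_of_mem (by simp), hDc]; norm_num
      · intro g hg
        rw [Finset.mem_erase, Finset.mem_filter] at hg
        rw [← hF, hX.fix38 x g hg.2.2 hg.1]
  rw [← Finset.add_sum_erase _ _ (Finset.mem_univ x)] at hsum
  have hx : LL D x x = D x := by
    ext g; rw [mem_LL]; exact ⟨fun h => h.1, fun h => ⟨h, hX.fixD x g h⟩⟩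
  rw [hx, hX.cardD] at hsum
  have hs2 : ∑ z ∈ Finset.univ.erase x, Nat.card (LL D x z) = ∑ z ∈ Finset.univ.erase x, 37 := by
    rw [Finset.sum_const, Finset.card_erase_of_mem (Finset.mem_univ _), hXc]
    simp only [smul_eq_mul]
    omega
  exact (Finset.sum_eq_sum_iff_of_le (fun z hz => hX.LL_le (Finset.mem_erase.1 hz).1)).1 hs2 y
    (Finset.mem_erase.2 ⟨h, Finset.mem_univ _⟩)

end plane1
end OD


namespace OD

section plane2
set_option linter.unusedSectionVars false

variable {G X : Type*} [Group G] [Finite G] [MulAction G X] [Finite X] {D : X → Subgroup G}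

/-- the line through two points -/
def line (D : X → Subgroup G) (x y : X) : Set X := {p | ∀ g ∈ LL D x y, g • p = p}

theorem mem_line {x y p : X} : p ∈ line D x y ↔ ∀ g ∈ LL D x y, g • p = p := Iff.rfl

theorem line_right (x y : X) : y ∈ line D x y := fun _ hg => (mem_LL.1 hg).2

theorem Geom.line_left (hX : Geom G X D) (x y : X) : x ∈ line D x y :=
  fun g hg => hX.fixD x g (mem_LL.1 hg).1

/-- a generator -/
theorem Geom.exists_gen (hX : Geom G X D) {x y : X} (h : y ≠ x) :
    ∃ u, orderOf u = 37 ∧ LL D x y = Subgroup.zpowers u :=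
  zpowers_eq (p := 37) _ (hX.LL_card h)

theorem Geom.gen_of_ne (hX : Geom G X D) {x y : X} (h : y ≠ x) {g : G} (hg : g ∈ LL D x y) (hg1 : g ≠ 1) :
    LL D x y = Subgroup.zpowers g := by
  have h1 : orderOf g = 37 := by
    have h2 := Subgroup.orderOf_dvd_natCard (LL D x y) hg
    rw [hX.LL_card h] at h2
    rcases (Nat.dvd_prime (by norm_num)).1 h2 with h3 | h3
    · exact absurd (orderOf_eq_one_iff.1 h3) hg1
    · exact h3
  refine (Subgroup.eq_of_le_of_card_ge ?_ ?_).symm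
  · rwa [Subgroup.zpowers_le]
  · rw [Nat.card_zpowers, h1, hX.LL_card h]

theorem fix_zpowers {g z : G} (hz : z ∈ Subgroup.zpowers g) {p : X} (h : g • p = p) : z • p = p := by
  have h1 : Subgroup.zpowers g ≤ MulAction.stabilizer G p := by
    rw [Subgroup.zpowers_le]; exact h
  exact h1 hz

theorem Geom.line_eq_fix (hX : Geom G X D) {x y : X} (h : y ≠ x) {g : G} (hg : g ∈ LL D x y) (hg1 : g ≠ 1) :
    line D x y = {p | g • p = p} := by
  ext p
  rw [mem_line, Set.mem_ofPred_eq]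
  constructor
  · exact fun h => h g hg
  · intro hp z hz
    rw [hX.gen_of_ne h hg hg1] at hz
    exact fix_zpowers hz hp

theorem Geom.exists_ne (hX : Geom G X D) {x y : X} (h : y ≠ x) : ∃ g ∈ LL D x y, g ≠ 1 := by
  obtain ⟨u, hu, hL⟩ := hX.exists_gen h
  refine ⟨u, by rw [hL]; exact Subgroup.mem_zpowers u, ?_⟩
  rintro rfl
  rw [orderOf_one] at hu; omega

theorem Geom.line_card (hX : Geom G X D) {x y : X} (h : y ≠ x) : (line D x y).ncard = 38 := by
  obtain ⟨g, hg, hg1⟩ := hX.exists_ne h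
  rw [hX.line_eq_fix h hg hg1, hX.fix38 x g (mem_LL.1 hg).1 hg1]

theorem Geom.LL_eq (hX : Geom G X D) {x y p : X} (h : y ≠ x) (hp : p ∈ line D x y) (hpx : p ≠ x) :
    LL D x p = LL D x y := by
  symm
  apply Subgroup.eq_of_le_of_card_ge
  · intro g hg
    exact mem_LL.2 ⟨(mem_LL.1 hg).1, hp g hg⟩
  · rw [hX.LL_card h, hX.LL_card hpx]

theorem Geom.line_eq (hX : Geom G X D) {x y p : X} (h : y ≠ x) (hp : p ∈ line D x y) (hpx : p ≠ x) :
    line D x p = line D x y := by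
  unfold line; rw [hX.LL_eq h hp hpx]

theorem Geom.D_line (hX : Geom G X D) {x y p : X} (hp : p ∈ line D x y) {d : G} (hd : d ∈ D x) :
    d • p ∈ line D x y := by
  intro g hg
  rw [← mul_smul, hX.comm x g (mem_LL.1 hg).1 d hd, mul_smul, hp g hg]

theorem card_orbit_sub (H : Subgroup G) (p : X) :
    Nat.card H = Set.ncard {q | ∃ g ∈ H, g • p = q} * Nat.card (H ⊓ MulAction.stabilizer G p : Subgroup G) := by
  have h := (MulAction.stabilizer H p).index_mul_card
  rw [MulAction.index_stabilizer] at h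
  have h1 : {q | ∃ g ∈ H, g • p = q} = MulAction.orbit H p := by
    ext q
    constructor
    · rintro ⟨g, hg, rfl⟩
      exact ⟨⟨g, hg⟩, rfl⟩
    · rintro ⟨g, rfl⟩
      exact ⟨g, g.2, rfl⟩
  have h2 : Nat.card (H ⊓ MulAction.stabilizer G p : Subgroup G) = Nat.card (MulAction.stabilizer H p) := by
    apply Nat.card_congr
    exact
      { toFun := fun g => ⟨⟨g, g.2.1⟩, g.2.2⟩
        invFun := fun g => ⟨g, g.1.2, g.2⟩
        left_inv := fun g => rfl
        right_inv := fun g => rfl }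
  rw [h1, h2, h]

theorem Geom.D_trans (hX : Geom G X D) {x y p : X} (h : y ≠ x) (hp : p ∈ line D x y) (hpx : p ≠ x) :
    ∃ d ∈ D x, d • y = p := by
  have h1 := card_orbit_sub (D x) y
  change _ = _ * Nat.card (LL D x y) at h1
  rw [hX.cardD, hX.LL_card h] at h1
  have h2 : {q | ∃ g ∈ D x, g • y = q} = line D x y \ {x} := by
    refine Set.eq_of_subset_of_ncard_le ?_ ?_ (Set.toFinite _)
    · rintro _ ⟨d, hd, rfl⟩
      refine ⟨hX.D_line (line_right x y) hd, ?_⟩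
      intro h3
      apply h
      rw [Set.mem_singleton_iff] at h3
      have := hX.fixD x d⁻¹ (inv_mem hd)
      rw [← h3, inv_smul_smul] at this
      rw [this, h3]
    · rw [Set.ncard_sdiff_singleton_of_mem (hX.line_left x y), hX.line_card h]
      omega
  have : p ∈ line D x y \ {x} := ⟨hp, hpx⟩
  rw [← h2] at this
  exact this

theorem exists_third {S : Set X} {n : ℕ} (hS : S.ncard = n) (hn : 2 < n) (x y : X) : ∃ z ∈ S, z ≠ x ∧ z ≠ y := by
  by_contra hc
  push Not at hc
  have h1 : S ⊆ {x, y} := by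
    intro z hz
    by_cases hzx : z = x
    · exact Or.inl hzx
    · exact Or.inr (hc z hz hzx)
  have h2 := Set.ncard_le_ncard h1
  have h3 : ({x, y} : Set X).ncard ≤ 2 := (Set.ncard_insert_le x {y}).trans (by rw [Set.ncard_singleton])
  omega

theorem Geom.LL_ne (hX : Geom G X D) {x y : X} (h : y ≠ x) : LL D x y ≠ LL D y x := by
  intro hL
  have hline : line D x y = line D y x := by unfold line; rw [hL]
  obtain ⟨u, hu, hLu⟩ := hX.exists_gen h
  set C := Subgroup.centralizer (Subgroup.zpowers u : Set G) with hC
  have hcent : ∀ z, u ∈ D z → D z ≤ C := by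
    intro z hz d hd
    rw [hC, mem_cent_zpowers]
    exact hX.comm z u hz d hd
  have hux : u ∈ LL D x y := by rw [hLu]; exact Subgroup.mem_zpowers u
  have huy : u ∈ LL D y x := hL ▸ hux
  have hCx := hcent x (mem_LL.1 hux).1
  have hCy := hcent y (mem_LL.1 huy).1
  have h1 := card_orbit_sub C x
  have h2 : {q | ∃ g ∈ C, g • x = q} = line D x y := by
    apply Set.Subset.antisymm
    · rintro _ ⟨g, hg, rfl⟩ z hz
      rw [hLu] at hz
      rw [hC, Subgroup.mem_centralizer_iff] at hg
      rw [← mul_smul, hg z hz, mul_smul, fix_zpowers hz (hX.fixD x u (mem_LL.1 hux).1)]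
    · intro p hp
      by_cases hpy : p = y
      · obtain ⟨z, hz, hzx, hzy⟩ := exists_third (hX.line_card h) (by norm_num) x y
        obtain ⟨d, hd, hdz⟩ := hX.D_trans h.symm (hline ▸ hz) hzy
        obtain ⟨e, he, hey⟩ := hX.D_trans h hz hzx
        refine ⟨e⁻¹ * d, C.mul_mem (C.inv_mem (hCx he)) (hCy hd), ?_⟩
        rw [mul_smul, hdz, ← hey, inv_smul_smul, hpy]
      · obtain ⟨d, hd, hdp⟩ := hX.D_trans h.symm (hline ▸ hp) hpy
        exact ⟨d, hCy hd, hdp⟩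
  rw [h2, hX.line_card h] at h1
  exact hX.c19 u hu (by rw [← hC, h1]; exact Dvd.dvd.mul_right (by norm_num) _)

theorem Geom.LL_norm (hX : Geom G X D) {x y : X} {g v : G} (hx : g • x = x) (hy : g • y = y) (hv : v ∈ LL D x y) :
    g * v * g⁻¹ ∈ LL D x y := by
  rw [mem_LL] at *
  constructor
  · have := hX.conj g x (g * v * g⁻¹)
    rw [hx] at this
    rw [this]
    simpa [mul_assoc] using hv.1
  · have h1 : g⁻¹ • y = y := by rw [inv_smul_eq_iff, hy]
    rw [mul_smul, mul_smul, h1, hv.2, hy]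

theorem Geom.LL_disj (hX : Geom G X D) {x y : X} (h : y ≠ x) {g : G} (h1 : g ∈ LL D x y) (h2 : g ∈ LL D y x) :
    g = 1 := by
  by_contra hg
  exact hX.LL_ne h ((hX.gen_of_ne h h1 hg).trans (hX.gen_of_ne h.symm h2 hg).symm)

theorem Geom.LL_comm (hX : Geom G X D) {x y : X} (h : y ≠ x) {a b : G} (ha : a ∈ LL D x y) (hb : b ∈ LL D y x) :
    a * b = b * a := by
  have ha' := mem_LL.1 ha
  have hb' := mem_LL.1 hb
  have hax := hX.fixD x a ha'.1
  have hby := hX.fixD y b hb'.1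
  have h1 : a * b * a⁻¹ * b⁻¹ ∈ LL D y x :=
    Subgroup.mul_mem _ (hX.LL_norm ha'.2 hax hb) (inv_mem hb)
  have h2 : a * b * a⁻¹ * b⁻¹ ∈ LL D x y := by
    have : a * (b * a⁻¹ * b⁻¹) ∈ LL D x y := Subgroup.mul_mem _ ha (hX.LL_norm hb'.2 hby (inv_mem ha))
    simpa [mul_assoc] using this
  have h3 := hX.LL_disj h h2 h1
  rw [mul_inv_eq_one, mul_inv_eq_iff_eq_mul] at h3
  exact h3

theorem Geom.line_symm (hX : Geom G X D) {x y : X} (h : y ≠ x) : line D x y = line D y x := by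
  refine Set.eq_of_subset_of_ncard_le ?_ ?_ (Set.toFinite _)
  · intro p hp b hb
    by_contra hbp
    have hb' := mem_LL.1 hb
    have hb1 : b ≠ 1 := by rintro rfl; exact hbp (one_smul _ _)
    have hL := hX.gen_of_ne h.symm hb hb1
    have hc := hX.LL_card h.symm
    have h1 := card_orbit_sub (LL D y x) p
    rw [hc] at h1
    have h2 : Nat.card (LL D y x ⊓ MulAction.stabilizer G p : Subgroup G) = 1 := by
      have h3 : Nat.card (LL D y x ⊓ MulAction.stabilizer G p : Subgroup G) ∣ 37 := ⟨_, by rw [mul_comm]; exact h1⟩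
      rcases (Nat.dvd_prime (by norm_num)).1 h3 with h4 | h4
      · exact h4
      · have h5 : LL D y x ⊓ MulAction.stabilizer G p = LL D y x :=
          Subgroup.eq_of_le_of_card_ge inf_le_left (by rw [h4, hc])
        have h6 : b ∈ LL D y x ⊓ MulAction.stabilizer G p := by rw [h5]; exact hb
        exact absurd h6.2 hbp
    rw [h2, mul_one] at h1
    have h3 : {q | ∃ g ∈ LL D y x, g • p = q} ⊆ (line D x y \ {x}) \ {y} := by
      rintro _ ⟨g, hg, rfl⟩
      have hg' := mem_LL.1 hg
      have hgy := hX.fixD y g hg'.1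
      refine ⟨⟨?_, ?_⟩, ?_⟩
      · intro a ha
        rw [← mul_smul, hX.LL_comm h ha hg, mul_smul, hp a ha]
      · intro hgp
        rw [Set.mem_singleton_iff] at hgp
        rw [← hg'.2, smul_left_cancel_iff] at hgp
        rw [hgp] at hbp
        exact hbp hb'.2
      · intro hgp
        rw [Set.mem_singleton_iff] at hgp
        have hgp : g • p = g • y := hgp.trans hgy.symm
        rw [smul_left_cancel_iff] at hgp
        rw [hgp] at hbp
        exact hbp (hX.fixD y b hb'.1)
    have h4 := Set.ncard_le_ncard h3
    rw [Set.ncard_sdiff_singleton_of_mem (show y ∈ line D x y \ {x} from ⟨line_right x y, h⟩), Set.ncard_sdiff_singleton_of_mem (hX.line_left x y),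
      hX.line_card h] at h4
    omega
  · rw [hX.line_card h, hX.line_card h.symm]

theorem Geom.line_unique (hX : Geom G X D) {x y p q : X} (h : y ≠ x) (hp : p ∈ line D x y) (hq : q ∈ line D x y)
    (hpq : q ≠ p) : line D p q = line D x y := by
  by_cases hpx : p = x
  · subst hpx
    exact hX.line_eq h hq hpq
  · have h1 : line D p x = line D x y := by
      rw [← hX.line_symm hpx, hX.line_eq h hp hpx]
    rw [← h1] at hq ⊢
    exact hX.line_eq (Ne.symm hpx) hq hpq

theorem Geom.line_smul (hX : Geom G X D) (g : G) {x y p : X} (hp : p ∈ line D x y) :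
    g • p ∈ line D (g • x) (g • y) := by
  intro a ha
  rw [mem_LL, hX.conj] at ha
  have h1 : g⁻¹ * a * g ∈ LL D x y := by
    rw [mem_LL]
    refine ⟨ha.1, ?_⟩
    rw [mul_smul, mul_smul, ha.2, inv_smul_smul]
  have h2 := hp _ h1
  rw [mul_smul, mul_smul, inv_smul_eq_iff] at h2
  exact h2

theorem Geom.faithful (hX : Geom G X D) (hG : Hyp G) (n : G) (hn : ∀ x : X, n • x = x) : n = 1 := by
  set N : Subgroup G := (MulAction.toPermHom G X).ker with hN
  have hNm : ∀ g, g ∈ N ↔ ∀ x : X, g • x = x := by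
    intro g
    rw [hN, MonoidHom.mem_ker, Equiv.ext_iff]
    rfl
  have hdisj : ∀ x, ∀ d ∈ D x, d ∈ N → d = 1 := by
    intro x d hd hdN
    by_contra hd1
    have h1 := hX.fix38 x d hd hd1
    have h2 : {y : X | d • y = y} = Set.univ := by
      ext y; simp [(hNm d).1 hdN y]
    rw [h2, Set.ncard_univ, hX.cardX] at h1
    omega
  have hcomm : ∀ x, ∀ d ∈ D x, ∀ m ∈ N, d * m = m * d := by
    intro x d hd m hm
    have h1 : m * d * m⁻¹ * d⁻¹ ∈ D x := by
      refine (D x).mul_mem ?_ (inv_mem hd)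
      have := hX.conj m x (m * d * m⁻¹)
      rw [(hNm m).1 hm x] at this
      rw [this]
      simpa [mul_assoc] using hd
    have h2 : m * d * m⁻¹ * d⁻¹ ∈ N := by
      have : m * (d * m⁻¹ * d⁻¹) ∈ N := N.mul_mem hm ((MonoidHom.normal_ker _).conj_mem _ (inv_mem hm) d)
      simpa [mul_assoc] using this
    have h3 := hdisj x _ h1 h2
    rw [mul_inv_eq_one, mul_inv_eq_iff_eq_mul] at h3
    exact h3.symm
  have hne : Nonempty X := by
    by_contra h
    rw [not_nonempty_iff] at h
    have := hX.cardX
    rw [Nat.card_of_isEmpty] at this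
    omega
  obtain ⟨x⟩ := hne
  set R : Subgroup G := Subgroup.closure (⋃ y, (D y : Set G)) with hR
  have hDR : ∀ y, D y ≤ R := fun y d hd => Subgroup.subset_closure (Set.mem_iUnion.2 ⟨y, hd⟩)
  have hNR : N ≤ Subgroup.centralizer (R : Set G) := by
    rw [hR, Subgroup.centralizer_closure]
    intro m hm
    rw [Subgroup.mem_centralizer_iff]
    intro d hd
    obtain ⟨y, hy⟩ := Set.mem_iUnion.1 hd
    exact hcomm y d hy m hm
  have h67 : 67 ∣ Nat.card R := by
    have h1 := card_orbit_sub R x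
    have h2 : {q | ∃ g ∈ R, g • x = q} = Set.univ := by
      ext y
      simp only [Set.mem_ofPred_eq, Set.mem_univ, iff_true]
      by_cases hy : y = x
      · exact ⟨1, one_mem _, by rw [one_smul, hy]⟩
      · obtain ⟨z, hz, hzx, hzy⟩ := exists_third (hX.line_card hy) (by norm_num) x y
        have h3 : line D z x = line D x y := hX.line_unique hy hz (hX.line_left x y) hzx.symm
        obtain ⟨d, hd, hdy⟩ := hX.D_trans hzx.symm (h3 ▸ line_right x y) hzy.symm
        exact ⟨d, hDR z hd, hdy⟩
    rw [h2, Set.ncard_univ, hX.cardX] at h1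
    rw [h1]
    exact Dvd.dvd.mul_right (by norm_num) _
  obtain ⟨q, hq, hqo⟩ := exists_order (p := 67) R h67
  have hNQ : N ≤ Subgroup.centralizer (Subgroup.zpowers q : Set G) :=
    hNR.trans (Subgroup.centralizer_le (by
      have : Subgroup.zpowers q ≤ R := by rwa [Subgroup.zpowers_le]
      exact this))
  have hQ : Nat.card (Subgroup.zpowers q) = 67 := by rw [Nat.card_zpowers, hqo]
  have h3 := hG.c67 _ hQ
  have hN1 : Nat.card N ∣ 1407 := by
    rw [← hG.n67 _ hQ]
    exact Subgroup.card_dvd_of_le (hNQ.trans (centralizer_le_normalizer _))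
  have hN3 : ¬ 3 ∣ Nat.card N := fun h => h3 (h.trans (Subgroup.card_dvd_of_le hNQ))
  obtain ⟨u, huD, hu⟩ := exists_order (p := 37) (D x) (by rw [hX.cardD]; norm_num)
  obtain ⟨e, m, he, hm, hNe⟩ := cent_form hG hu N (fun k hk => by
    rw [mem_cent_zpowers]; exact hcomm x u huD k hk)
  have hNd : Nat.card N ∣ 37 ^ 3 * 2592 := by
    rw [hNe]; exact mul_dvd_mul (pow_dvd_pow _ he) hm
  have hc : Nat.card N = 1 := by
    have h1 := Nat.dvd_gcd hN1 hNd
    norm_num at h1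
    rcases (Nat.dvd_prime (by norm_num)).1 h1 with h | h
    · exact h
    · exact absurd (h ▸ dvd_refl _) hN3
  have := Subgroup.card_eq_one.1 hc
  have hn' : n ∈ N := (hNm n).2 hn
  rw [this] at hn'
  exact hn'

end plane2
end OD


namespace OD

section plane3
set_option linter.unusedSectionVars false

variable {G X : Type*} [Group G] [Finite G] [MulAction G X] [Finite X] {D : X → Subgroup G}

/-- elations with centre `z` and axis `l` -/
def MM (D : X → Subgroup G) (l : Set X) (z : X) : Subgroup G := D z ⊓ fixingSubgroup G l

theorem mem_MM {l : Set X} {z : X} {g : G} : g ∈ MM D l z ↔ g ∈ D z ∧ ∀ p ∈ l, g • p = p := by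
  unfold MM
  rw [Subgroup.mem_inf, mem_fixingSubgroup_iff]

theorem Geom.MM_eq (hX : Geom G X D) {x y z w : X} (h : y ≠ x) (hz : z ∈ line D x y) (hw : w ∈ line D x y)
    (hzw : w ≠ z) : MM D (line D x y) z = LL D z w := by
  ext g
  rw [mem_MM, mem_LL]
  constructor
  · exact fun hg => ⟨hg.1, hg.2 w hw⟩
  · rintro ⟨h1, h2⟩
    refine ⟨h1, fun p hp => ?_⟩
    rw [← hX.line_unique h hz hw hzw] at hp
    exact hp g (mem_LL.2 ⟨h1, h2⟩)

theorem Geom.other (hX : Geom G X D) {x y : X} (h : y ≠ x) (z : X) : ∃ w ∈ line D x y, w ≠ z := by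
  obtain ⟨w, hw, h1, -⟩ := exists_third (hX.line_card h) (by norm_num) z z
  exact ⟨w, hw, h1⟩

theorem Geom.MM_card (hX : Geom G X D) {x y z : X} (h : y ≠ x) (hz : z ∈ line D x y) :
    Nat.card (MM D (line D x y) z) = 37 := by
  obtain ⟨w, hw, h1⟩ := hX.other h z
  rw [hX.MM_eq h hz hw h1, hX.LL_card h1]

theorem Geom.MM_fix (hX : Geom G X D) {x y z p : X} (h : y ≠ x) (hz : z ∈ line D x y) {g : G}
    (hg : g ∈ MM D (line D x y) z) (hg1 : g ≠ 1) (hp : g • p = p) : p ∈ line D x y := by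
  obtain ⟨w, hw, h1⟩ := hX.other h z
  rw [hX.MM_eq h hz hw h1] at hg
  rw [← hX.line_unique h hz hw h1, hX.line_eq_fix h1 hg hg1]
  exact hp

theorem Geom.MM_comm (hX : Geom G X D) {x y z w : X} (h : y ≠ x) (hz : z ∈ line D x y) (hw : w ∈ line D x y)
    {a b : G} (ha : a ∈ MM D (line D x y) z) (hb : b ∈ MM D (line D x y) w) : a * b = b * a := by
  by_cases hzw : w = z
  · subst hzw
    exact hX.comm w a (mem_MM.1 ha).1 b (mem_MM.1 hb).1
  · rw [hX.MM_eq h hz hw hzw] at ha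
    rw [hX.MM_eq h hw hz (Ne.symm hzw)] at hb
    exact hX.LL_comm hzw ha hb

theorem Geom.MM_disj (hX : Geom G X D) {x y z w : X} (h : y ≠ x) (hz : z ∈ line D x y) (hw : w ∈ line D x y)
    (hzw : w ≠ z) {a : G} (ha : a ∈ MM D (line D x y) z) (hb : a ∈ MM D (line D x y) w) : a = 1 := by
  rw [hX.MM_eq h hz hw hzw] at ha
  rw [hX.MM_eq h hw hz (Ne.symm hzw)] at hb
  exact hX.LL_disj hzw ha hb

theorem Geom.MM_trans (hX : Geom G X D) {x y z p q : X} (h : y ≠ x) (hz : z ∈ line D x y)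
    (hp : p ∉ line D x y) (hq : q ∈ line D z p) (hqz : q ≠ z) : ∃ g ∈ MM D (line D x y) z, g • p = q := by
  have hpz : p ≠ z := by rintro rfl; exact hp hz
  have h1 := card_orbit_sub (MM D (line D x y) z) p
  have h0 : MM D (line D x y) z ⊓ MulAction.stabilizer G p = ⊥ := by
    rw [eq_bot_iff]
    rintro g ⟨hg, hgp⟩
    rw [Subgroup.mem_bot]
    by_contra hg1
    exact hp (hX.MM_fix h hz hg hg1 hgp)
  rw [hX.MM_card h hz, h0, Subgroup.card_bot, mul_one] at h1
  have h2 : {q | ∃ g ∈ MM D (line D x y) z, g • p = q} = line D z p \ {z} := by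
    refine Set.eq_of_subset_of_ncard_le ?_ ?_ (Set.toFinite _)
    · rintro _ ⟨d, hd, rfl⟩
      have hd' := (mem_MM.1 hd).1
      refine ⟨hX.D_line (line_right z p) hd', ?_⟩
      intro h3
      rw [Set.mem_singleton_iff] at h3
      have h4 : d • p = d • z := h3.trans (hX.fixD z d hd').symm
      exact hpz (smul_left_cancel _ h4)
    · rw [Set.ncard_sdiff_singleton_of_mem (hX.line_left z p), hX.line_card hpz]
      omega
  have : q ∈ line D z p \ {z} := ⟨hq, hqz⟩
  rw [← h2] at this
  exact this

theorem Geom.meet (hX : Geom G X D) {a b c d p q : X} (hab : b ≠ a) (hcd : d ≠ c) (h1 : p ∈ line D a b)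
    (h2 : q ∈ line D a b) (h3 : p ∈ line D c d) (h4 : q ∈ line D c d) (hpq : q ≠ p) : line D a b = line D c d := by
  rw [← hX.line_unique hab h1 h2 hpq, ← hX.line_unique hcd h3 h4 hpq]

theorem pz_add {e : G} (he : e ^ 37 = 1) (a b : ZMod 37) : e ^ (a + b).val = e ^ a.val * e ^ b.val := by
  rw [ZMod.val_add, ← pow_eq_pow_mod _ he, pow_add]

theorem pz_mul {e : G} (he : e ^ 37 = 1) (k a : ZMod 37) : e ^ (k * a).val = (e ^ a.val) ^ k.val := by
  rw [ZMod.val_mul, ← pow_eq_pow_mod _ he, mul_comm, pow_mul]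

theorem pz_one {e : G} (he : orderOf e = 37) (a : ZMod 37) (h : e ^ a.val = 1) : a = 0 := by
  have h1 := orderOf_dvd_of_pow_eq_one h
  rw [he] at h1
  have h2 := a.val_lt
  exact (ZMod.val_eq_zero a).1 (Nat.eq_zero_of_dvd_of_lt h1 h2)

/-- affine coordinates -/
structure Aff (D : X → Subgroup G) (l : Set X) (o : X) (φ : ZMod 37 → ZMod 37 → G) : Prop where
  add : ∀ a b a' b', φ (a + a') (b + b') = φ a b * φ a' b'
  mul : ∀ k a b, φ (k * a) (k * b) = φ a b ^ k.val
  fix : ∀ a b, ∀ p ∈ l, φ a b • p = p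
  inj : ∀ a b a' b', φ a b • o = φ a' b' • o → a = a' ∧ b = b'
  surj : ∀ p, p ∉ l → ∃ a b, φ a b • o = p
  notl : ∀ a b, φ a b • o ∉ l
  sub : ∀ z ∈ l, ∀ c ∈ MM D l z, ∃ a b, c = φ a b
  cov : ∀ a b, (a ≠ 0 ∨ b ≠ 0) → ∃ z ∈ l, φ a b ∈ MM D l z

theorem Geom.exists_aff (hX : Geom G X D) (hf : ∀ n : G, (∀ x : X, n • x = x) → n = 1) {x y o : X} (h : y ≠ x)
    (ho : o ∉ line D x y) : ∃ φ, Aff D (line D x y) o φ := by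
  classical
  have hxl := hX.line_left x y
  have hyl : y ∈ line D x y := line_right x y
  obtain ⟨e, he, hM1⟩ := zpowers_eq (p := 37) _ (hX.MM_card h hxl)
  obtain ⟨f, hfo, hM2⟩ := zpowers_eq (p := 37) _ (hX.MM_card h hyl)
  have heM : e ∈ MM D (line D x y) x := by rw [hM1]; exact Subgroup.mem_zpowers e
  have hfM : f ∈ MM D (line D x y) y := by rw [hM2]; exact Subgroup.mem_zpowers f
  have he37 : e ^ 37 = 1 := he ▸ pow_orderOf_eq_one e
  have hf37 : f ^ 37 = 1 := hfo ▸ pow_orderOf_eq_one f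
  have hef : Commute e f := hX.MM_comm h hxl hyl heM hfM
  set l := line D x y with hl
  set φ : ZMod 37 → ZMod 37 → G := fun a b => e ^ a.val * f ^ b.val with hφ
  have hadd : ∀ a b a' b', φ (a + a') (b + b') = φ a b * φ a' b' := by
    intro a b a' b'
    have := (hef.pow_pow a'.val b.val).eq
    simp only [hφ, pz_add he37, pz_add hf37]
    rw [mul_assoc, mul_assoc, ← mul_assoc (f ^ b.val), ← this, mul_assoc]
  have hmul : ∀ k a b, φ (k * a) (k * b) = φ a b ^ k.val := by
    intro k a b
    simp only [hφ, pz_mul he37, pz_mul hf37]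
    rw [(hef.pow_pow a.val b.val).mul_pow]
  have hfixe : ∀ a : ℕ, e ^ a ∈ MM D l x := fun a => pow_mem heM a
  have hfixf : ∀ a : ℕ, f ^ a ∈ MM D l y := fun a => pow_mem hfM a
  have hfix : ∀ a b, ∀ p ∈ l, φ a b • p = p := by
    intro a b p hp
    simp only [hφ]
    rw [mul_smul, (mem_MM.1 (hfixf _)).2 p hp, (mem_MM.1 (hfixe _)).2 p hp]
  have hox : o ≠ x := by rintro rfl; exact ho hxl
  have hoy : o ≠ y := by rintro rfl; exact ho hyl
  have hfree : ∀ a b, φ a b • o = o → a = 0 ∧ b = 0 := by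
    intro a b hab
    simp only [hφ] at hab
    have h1 : f ^ b.val • o = (e ^ a.val)⁻¹ • o := by
      rw [eq_inv_smul_iff, ← mul_smul, hab]
    have h2 : f ^ b.val • o ∈ line D y o := hX.D_line (line_right _ _) (mem_MM.1 (hfixf _)).1
    have h3 : f ^ b.val • o ∈ line D x o := by
      rw [h1]; exact hX.D_line (line_right _ _) (inv_mem (mem_MM.1 (hfixe _)).1)
    have h4 : f ^ b.val • o = o := by
      by_contra h5
      have h6 := hX.meet hoy hox (line_right _ _) h2 (line_right _ _) h3 h5
      have h7 : y ∈ line D x o := by rw [← h6]; exact hX.line_left _ _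
      have h8 := hX.meet h hox hxl hyl (hX.line_left _ _) h7 h
      rw [← hl] at h8
      exact ho (by rw [h8]; exact line_right _ _)
    have h5 : (e ^ a.val)⁻¹ • o = o := h1.symm.trans h4
    rw [inv_smul_eq_iff] at h5
    constructor
    · apply pz_one he
      by_contra h6
      exact ho (hX.MM_fix h hxl (hfixe _) h6 h5.symm)
    · apply pz_one hfo
      by_contra h6
      exact ho (hX.MM_fix h hyl (hfixf _) h6 h4)
  have hinj : ∀ a b a' b', φ a b • o = φ a' b' • o → a = a' ∧ b = b' := by
    intro a b a' b' hab
    have h1 := hadd a' b' (a - a') (b - b')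
    rw [add_sub_cancel, add_sub_cancel] at h1
    rw [h1, mul_smul, smul_left_cancel_iff] at hab
    have := hfree _ _ hab
    exact ⟨sub_eq_zero.1 this.1, sub_eq_zero.1 this.2⟩
  have hnotl : ∀ a b, φ a b • o ∉ l := by
    intro a b hab
    have h1 := hfix a b _ hab
    rw [smul_left_cancel_iff] at h1
    rw [h1] at hab
    exact ho hab
  have hsurj : ∀ p, p ∉ l → ∃ a b, φ a b • o = p := by
    have h1 : Set.range (fun v : ZMod 37 × ZMod 37 => φ v.1 v.2 • o) = lᶜ := by
      refine Set.eq_of_subset_of_ncard_le ?_ ?_ (Set.toFinite _)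
      · rintro _ ⟨v, rfl⟩
        exact hnotl _ _
      · have h2 : Function.Injective (fun v : ZMod 37 × ZMod 37 => φ v.1 v.2 • o) := by
          rintro ⟨a, b⟩ ⟨a', b'⟩ hab
          obtain ⟨rfl, rfl⟩ := hinj _ _ _ _ hab
          rfl
        have h3 : (Set.range (fun v : ZMod 37 × ZMod 37 => φ v.1 v.2 • o)).ncard = 37 * 37 := by
          rw [← Set.image_univ, Set.ncard_image_of_injective _ h2, Set.ncard_univ, Nat.card_prod, Nat.card_zmod]
        have h4 := Set.ncard_add_ncard_compl l
        rw [hX.cardX, (hX.line_card h : l.ncard = 38)] at h4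
        rw [h3]
        omega
    intro p hp
    have h2 : p ∈ lᶜ := hp
    rw [← h1] at h2
    obtain ⟨v, hv⟩ := h2
    exact ⟨v.1, v.2, hv⟩
  have hsub : ∀ z ∈ l, ∀ c ∈ MM D l z, ∃ a b, c = φ a b := by
    intro z hz c hc
    have hco : c • o ∉ l := by
      intro hcl
      have h1 := (mem_MM.1 hc).2 _ hcl
      rw [smul_left_cancel_iff] at h1
      rw [h1] at hcl
      exact ho hcl
    obtain ⟨a, b, hab⟩ := hsurj _ hco
    refine ⟨a, b, ?_⟩
    have hcomm : ∀ a b, Commute c (φ a b) := by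
      intro a b
      exact Commute.mul_right (hX.MM_comm h hz hxl hc (hfixe _)) (hX.MM_comm h hz hyl hc (hfixf _))
    have hcomm2 : ∀ a' b', Commute (φ a b) (φ a' b') := by
      intro a' b'
      change _ * _ = _ * _
      rw [← hadd, ← hadd, add_comm a, add_comm b]
    have h1 : (φ a b)⁻¹ * c = 1 := by
      apply hf
      intro p
      rw [mul_smul, inv_smul_eq_iff]
      by_cases hp : p ∈ l
      · rw [hfix a b p hp, (mem_MM.1 hc).2 p hp]
      · obtain ⟨a', b', rfl⟩ := hsurj p hp
        rw [← mul_smul, ← mul_smul, (hcomm a' b').eq, (hcomm2 a' b').eq, mul_smul (φ a' b') c o,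
          mul_smul (φ a' b') (φ a b) o, hab]
    exact (inv_mul_eq_one.1 h1).symm
  refine ⟨φ, hadd, hmul, hfix, hinj, hsurj, hnotl, hsub, ?_⟩
  have := Fintype.ofFinite G
  have := Fintype.ofFinite X
  have hlc : l.toFinset.card = 38 := by
    rw [← Set.ncard_eq_toFinset_card', hl, hX.line_card h]
  set B : Finset G := l.toFinset.biUnion (fun z => (Finset.univ.filter (fun g => g ∈ MM D l z)).erase 1) with hB
  set C : Finset G := ((Finset.univ : Finset (ZMod 37 × ZMod 37)).image (fun v => φ v.1 v.2)).erase 1 with hC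
  have hBC : B ⊆ C := by
    intro g hg
    rw [hB, Finset.mem_biUnion] at hg
    obtain ⟨z, hz, hg⟩ := hg
    rw [Finset.mem_erase, Finset.mem_filter] at hg
    rw [hC, Finset.mem_erase, Finset.mem_image]
    obtain ⟨a, b, hab⟩ := hsub z (Set.mem_toFinset.1 hz) g hg.2.2
    exact ⟨hg.1, (a, b), Finset.mem_univ _, hab.symm⟩
  have hφ0 : φ 0 0 = 1 := by simp [hφ]
  have hCc : C.card ≤ 1368 := by
    rw [hC, Finset.card_erase_of_mem]
    · have h1 := Finset.card_image_le (s := (Finset.univ : Finset (ZMod 37 × ZMod 37))) (f := fun v => φ v.1 v.2)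
      rw [Finset.card_univ, Fintype.card_prod, ZMod.card] at h1
      omega
    · rw [Finset.mem_image]
      exact ⟨(0, 0), Finset.mem_univ _, hφ0⟩
  have hBc : B.card = 38 * 36 := by
    rw [hB, Finset.card_biUnion, Finset.sum_congr rfl (g := fun _ => 36), Finset.sum_const, hlc]
    · rfl
    · intro z hz
      rw [Finset.card_erase_of_mem (by simp [one_mem])]
      have h1 : (Finset.univ.filter (fun g => g ∈ MM D l z)).card = 37 := by
        rw [← hX.MM_card h (Set.mem_toFinset.1 hz), Nat.card_eq_fintype_card, Fintype.card_subtype]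
      rw [h1]
    · intro z hz w hw hzw
      change Disjoint _ _
      rw [Finset.disjoint_left]
      intro g hg hg'
      rw [Finset.mem_erase, Finset.mem_filter] at hg hg'
      exact hg.1 (hX.MM_disj h (Set.mem_toFinset.1 hz) (Set.mem_toFinset.1 hw) (Ne.symm hzw) hg.2.2 hg'.2.2)
  have hEq : B = C := Finset.eq_of_subset_of_card_le hBC (by rw [hBc]; exact hCc)
  intro a b hab
  have h1 : φ a b ∈ C := by
    rw [hC, Finset.mem_erase, Finset.mem_image]
    refine ⟨?_, (a, b), Finset.mem_univ _, rfl⟩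
    intro h1
    have h2 := hfree a b (by rw [h1, one_smul])
    rcases hab with h3 | h3
    · exact h3 h2.1
    · exact h3 h2.2
  rw [← hEq, hB, Finset.mem_biUnion] at h1
  obtain ⟨z, hz, hg⟩ := h1
  rw [Finset.mem_erase, Finset.mem_filter] at hg
  exact ⟨z, Set.mem_toFinset.1 hz, hg.2.2⟩

end plane3
end OD


namespace OD

section plane4
set_option linter.unusedSectionVars false

variable {G X : Type*} [Group G] [Finite G] [MulAction G X] [Finite X] {D : X → Subgroup G}

/-- homogeneous coordinates -/
structure Coord (D : X → Subgroup G) (θ : (Fin 3 → ZMod 37) → X) : Prop where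
  scale : ∀ (k : ZMod 37) (v : Fin 3 → ZMod 37), k ≠ 0 → v ≠ 0 → θ (k • v) = θ v
  inj : ∀ v w : Fin 3 → ZMod 37, v ≠ 0 → w ≠ 0 → θ v = θ w → ∃ k : ZMod 37, k ≠ 0 ∧ w = k • v
  surj : ∀ x, ∃ v : Fin 3 → ZMod 37, v ≠ 0 ∧ θ v = x
  coll : ∀ (v w : Fin 3 → ZMod 37) (a b : ZMod 37), v ≠ 0 → w ≠ 0 → θ v ≠ θ w → a • v + b • w ≠ 0 →
    θ (a • v + b • w) ∈ line D (θ v) (θ w)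

theorem vec_ne {v : Fin 3 → ZMod 37} (hv : v ≠ 0) (h2 : v 2 = 0) : v 0 ≠ 0 ∨ v 1 ≠ 0 := by
  by_contra hc
  push Not at hc
  apply hv
  funext i
  fin_cases i
  · exact hc.1
  · exact hc.2
  · exact h2

theorem vec_ext {v w : Fin 3 → ZMod 37} (h0 : v 0 = w 0) (h1 : v 1 = w 1) (h2 : v 2 = w 2) : v = w := by
  funext i
  fin_cases i
  · exact h0
  · exact h1
  · exact h2

theorem Geom.exists_coord (hX : Geom G X D) (hf : ∀ n : G, (∀ x : X, n • x = x) → n = 1) :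
    ∃ θ, Coord D θ := by
  classical
  -- a line and a point off it
  have hnt : ∃ x y : X, y ≠ x := by
    by_contra hc
    push Not at hc
    have h1 : Subsingleton X := ⟨fun a b => hc b a⟩
    have h2 := Finite.card_le_one_iff_subsingleton.2 h1
    rw [hX.cardX] at h2
    omega
  obtain ⟨x, y, hxy⟩ := hnt
  have hlc := hX.line_card hxy
  have hoe : ∃ o, o ∉ line D x y := by
    by_contra hc
    push Not at hc
    have h1 : line D x y = Set.univ := Set.eq_univ_of_forall hc
    rw [h1, Set.ncard_univ, hX.cardX] at hlc
    omega
  obtain ⟨o, ho⟩ := hoe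
  obtain ⟨φ, hA⟩ := hX.exists_aff hf hxy ho
  have hdisj : ∀ z ∈ line D x y, ∀ w ∈ line D x y, ∀ g ∈ MM D (line D x y) z, g ∈ MM D (line D x y) w → g ≠ 1 → z = w := by
    intro z hz w hw g hg hg' hg1
    by_contra hzw
    exact hg1 (hX.MM_disj hxy hz hw (Ne.symm hzw) hg hg')
  have hslope : ∀ a b, ∃ z, (a ≠ 0 ∨ b ≠ 0) → z ∈ line D x y ∧ φ a b ∈ MM D (line D x y) z := by
    intro a b
    by_cases hab : a ≠ 0 ∨ b ≠ 0
    · obtain ⟨z, hz, h⟩ := hA.cov a b hab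
      exact ⟨z, fun _ => ⟨hz, h⟩⟩
    · exact ⟨x, fun h => absurd h hab⟩
  choose s hs using hslope
  have hMg : ∀ z ∈ line D x y, ∃ u, orderOf u = 37 ∧ MM D (line D x y) z = Subgroup.zpowers u :=
    fun z hz => zpowers_eq (p := 37) _ (hX.MM_card hxy hz)
  have hMne : ∀ z ∈ line D x y, ∃ u ∈ MM D (line D x y) z, u ≠ 1 := by
    intro z hz
    obtain ⟨u, hu, hL⟩ := hMg z hz
    refine ⟨u, by rw [hL]; exact Subgroup.mem_zpowers u, ?_⟩
    rintro rfl
    rw [orderOf_one] at hu; omega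
  have hlu : ∀ p ∈ line D x y, ∀ q ∈ line D x y, q ≠ p → line D p q = line D x y :=
    fun p hp q hq hpq => hX.line_unique hxy hp hq hpq
  generalize line D x y = l at *
  have hφ0 : φ 0 0 = 1 := by
    have := hA.mul 0 0 0
    simpa using this
  have hφ1 : ∀ a b, (a ≠ 0 ∨ b ≠ 0) → φ a b ≠ 1 := by
    intro a b hab h1
    have := hA.inj a b 0 0 (by rw [h1, hφ0])
    rcases hab with h | h
    · exact h this.1
    · exact h this.2
  set θ : (Fin 3 → ZMod 37) → X := fun v => if v 2 = 0 then s (v 0) (v 1) else φ (v 0 / v 2) (v 1 / v 2) • o with hθ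
  have hinf : ∀ v, v 2 = 0 → θ v = s (v 0) (v 1) := fun v h => by simp only [hθ, if_pos h]
  have haff : ∀ v, v 2 ≠ 0 → θ v = φ (v 0 / v 2) (v 1 / v 2) • o := fun v h => by simp only [hθ, if_neg h]
  have hinf' : ∀ v, v ≠ 0 → v 2 = 0 → θ v ∈ l ∧ φ (v 0) (v 1) ∈ MM D l (θ v) := by
    intro v hv h2
    rw [hinf v h2]
    exact hs _ _ (vec_ne hv h2)
  have haff' : ∀ v, v 2 ≠ 0 → θ v ∉ l := by
    intro v h2
    rw [haff v h2]
    exact hA.notl _ _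
  clear_value θ
  have hsm : ∀ (k : ZMod 37) (v : Fin 3 → ZMod 37) (i : Fin 3), (k • v) i = k * v i := fun k v i => rfl
  have hscale : ∀ (k : ZMod 37) (v : Fin 3 → ZMod 37), k ≠ 0 → v ≠ 0 → θ (k • v) = θ v := by
    intro k v hk hv
    by_cases h2 : v 2 = 0
    · have hkv : k • v ≠ 0 := smul_ne_zero hk hv
      have hkv2 : (k • v) 2 = 0 := by rw [hsm, h2, mul_zero]
      have h3 := hinf' v hv h2
      have h4 := hinf' (k • v) hkv hkv2
      refine (hdisj _ h3.1 _ h4.1 _ ?_ h4.2 (hφ1 _ _ (vec_ne hkv hkv2))).symm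
      rw [hsm, hsm, hA.mul]
      exact pow_mem h3.2 _
    · rw [haff v h2, haff (k • v) (by rw [hsm]; exact mul_ne_zero hk h2), hsm, hsm, hsm,
        mul_div_mul_left _ _ hk, mul_div_mul_left _ _ hk]
  have hinj : ∀ v w : Fin 3 → ZMod 37, v ≠ 0 → w ≠ 0 → θ v = θ w → ∃ k : ZMod 37, k ≠ 0 ∧ w = k • v := by
    intro v w hv hw hvw
    by_cases h2 : v 2 = 0
    · have h3 := hinf' v hv h2
      by_cases h2' : w 2 = 0
      · have h4 := hinf' w hw h2'
        rw [← hvw] at h4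
        obtain ⟨u, hu, hL⟩ := hMg _ h3.1
        have h5 := hφ1 _ _ (vec_ne hv h2)
        obtain ⟨n, hn⟩ := prime_gen hu (hL ▸ h3.2) h5 (hL ▸ h4.2)
        have h6 : φ (w 0) (w 1) = φ ((n : ZMod 37) * v 0) ((n : ZMod 37) * v 1) := by
          rw [hA.mul, ZMod.val_natCast, hn]
          exact pow_eq_pow_mod n (hX.exp _ _ (mem_MM.1 h3.2).1)
        have h7 := hA.inj _ _ _ _ (congrArg (fun g => g • o) h6)
        have h8 : w = (n : ZMod 37) • v := vec_ext h7.1 h7.2 (by rw [hsm, h2, h2', mul_zero])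
        refine ⟨n, ?_, h8⟩
        intro h9
        rw [h9, zero_smul] at h8
        exact hw h8
      · exact absurd (hvw ▸ h3.1) (haff' w h2')
    · by_cases h2' : w 2 = 0
      · exact absurd (hvw ▸ (hinf' w hw h2').1) (haff' v h2)
      · rw [haff v h2, haff w h2'] at hvw
        have h3 := hA.inj _ _ _ _ hvw
        refine ⟨w 2 / v 2, div_ne_zero h2' h2, vec_ext ?_ ?_ ?_⟩
        · rw [hsm]
          have := h3.1
          field_simp at this ⊢
          linear_combination -this
        · rw [hsm]
          have := h3.2
          field_simp at this ⊢
          linear_combination -this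
        · rw [hsm]
          field_simp
  have hPL : ∀ (v d : Fin 3 → ZMod 37) (a b : ZMod 37), v 2 ≠ 0 → d 2 = 0 → d ≠ 0 → a • v + b • d ≠ 0 →
      θ (a • v + b • d) ∈ line D (θ d) (θ v) := by
    intro v d a b hv hd hd0 hu
    by_cases ha : a = 0
    · subst ha
      rw [zero_smul, zero_add] at hu ⊢
      have hb : b ≠ 0 := by rintro rfl; exact hu (zero_smul _ _)
      rw [hscale b d hb hd0]
      exact hX.line_left _ _
    · have hap : ∀ i, (a • v + b • d) i = a * v i + b * d i := fun i => rfl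
      have hu2 : (a • v + b • d) 2 = a * v 2 := by rw [hap, hd, mul_zero, add_zero]
      have hu2' : (a • v + b • d) 2 ≠ 0 := by rw [hu2]; exact mul_ne_zero ha hv
      have e0 : ∀ i, (a • v + b • d) i / (a • v + b • d) 2 = (b / (a * v 2)) * d i + v i / v 2 := by
        intro i
        rw [hu2, hap]
        field_simp
        ring
      rw [haff _ hu2', e0, e0, hA.add, mul_smul, hA.mul, ← haff v hv]
      exact hX.D_line (line_right _ _) (pow_mem (mem_MM.1 (hinf' d hd0 hd).2).1 _)
  -- collinearity when `v` is affine
  have hC1 : ∀ (v w : Fin 3 → ZMod 37) (a b : ZMod 37), v 2 ≠ 0 → v ≠ 0 → w ≠ 0 → θ v ≠ θ w → a • v + b • w ≠ 0 →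
      θ (a • v + b • w) ∈ line D (θ v) (θ w) := by
    intro v w a b hv2 hv hw hvw hu
    set d := v 2 • w - w 2 • v with hd
    have hd2 : d 2 = 0 := by
      change v 2 * w 2 - w 2 * v 2 = 0
      ring
    have hwd : w = (w 2 / v 2) • v + (1 / v 2) • d := by
      funext i
      change w i = w 2 / v 2 * v i + 1 / v 2 * (v 2 * w i - w 2 * v i)
      field_simp
      ring
    have hd0 : d ≠ 0 := by
      intro h0
      rw [h0, smul_zero, add_zero] at hwd
      have hk : w 2 / v 2 ≠ 0 := by
        intro hk
        rw [hk, zero_smul] at hwd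
        exact hw hwd
      apply hvw
      rw [hwd, hscale _ _ hk hv]
    have hdv : θ v ≠ θ d := by
      intro h
      exact haff' v hv2 (h ▸ (hinf' d hd0 hd2).1)
    have h1 : θ v ∈ line D (θ d) (θ v) := line_right _ _
    have h2 : θ w ∈ line D (θ d) (θ v) := by
      have := hPL v d (w 2 / v 2) (1 / v 2) hv2 hd2 hd0 (by rw [← hwd]; exact hw)
      rwa [← hwd] at this
    have h3 : a • v + b • w = (a + b * (w 2 / v 2)) • v + (b * (1 / v 2)) • d := by
      conv_lhs => rw [hwd]
      module
    have h4 : θ (a • v + b • w) ∈ line D (θ d) (θ v) := by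
      rw [h3] at hu ⊢
      exact hPL v d _ _ hv2 hd2 hd0 hu
    rw [hX.line_unique hdv h1 h2 hvw.symm]
    exact h4
  refine ⟨θ, hscale, hinj, ?_, ?_⟩
  · intro p
    by_cases hp : p ∈ l
    · obtain ⟨u, hu, hu1⟩ := hMne p hp
      obtain ⟨a, b, rfl⟩ := hA.sub p hp u hu
      have hv : (![a, b, 0] : Fin 3 → ZMod 37) ≠ 0 := by
        intro h0
        have ha : a = 0 := congrFun h0 0
        have hb : b = 0 := congrFun h0 1
        rw [ha, hb] at hu1
        exact hu1 hφ0
      have h1 := hinf' ![a, b, 0] hv rfl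
      exact ⟨_, hv, hdisj _ h1.1 _ hp _ h1.2 hu hu1⟩
    · obtain ⟨a, b, hab⟩ := hA.surj p hp
      refine ⟨![a, b, 1], ?_, ?_⟩
      · intro h0
        have h1 : (1 : ZMod 37) = 0 := congrFun h0 2
        exact one_ne_zero h1
      · rw [haff _ (show (1 : ZMod 37) ≠ 0 from one_ne_zero), ← hab]
        change φ (a / 1) (b / 1) • o = _
        rw [div_one, div_one]
  · intro v w a b hv hw hvw hu
    by_cases hv2 : v 2 = 0
    · by_cases hw2 : w 2 = 0
      · rw [hlu _ (hinf' v hv hv2).1 _ (hinf' w hw hw2).1 hvw.symm]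
        refine (hinf' _ hu ?_).1
        change a * v 2 + b * w 2 = 0
        rw [hv2, hw2, mul_zero, mul_zero, add_zero]
      · rw [hX.line_symm hvw.symm, add_comm]
        rw [add_comm] at hu
        exact hC1 w v b a hw2 hw hv hvw.symm hu
    · exact hC1 v w a b hv2 hv hw hvw hu

end plane4
end OD


open scoped Pointwise

namespace OD

section ident1

variable {G : Type*} [Group G] [Finite G]

attribute [local instance] conjAction

theorem exists_geom (hG : Hyp G) : ∃ D : Subgroup G, Geom G (MulAction.orbit G D) (fun x => x.1) := by
  obtain ⟨D, hD, hN, htr, hexp, hfix⟩ := step5 hG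
  refine ⟨D, ?_⟩
  have hst : MulAction.stabilizer G D = Subgroup.normalizer (D : Set G) := by
    ext g
    rw [MulAction.mem_stabilizer_iff, conj_eq_iff_mem_normalizer]
  have hval : ∀ (g : G) (x : MulAction.orbit G D), (g • x).1 = g • x.1 := fun g x => rfl
  have hrep : ∀ x : MulAction.orbit G D, ∃ g : G, x.1 = g • D := by
    rintro ⟨x, g, rfl⟩
    exact ⟨g, rfl⟩
  have hc : ∀ x : MulAction.orbit G D, Nat.card x.1 = 37 ^ 2 := by
    intro x
    obtain ⟨g, hg⟩ := hrep x
    rw [hg, conj_card, hD]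
  refine ⟨?_, hc, ?_, ?_, ?_, ?_, ?_, ?_, ?_, ?_⟩
  · have h1 := MulAction.index_stabilizer G D
    have h2 := Subgroup.index_mul_card (MulAction.stabilizer G D)
    rw [hst, hN] at h2
    rw [hst] at h1
    rw [h1, hG.card] at h2
    rw [Nat.card_coe_set_eq]
    omega
  · intro g x d
    rw [hval, conj_mem_iff]
  · intro x d hd
    apply Subtype.ext
    rw [hval, conj_eq_iff_mem_normalizer]
    exact Subgroup.le_normalizer hd
  · intro x y h
    obtain ⟨g, hg⟩ := hrep x
    obtain ⟨k, hk⟩ := hrep y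
    have h1 := hfix (g⁻¹ * k) ?_
    · apply Subtype.ext
      rw [hk, hg, ← inv_smul_eq_iff, ← mul_smul, h1]
    · intro d hd
      have h2 : g * d * g⁻¹ ∈ x.1 := by rw [hg]; exact conj_mem_conj g d D hd
      have h3 := congrArg Subtype.val (h _ h2)
      rw [hval, hk] at h3
      rw [← conj_eq_iff_mem_normalizer, ← mul_smul]
      have h4 : g⁻¹ • ((g * d * g⁻¹) • (k • D)) = g⁻¹ • (k • D) := by rw [h3]
      rw [← mul_smul, ← mul_smul, ← mul_smul] at h4
      rw [← h4]
      congr 1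
      group
  · intro x y
    obtain ⟨g, hg⟩ := hrep x
    obtain ⟨k, hk⟩ := hrep y
    refine ⟨k * g⁻¹, Subtype.ext ?_⟩
    rw [hval, hg, hk, ← mul_smul, inv_mul_cancel_right]
  · intro x d hd hd1 e he he1
    obtain ⟨g, hg⟩ := hrep x
    simp only [hg, conj_mem_iff] at hd he
    obtain ⟨p, hp, hpe⟩ := htr _ hd (by
      intro h; apply hd1
      have : d = g * (g⁻¹ * d * g) * g⁻¹ := by group
      rw [this, h]; group) _ he (by
      intro h; apply he1
      have : e = g * (g⁻¹ * e * g) * g⁻¹ := by group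
      rw [this, h]; group)
    refine ⟨g * p * g⁻¹, Subtype.ext ?_, ?_⟩
    · rw [hval, hg, ← mul_smul, inv_mul_cancel_right, mul_smul, (conj_eq_iff_mem_normalizer p D).2 hp]
    · have : e = g * (g⁻¹ * e * g) * g⁻¹ := by group
      rw [this, ← hpe]; group
  · intro x d hd
    obtain ⟨g, hg⟩ := hrep x
    simp only [hg, conj_mem_iff] at hd
    have h1 := hexp _ hd
    have h2 : d = g * (g⁻¹ * d * g) * g⁻¹ := by group
    rw [h2, conj_pow, h1, mul_one, mul_inv_cancel]
  · intro x d hd e he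
    have := comm_of_card_sq (p := 37) x.1 (hc x) he
    rw [Subgroup.mem_centralizer_iff] at this
    exact this d hd
  · intro u hu h
    have := hG.c37 u hu 19 (by norm_num) h
    omega

end ident1
end OD


namespace OD

section ident2
set_option linter.unusedSectionVars false

variable {G X : Type*} [Group G] [Finite G] [MulAction G X] [Finite X] {D : X → Subgroup G}

theorem Coord.transv (hX : Geom G X D) {θ : (Fin 3 → ZMod 37) → X} (hθ : Coord D θ)
    (f : (Fin 3 → ZMod 37) →ₗ[ZMod 37] ZMod 37) (c h₀ r : Fin 3 → ZMod 37)
    (hc : c ≠ 0) (fc : f c = 0) (fh : f h₀ = 0) (fr : f r = 1) (hh₀ : ∀ k : ZMod 37, h₀ ≠ k • c)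
    (hspan : ∀ v, f v = 0 → ∃ a b : ZMod 37, v = a • c + b • h₀) :
    ∃ g : G, ∀ v, v ≠ 0 → g • θ v = θ (v + f v • c) := by
  have hns : ∀ h : Fin 3 → ZMod 37, (∀ k : ZMod 37, h ≠ k • c) → h ≠ 0 ∧ θ h ≠ θ c := by
    intro h hk
    have h0 : h ≠ 0 := by
      have := hk 0
      rwa [zero_smul] at this
    refine ⟨h0, fun he => ?_⟩
    obtain ⟨k, -, hk'⟩ := hθ.inj c h hc h0 he.symm
    exact hk k hk'
  have hh0 := hns h₀ hh₀
  have fne : ∀ v, f v ≠ 0 → v ≠ 0 := by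
    rintro v hv rfl
    exact hv (map_zero f)
  have hH : ∀ v, v ≠ 0 → f v = 0 → θ v ∈ line D (θ c) (θ h₀) := by
    intro v hv hfv
    obtain ⟨a, b, rfl⟩ := hspan v hfv
    exact hθ.coll c h₀ a b hc hh0.1 hh0.2.symm hv
  have hsep : ∀ u v, f u ≠ 0 → f v = 0 → v ≠ 0 → θ u ≠ θ v := by
    intro u v hu hv hv0 h
    obtain ⟨k, hk, rfl⟩ := hθ.inj u v (fne u hu) hv0 h
    rw [map_smul, smul_eq_mul] at hv
    exact mul_ne_zero hk hu hv
  have hlc := hX.line_card hh0.2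
  have hH' : ∀ u, f u ≠ 0 → θ u ∉ line D (θ c) (θ h₀) := by
    intro u hu hum
    have hall : line D (θ c) (θ h₀) = Set.univ := by
      apply Set.eq_univ_of_forall
      intro x
      obtain ⟨v, hv, rfl⟩ := hθ.surj x
      by_cases hfv : f v = 0
      · exact hH v hv hfv
      have hfh : f (v - (f v / f u) • u) = 0 := by
        rw [map_sub, map_smul, smul_eq_mul, div_mul_cancel₀ _ hu, sub_self]
      have hvd : (f v / f u) • u + (1 : ZMod 37) • (v - (f v / f u) • u) = v := by
        rw [one_smul, add_sub_cancel]
      by_cases h0 : v - (f v / f u) • u = 0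
      · rw [sub_eq_zero.1 h0, hθ.scale _ _ (div_ne_zero hfv hu) (fne u hu)]
        exact hum
      · have h1 := hsep u _ hu hfh h0
        have h2 := hθ.coll u _ (f v / f u) 1 (fne u hu) h0 h1 (by rw [hvd]; exact hv)
        rw [hvd] at h2
        rwa [hX.line_unique hh0.2 hum (hH _ h0 hfh) h1.symm] at h2
    rw [hall, Set.ncard_univ, hX.cardX] at hlc
    omega
  have hcm : θ c ∈ line D (θ c) (θ h₀) := hX.line_left _ _
  have fadd : ∀ u, f (u + c) = f u := fun u => by rw [map_add, fc, add_zero]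
  have hthr : ∀ u, f u ≠ 0 → θ (u + c) ∈ line D (θ c) (θ u) := by
    intro u hu
    have h1 := hθ.coll c u 1 1 hc (fne u hu) (hsep u c hu fc hc).symm
      (by rw [one_smul, one_smul, add_comm]; exact fne _ (by rw [fadd]; exact hu))
    rwa [one_smul, one_smul, add_comm] at h1
  have fr0 : f r ≠ 0 := by rw [fr]; exact one_ne_zero
  obtain ⟨g, hg, hgr⟩ := hX.MM_trans hh0.2 hcm (hH' r fr0) (hthr r fr0)
    (hsep _ _ (by rw [fadd]; exact fr0) fc hc)
  rw [mem_MM] at hg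
  refine ⟨g, ?_⟩
  have claim : ∀ r', f r' = 1 → g • θ r' = θ (r' + c) → ∀ h, f h = 0 → (∀ k : ZMod 37, h ≠ k • c) →
      g • θ (r' + h) = θ (r' + h + c) := by
    intro r' hr' hgr' h hfh hk
    have hr0 : f r' ≠ 0 := by rw [hr']; exact one_ne_zero
    have hh := hns h hk
    have fu : f (r' + h) ≠ 0 := by rw [map_add, hfh, add_zero]; exact hr0
    have h1 : θ (r' + h) ∈ line D (θ r') (θ h) := by
      have := hθ.coll r' h 1 1 (fne _ hr0) hh.1 (hsep _ _ hr0 hfh hh.1) (by rw [one_smul, one_smul]; exact fne _ fu)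
      rwa [one_smul, one_smul] at this
    have hrc : f (r' + c) ≠ 0 := by rw [fadd]; exact hr0
    have huc : f (r' + h + c) ≠ 0 := by rw [fadd]; exact fu
    have h2 := hX.line_smul g h1
    have hm := hH h hh.1 hfh
    rw [hgr', hg.2 _ hm] at h2
    have hne := hsep _ _ hrc hfh hh.1
    have e1 : r' + c + h = r' + h + c := by abel
    have h3 : θ (r' + h + c) ∈ line D (θ (r' + c)) (θ h) := by
      have := hθ.coll (r' + c) h 1 1 (fne _ hrc) hh.1 hne (by rw [one_smul, one_smul, e1]; exact fne _ huc)
      rwa [one_smul, one_smul, e1] at this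
    have h4 : g • θ (r' + h) ∈ line D (θ c) (θ (r' + h)) := hX.D_line (line_right _ _) hg.1
    have h5 := hthr _ fu
    by_contra hcon
    have h6 := hX.meet hne.symm (hsep _ _ fu fc hc) h2 h3 h4 h5 (Ne.symm hcon)
    have h7 : θ h ∈ line D (θ c) (θ (r' + h)) := h6 ▸ line_right _ _
    have h8 := hX.line_unique (hsep _ _ fu fc hc) (hX.line_left _ _) h7 hh.2
    have h9 := hX.line_unique hh0.2 hcm hm hh.2
    apply hH' _ fu
    rw [← h9, h8]
    exact line_right _ _
  have hone : ∀ u, f u = 1 → g • θ u = θ (u + c) := by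
    intro u hu
    have fd : f (u - r) = 0 := by rw [map_sub, hu, fr, sub_self]
    by_cases hk : ∀ k : ZMod 37, u - r ≠ k • c
    · have := claim r fr hgr (u - r) fd hk
      rwa [add_sub_cancel] at this
    · push Not at hk
      obtain ⟨k, hk⟩ := hk
      have h1 := claim r fr hgr h₀ fh hh₀
      have h2 := claim (r + h₀) (by rw [map_add, fh, add_zero, fr]) h1 (u - r - h₀)
        (by rw [map_sub, fd, fh, sub_zero]) (by
          intro k' hk'
          apply hh₀ (k - k')
          rw [sub_smul, ← hk, ← hk']
          abel)
      have e : r + h₀ + (u - r - h₀) = u := by abel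
      rwa [e] at h2
  intro v hv
  by_cases hfv : f v = 0
  · rw [hfv, zero_smul, add_zero]
    exact hg.2 _ (hH v hv hfv)
  · have h1 := hone ((f v)⁻¹ • v) (by rw [map_smul, smul_eq_mul, inv_mul_cancel₀ hfv])
    rw [hθ.scale _ _ (inv_ne_zero hfv) hv] at h1
    have h2 : v + f v • c = f v • ((f v)⁻¹ • v + c) := by
      rw [smul_add, smul_inv_smul₀ hfv]
    rw [h1, h2, hθ.scale _ _ hfv]
    apply fne
    rw [fadd, map_smul, smul_eq_mul, inv_mul_cancel₀ hfv]
    exact one_ne_zero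

end ident2
end OD


open scoped MatrixGroups

namespace OD

section ident3
set_option linter.unusedSectionVars false

variable {G X : Type*} [Group G] [Finite G] [MulAction G X] [Finite X] {D : X → Subgroup G}

open Matrix

theorem third_index (i j : Fin 3) (h : i ≠ j) : ∃ k, k ≠ i ∧ k ≠ j ∧ ∀ m, m = i ∨ m = j ∨ m = k := by
  revert i j; decide

/-- the action of `SL(3, 37)` on vectors -/
def mv (A : SL(3, ZMod 37)) (v : Fin 3 → ZMod 37) : Fin 3 → ZMod 37 :=
  (A : Matrix (Fin 3) (Fin 3) (ZMod 37)) *ᵥ v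

theorem mv_mul (A B : SL(3, ZMod 37)) (v : Fin 3 → ZMod 37) : mv (A * B) v = mv A (mv B v) := by
  unfold mv
  rw [Matrix.SpecialLinearGroup.coe_mul, mulVec_mulVec]

theorem mv_one (v : Fin 3 → ZMod 37) : mv 1 v = v := by
  unfold mv
  rw [Matrix.SpecialLinearGroup.coe_one, one_mulVec]

theorem mv_ne (A : SL(3, ZMod 37)) {v : Fin 3 → ZMod 37} (hv : v ≠ 0) : mv A v ≠ 0 := by
  intro h0
  apply hv
  have h1 : mv (A⁻¹ * A) v = 0 := by
    rw [mv_mul, h0]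
    exact mulVec_zero _
  rwa [inv_mul_cancel, mv_one] at h1

theorem mv_trans (i j : Fin 3) (hij : i ≠ j) (b : ZMod 37) (v : Fin 3 → ZMod 37) :
    mv (Matrix.SpecialLinearGroup.transvection hij b) v = v + v j • (b • Pi.single i 1) := by
  unfold mv
  rw [Matrix.SpecialLinearGroup.transvection_coe, add_mulVec, one_mulVec]
  congr 1
  rw [Matrix.single_mulVec]
  funext m
  by_cases hm : m = i
  · subst hm; simp [mul_comm]
  · simp [hm]

theorem mv_trans_same (i j : Fin 3) (hij : i ≠ j) (b : ZMod 37) (v : Fin 3 → ZMod 37) :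
    mv (Matrix.SpecialLinearGroup.transvection hij b) v i = v i + v j * b := by
  rw [mv_trans]; simp

theorem mv_trans_ne (i j m : Fin 3) (hij : i ≠ j) (hm : m ≠ i) (b : ZMod 37) (v : Fin 3 → ZMod 37) :
    mv (Matrix.SpecialLinearGroup.transvection hij b) v m = v m := by
  rw [mv_trans]; simp [hm]

theorem mv_diag (i j : Fin 3) (hij : i ≠ j) {c : ZMod 37} (hc : c ≠ 0) (v : Fin 3 → ZMod 37) (m : Fin 3) :
    mv (Matrix.SpecialLinearGroup.diag2n hij c hc) v m = (if m = i then c else if m = j then c⁻¹ else 1) * v m := by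
  unfold mv
  rw [Matrix.SpecialLinearGroup.diag2n_coe, mulVec_diagonal]

theorem Coord.transv_mat (hX : Geom G X D) {θ : (Fin 3 → ZMod 37) → X} (hθ : Coord D θ)
    (i j : Fin 3) (hij : i ≠ j) (b : ZMod 37) :
    ∃ g : G, ∀ v, v ≠ 0 → g • θ v = θ (mv (Matrix.SpecialLinearGroup.transvection hij b) v) := by
  simp only [mv_trans]
  by_cases hb : b = 0
  · refine ⟨1, fun v _ => ?_⟩
    rw [hb, zero_smul, smul_zero, add_zero, one_smul]
  obtain ⟨k, hki, hkj, hk⟩ := third_index i j hij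
  refine hθ.transv hX (LinearMap.proj j) (b • Pi.single i 1) (Pi.single k 1) (Pi.single j 1) ?_ ?_ ?_ ?_ ?_ ?_
  · intro h
    have := congrFun h i
    simp [hb] at this
  · simp [hij.symm]
  · simp [hkj.symm]
  · simp
  · intro c h
    have := congrFun h k
    simp [hki] at this
  · intro v hv
    have hv' : v j = 0 := hv
    refine ⟨v i / b, v k, ?_⟩
    funext m
    rcases hk m with rfl | rfl | rfl
    · simp [hki.symm, hb]
    · simp [hij.symm, hkj.symm, hv']
    · simp [hki]

theorem diag_decomp (i j : Fin 3) (hij : i ≠ j) {c : ZMod 37} (hc : c ≠ 0) (v : Fin 3 → ZMod 37) :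
    mv (Matrix.SpecialLinearGroup.diag2n hij c hc) v =
      mv (Matrix.SpecialLinearGroup.transvection hij c * Matrix.SpecialLinearGroup.transvection hij.symm (-c⁻¹) *
      Matrix.SpecialLinearGroup.transvection hij c * Matrix.SpecialLinearGroup.transvection hij (-1) *
      Matrix.SpecialLinearGroup.transvection hij.symm 1 * Matrix.SpecialLinearGroup.transvection hij (-1)) v := by
  obtain ⟨k, hki, hkj, hk⟩ := third_index i j hij
  have a1 := fun b w => mv_trans_same i j hij b w
  have a2 := fun b w => mv_trans_same j i hij.symm b w
  have a3 := fun b w => mv_trans_ne i j j hij hij.symm b w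
  have a4 := fun b w => mv_trans_ne j i i hij.symm hij b w
  have a5 := fun b w => mv_trans_ne i j k hij hki b w
  have a6 := fun b w => mv_trans_ne j i k hij.symm hkj b w
  simp only [mv_mul]
  funext m
  rw [mv_diag]
  rcases hk m with rfl | rfl | rfl
  · rw [if_pos rfl]
    simp only [a1, a2, a3, a4]
    field_simp
    ring
  · rw [if_neg hij.symm, if_pos rfl]
    simp only [a1, a2, a3, a4]
    field_simp
    ring
  · rw [if_neg hki, if_neg hkj]
    simp only [a5, a6, one_mul]

theorem Coord.act (hX : Geom G X D) {θ : (Fin 3 → ZMod 37) → X} (hθ : Coord D θ) (A : SL(3, ZMod 37)) :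
    ∃ g : G, ∀ v, v ≠ 0 → g • θ v = θ (mv A v) := by
  have hmul : ∀ A B : SL(3, ZMod 37), (∃ g : G, ∀ v, v ≠ 0 → g • θ v = θ (mv A v)) →
      (∃ g : G, ∀ v, v ≠ 0 → g • θ v = θ (mv B v)) → ∃ g : G, ∀ v, v ≠ 0 → g • θ v = θ (mv (A * B) v) := by
    rintro A B ⟨g, hg⟩ ⟨k, hk⟩
    refine ⟨g * k, fun v hv => ?_⟩
    rw [mul_smul, hk v hv, hg _ (mv_ne B hv), mv_mul]
  refine Matrix.SpecialLinearGroup.diagonal_transvection_induction'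
    (fun A => ∃ g : G, ∀ v, v ≠ 0 → g • θ v = θ (mv A v)) A ?_ ?_ hmul
  · intro i j hij c hc
    simp only [diag_decomp i j hij hc]
    have hT := fun (i j : Fin 3) (hij : i ≠ j) (b : ZMod 37) => hθ.transv_mat hX i j hij b
    exact hmul _ _ (hmul _ _ (hmul _ _ (hmul _ _ (hmul _ _ (hT _ _ _ _) (hT _ _ _ _)) (hT _ _ _ _)) (hT _ _ _ _))
      (hT _ _ _ _)) (hT _ _ _ _)
  · exact fun i j hij b => hθ.transv_mat hX i j hij b

theorem card_SL : 3 * (2 ^ 5 * 3 ^ 4 * 7 * 19 * 37 ^ 3 * 67) ≤ Nat.card SL(3, ZMod 37) := by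
  have h1 := Matrix.card_GL_field (𝔽 := ZMod 37) 3
  have h2 := Subgroup.card_mul_index (MonoidHom.ker (GeneralLinearGroup.det (n := Fin 3) (R := ZMod 37)))
  rw [Subgroup.index_ker] at h2
  have h3 : Nat.card (MonoidHom.range (GeneralLinearGroup.det (n := Fin 3) (R := ZMod 37))) ≤ 36 := by
    refine le_trans (Subgroup.card_le_card_group _) ?_
    rw [Nat.card_units, Nat.card_eq_fintype_card, ZMod.card]
  have h4 : Nat.card (MonoidHom.ker (GeneralLinearGroup.det (n := Fin 3) (R := ZMod 37))) ≤ Nat.card SL(3, ZMod 37) := by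
    refine Nat.card_le_card_of_injective (fun A => (⟨A.1.1, ?_⟩ : SL(3, ZMod 37))) ?_
    · have h5 := A.2
      rw [MonoidHom.mem_ker] at h5
      exact congrArg Units.val h5
    · intro A B h
      apply Subtype.ext
      apply Units.ext
      exact congrArg Subtype.val h
  rw [h1, Fin.prod_univ_three] at h2
  simp only [Fintype.card_fin, ZMod.card, Fin.val_zero, Fin.val_one, Fin.val_two] at h2
  have h6 := Nat.mul_le_mul h4 h3
  rw [h2] at h6
  norm_num at h6 ⊢
  omega

theorem scalar_of_eig (M : Matrix (Fin 3) (Fin 3) (ZMod 37))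
    (h : ∀ v : Fin 3 → ZMod 37, v ≠ 0 → ∃ k : ZMod 37, M *ᵥ v = k • v) : ∃ k, M = scalar (Fin 3) k := by
  obtain ⟨k0, h0⟩ := h ![1, 0, 0] (fun h => one_ne_zero (congrFun h 0))
  obtain ⟨k1, h1⟩ := h ![0, 1, 0] (fun h => one_ne_zero (congrFun h 1))
  obtain ⟨k2, h2⟩ := h ![0, 0, 1] (fun h => one_ne_zero (congrFun h 2))
  obtain ⟨k3, h3⟩ := h ![1, 1, 1] (fun h => one_ne_zero (congrFun h 2))
  have key : ∀ m a b c k, M *ᵥ ![a, b, c] = k • ![a, b, c] →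
      M m 0 * a + M m 1 * b + M m 2 * c = k * ![a, b, c] m := by
    intro m a b c k h
    have := congrFun h m
    simp only [mulVec, dotProduct, Fin.sum_univ_three] at this
    exact this
  have a0 : ∀ m, M m 0 = k0 * ![1, 0, 0] m := fun m => by rw [← key m 1 0 0 k0 h0]; ring
  have a1 : ∀ m, M m 1 = k1 * ![0, 1, 0] m := fun m => by rw [← key m 0 1 0 k1 h1]; ring
  have a2 : ∀ m, M m 2 = k2 * ![0, 0, 1] m := fun m => by rw [← key m 0 0 1 k2 h2]; ring
  have a3 : ∀ m, k0 * ![1, 0, 0] m + k1 * ![0, 1, 0] m + k2 * ![0, 0, 1] m = k3 * ![1, 1, 1] m := fun m => by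
    rw [← key m 1 1 1 k3 h3, a0, a1, a2]; ring
  have e0 : k0 = k3 := by
    have h4 : k0 * 1 + k1 * 0 + k2 * 0 = k3 * 1 := a3 0
    linear_combination h4
  have e1 : k1 = k3 := by
    have h4 : k0 * 0 + k1 * 1 + k2 * 0 = k3 * 1 := a3 1
    linear_combination h4
  have e2 : k2 = k3 := by
    have h4 : k0 * 0 + k1 * 0 + k2 * 1 = k3 * 1 := a3 2
    linear_combination h4
  refine ⟨k3, ?_⟩
  rw [e0] at a0
  rw [e1] at a1
  rw [e2] at a2
  ext m n
  fin_cases n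
  · refine (a0 m).trans ?_
    fin_cases m <;> simp
  · refine (a1 m).trans ?_
    fin_cases m <;> simp
  · refine (a2 m).trans ?_
    fin_cases m <;> simp

theorem Coord.iso (hX : Geom G X D) {θ : (Fin 3 → ZMod 37) → X} (hθ : Coord D θ)
    (hf : ∀ n : G, (∀ x : X, n • x = x) → n = 1) (hcard : Nat.card G = 2 ^ 5 * 3 ^ 4 * 7 * 19 * 37 ^ 3 * 67) :
    Nonempty (G ≃* PSL(3, ZMod 37)) := by
  choose f hfA using fun A => hθ.act hX A
  have huniq : ∀ g k : G, (∀ v, v ≠ 0 → g • θ v = k • θ v) → g = k := by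
    intro g k h
    have := hf (k⁻¹ * g) (by
      intro x
      obtain ⟨v, hv, rfl⟩ := hθ.surj x
      rw [mul_smul, h v hv, inv_smul_smul])
    exact (inv_mul_eq_one.1 this).symm
  let F : SL(3, ZMod 37) →* G := MonoidHom.mk' f (by
    intro A B
    apply huniq
    intro v hv
    rw [hfA _ v hv, mul_smul, hfA B v hv, hfA A _ (mv_ne B hv), mv_mul])
  have hker : F.ker = Subgroup.center SL(3, ZMod 37) := by
    ext A
    rw [MonoidHom.mem_ker, Matrix.SpecialLinearGroup.mem_center_iff]
    constructor
    · intro h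
      have h' : f A = 1 := h
      have h1 : ∀ v : Fin 3 → ZMod 37, v ≠ 0 → ∃ k : ZMod 37, mv A v = k • v := by
        intro v hv
        have h2 := hfA A v hv
        rw [h', one_smul] at h2
        obtain ⟨k, -, hk⟩ := hθ.inj v _ hv (mv_ne A hv) h2
        exact ⟨k, hk⟩
      obtain ⟨k3, e⟩ := scalar_of_eig (A : Matrix (Fin 3) (Fin 3) (ZMod 37)) h1
      refine ⟨k3, ?_, e.symm⟩
      have hd := A.det_coe
      rw [e] at hd
      simpa using hd
    · rintro ⟨r, hr, hA⟩
      change f A = 1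
      apply huniq
      intro v hv
      have hr0 : r ≠ 0 := by
        rintro rfl
        simp at hr
      rw [hfA A v hv, one_smul, mv, ← hA]
      have : (scalar (Fin 3) r) *ᵥ v = r • v := by
        funext m
        simp [scalar_apply, mulVec_diagonal]
      rw [this, hθ.scale r v hr0 hv]
  have hZ : Nat.card (Subgroup.center SL(3, ZMod 37)) ≤ 3 := by
    rw [Nat.card_congr (Matrix.SpecialLinearGroup.center_equiv_rootsOfUnity' (R := ZMod 37) (0 : Fin 3)).toEquiv]
    exact card_rootsOfUnity (ZMod 37) 3
  have hsurj : Function.Surjective F := by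
    rw [← MonoidHom.range_eq_top]
    apply Subgroup.eq_top_of_le_card
    have h1 := Subgroup.card_mul_index F.ker
    rw [Subgroup.index_ker, hker] at h1
    have h2 := card_SL
    rw [← h1] at h2
    have h3 := Nat.mul_le_mul_right (Nat.card F.range) hZ
    rw [hcard]
    omega
  exact ⟨((QuotientGroup.quotientMulEquivOfEq hker.symm).trans
    (QuotientGroup.quotientKerEquivOfSurjective F hsurj)).symm⟩

theorem main (hG : Hyp G) : Nonempty (G ≃* PSL(3, ZMod 37)) := by
  let _ := conjAction (G := G)
  obtain ⟨D, hX⟩ := exists_geom hG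
  have hf := fun n hn => hX.faithful hG n hn
  obtain ⟨θ, hθ⟩ := hX.exists_coord hf
  exact hθ.iso hX hf hG.card

end ident3
end OD

theorem L3_37_OD_characterizable (G : Type*) [Group G] [Finite G]
    (hcard : Nat.card G = 2 ^ 5 * 3 ^ 4 * 7 * 19 * 37 ^ 3 * 67)
    (hdeg2 : primeGraphDeg G 2 = 3)
    (hdeg3 : primeGraphDeg G 3 = 3)
    (hdeg7 : primeGraphDeg G 7 = 1)
    (hdeg19 : primeGraphDeg G 19 = 2)
    (hdeg37 : primeGraphDeg G 37 = 2)
    (hdeg67 : primeGraphDeg G 67 = 1) :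
    Nonempty (G ≃* PSL(3, ZMod 37)) := by
  exact OD.main (OD.hyp_of_deg hcard hdeg2 hdeg3 hdeg7 hdeg37 hdeg67)
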